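/- Let n ≥ 2 with n ≠ 3 and n ≠ 7, or n = 5. Then there is no continuous map assigning to each point x of the sphere Sⁿ a basis of the tangent space TₓSⁿ; i.e., the tangent bundle of Sⁿ is not trivial. -/

import Mathlib

set_option linter.unusedVariables false
set_option linter.unusedSectionVars false

namespace SphereParallel

open Matrix unitInterval

/-- A continuous family of invertible complex matrices. -/
def IsGL {Y ι : Type} [TopologicalSpace Y] [Fintype ι] [DecidableEq ι]
    (g : Y → Matrix ι ι ℂ) : Prop :=
  Continuous g ∧ ∀ y, IsUnit (g y)

/-- A continuous family of idempotent complex matrices. -/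
def IsIdem {X ι : Type} [TopologicalSpace X] [Fintype ι] (P : X → Matrix ι ι ℂ) : Prop :=
  Continuous P ∧ ∀ x, P x * P x = P x

/-- An integer invariant of families of idempotents: additive on orthogonal sums and invariant
under algebraic equivalence. -/
structure IdemFun (X : Type) [TopologicalSpace X] where
  val : ∀ {ι : Type} [Fintype ι] [DecidableEq ι], (X → Matrix ι ι ℂ) → ℤ
  add' : ∀ {ι : Type} [Fintype ι] [DecidableEq ι] {P Q : X → Matrix ι ι ℂ},
    IsIdem P → IsIdem Q → (∀ x, P x * Q x = 0) → (∀ x, Q x * P x = 0) →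
      val (fun x => P x + Q x) = val P + val Q
  equiv' : ∀ {ι κ : Type} [Fintype ι] [DecidableEq ι] [Fintype κ] [DecidableEq κ]
    {u : X → Matrix ι κ ℂ} {v : X → Matrix κ ι ℂ}, Continuous u → Continuous v →
      IsIdem (fun x => u x * v x) → IsIdem (fun x => v x * u x) →
        val (fun x => u x * v x) = val (fun x => v x * u x)

/-- An integer invariant of families of invertible matrices: homotopy invariant, multiplicative
and stable. -/
structure GLFun (Y : Type) [TopologicalSpace Y] where
  val : ∀ {ι : Type} [Fintype ι] [DecidableEq ι], (Y → Matrix ι ι ℂ) → ℤ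
  homotopy' : ∀ {ι : Type} [Fintype ι] [DecidableEq ι] {G : I × Y → Matrix ι ι ℂ},
    IsGL G → val (fun y => G (0, y)) = val (fun y => G (1, y))
  mul' : ∀ {ι : Type} [Fintype ι] [DecidableEq ι] {g h : Y → Matrix ι ι ℂ},
    IsGL g → IsGL h → val (fun y => g y * h y) = val g + val h
  block1' : ∀ {ι κ : Type} [Fintype ι] [DecidableEq ι] [Fintype κ] [DecidableEq κ]
    {g : Y → Matrix ι ι ℂ}, IsGL g →
      val (fun y => fromBlocks (g y) 0 0 (1 : Matrix κ κ ℂ)) = val g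
  block2' : ∀ {ι κ : Type} [Fintype ι] [DecidableEq ι] [Fintype κ] [DecidableEq κ]
    {g : Y → Matrix ι ι ℂ}, IsGL g →
      val (fun y => fromBlocks (1 : Matrix κ κ ℂ) 0 0 (g y)) = val g

section Basic

variable {X Y Z ι κ : Type} [TopologicalSpace X] [TopologicalSpace Y] [TopologicalSpace Z]
  [Fintype ι] [DecidableEq ι] [Fintype κ] [DecidableEq κ]

theorem isUnit_of_mul_eq_one {a b : Matrix ι ι ℂ} (h : a * b = 1) : IsUnit a :=
  IsUnit.of_mul_eq_one b h

theorem isUnit_smul {c : ℂ} (hc : c ≠ 0) {a : Matrix ι ι ℂ} (ha : IsUnit a) : IsUnit (c • a) := by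
  obtain ⟨b, hb⟩ := ha.exists_right_inv
  refine isUnit_of_mul_eq_one (b := c⁻¹ • b) ?_
  rw [smul_mul_smul_comm, hb, mul_inv_cancel₀ hc, one_smul]

theorem IsGL.mul_inv {g : Y → Matrix ι ι ℂ} (h : IsGL g) (y : Y) : g y * (g y)⁻¹ = 1 :=
  Matrix.mul_nonsing_inv _ ((Matrix.isUnit_iff_isUnit_det _).1 (h.2 y))

theorem IsGL.inv_mul {g : Y → Matrix ι ι ℂ} (h : IsGL g) (y : Y) : (g y)⁻¹ * g y = 1 :=
  Matrix.nonsing_inv_mul _ ((Matrix.isUnit_iff_isUnit_det _).1 (h.2 y))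

theorem IsGL.inv {g : Y → Matrix ι ι ℂ} (h : IsGL g) : IsGL fun y => (g y)⁻¹ := by
  refine ⟨?_, fun y => isUnit_of_mul_eq_one (h.inv_mul y)⟩
  have h1 : ∀ y, (g y).det ≠ 0 := fun y => ((Matrix.isUnit_iff_isUnit_det _).1 (h.2 y)).ne_zero
  have h2 := h.1
  simp only [Matrix.inv_def, Ring.inverse_eq_inv']
  exact (Continuous.inv₀ (by fun_prop) h1).smul (by fun_prop)

theorem IsGL.mul {g h : Y → Matrix ι ι ℂ} (hg : IsGL g) (hh : IsGL h) :
    IsGL fun y => g y * h y :=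
  ⟨hg.1.matrix_mul hh.1, fun y => (hg.2 y).mul (hh.2 y)⟩

theorem IsGL.of_mul {g h : Y → Matrix ι ι ℂ} (hg : Continuous g) (H : ∀ y, g y * h y = 1) :
    IsGL g := ⟨hg, fun y => isUnit_of_mul_eq_one (H y)⟩

theorem IsGL.comp {g : Y → Matrix ι ι ℂ} (hg : IsGL g) {f : Z → Y} (hf : Continuous f) :
    IsGL fun z => g (f z) := ⟨hg.1.comp hf, fun z => hg.2 _⟩

theorem isGL_one : IsGL (fun _ : Y => (1 : Matrix ι ι ℂ)) := ⟨continuous_const, fun _ => isUnit_one⟩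

theorem IsIdem.comp {P : Y → Matrix ι ι ℂ} (hg : IsIdem P) {f : Z → Y} (hf : Continuous f) :
    IsIdem fun z => P (f z) := ⟨hg.1.comp hf, fun z => hg.2 _⟩

theorem isIdem_one : IsIdem (fun _ : Y => (1 : Matrix ι ι ℂ)) := ⟨continuous_const, by simp⟩

theorem isIdem_zero : IsIdem (fun _ : Y => (0 : Matrix ι ι ℂ)) := ⟨continuous_const, by simp⟩

theorem IsIdem.compl {P : Y → Matrix ι ι ℂ} (h : IsIdem P) : IsIdem fun y => 1 - P y :=
  ⟨by have := h.1; fun_prop, fun y => by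
    have := h.2 y
    simp only [mul_sub, sub_mul, this]; simp⟩

theorem isUnit_fromBlocks_diag {a : Matrix ι ι ℂ} {b : Matrix κ κ ℂ} (ha : IsUnit a)
    (hb : IsUnit b) : IsUnit (fromBlocks a 0 0 b) := by
  rw [Matrix.isUnit_iff_isUnit_det, Matrix.det_fromBlocks_zero₂₁]
  exact ((Matrix.isUnit_iff_isUnit_det _).1 ha).mul ((Matrix.isUnit_iff_isUnit_det _).1 hb)

theorem IsGL.fromBlocks {g : Y → Matrix ι ι ℂ} {h : Y → Matrix κ κ ℂ} (hg : IsGL g)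
    (hh : IsGL h) : IsGL fun y => fromBlocks (g y) 0 0 (h y) :=
  ⟨by have := hg.1; have := hh.1; fun_prop, fun y => isUnit_fromBlocks_diag (hg.2 y) (hh.2 y)⟩

/-- The identity plus a matrix acting on the range of an idempotent. -/
theorem corner_mul {E G H : Matrix ι ι ℂ} (hE : E * E = E) (hG : E * G = G * E) :
    (1 - E + E * G) * (1 - E + E * H) = 1 - E + E * (G * H) := by
  have h1 : E * G * E = E * G := by rw [mul_assoc, ← hG, ← mul_assoc, hE]
  have : (1 - E + E * G) * (1 - E + E * H)
      = 1 - E - E + E * E + E * H - E * E * H + E * G - E * G * E + E * G * E * H := by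
    noncomm_ring
  rw [this, h1, hE]; noncomm_ring

theorem IsGL.corner {E G : Y → Matrix ι ι ℂ} (hE : IsIdem E) (hG : IsGL G)
    (hc : ∀ y, E y * G y = G y * E y) : IsGL fun y => 1 - E y + E y * G y := by
  refine IsGL.of_mul (h := fun y => 1 - E y + E y * (G y)⁻¹) ?_ fun y => ?_
  · have := hE.1; have := hG.1; fun_prop
  · rw [corner_mul (hE.2 y) (hc y), hG.mul_inv]; simp

end Basic

namespace IdemFun

variable {X ι κ : Type} [TopologicalSpace X]
  [Fintype ι] [DecidableEq ι] [Fintype κ] [DecidableEq κ] (φ : IdemFun X)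

theorem val_zero : φ.val (fun _ => (0 : Matrix ι ι ℂ)) = 0 := by
  have := φ.add' (isIdem_zero (ι := ι)) isIdem_zero (by simp) (by simp)
  simpa using this

theorem congr {P Q : X → Matrix ι ι ℂ} (h : ∀ x, P x = Q x) : φ.val P = φ.val Q := by
  rw [funext h]

theorem equiv {P : X → Matrix ι ι ℂ} {Q : X → Matrix κ κ ℂ} (hP : IsIdem P) (hQ : IsIdem Q)
    {u : X → Matrix ι κ ℂ} {v : X → Matrix κ ι ℂ} (hu : Continuous u) (hv : Continuous v)
    (h1 : ∀ x, u x * v x = P x) (h2 : ∀ x, v x * u x = Q x) : φ.val P = φ.val Q := by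
  obtain rfl : (fun x => u x * v x) = P := funext h1
  obtain rfl : (fun x => v x * u x) = Q := funext h2
  exact φ.equiv' hu hv hP hQ

theorem conj {P Q : X → Matrix ι ι ℂ} (hP : IsIdem P) (hQ : IsIdem Q)
    {u : X → Matrix ι ι ℂ} (hu : IsGL u) (h : ∀ x, u x * P x = Q x * u x) :
    φ.val P = φ.val Q := by
  refine φ.equiv hP hQ (u := fun x => (u x)⁻¹) (v := fun x => u x * P x) hu.inv.1
    (hu.1.matrix_mul hP.1) (fun x => ?_) (fun x => ?_)
  · rw [← mul_assoc, hu.inv_mul, one_mul]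
  · rw [h, mul_assoc, hu.mul_inv, mul_one]

theorem fromBlocks {P : X → Matrix ι ι ℂ} {Q : X → Matrix κ κ ℂ} (hP : IsIdem P)
    (hQ : IsIdem Q) : φ.val (fun x => Matrix.fromBlocks (P x) 0 0 (Q x)) = φ.val P + φ.val Q := by
  have hP1 := hP.1
  have hQ1 := hQ.1
  have iP : IsIdem (fun x => Matrix.fromBlocks (P x) 0 0 (0 : Matrix κ κ ℂ)) :=
    ⟨by fun_prop, fun x => by simp [fromBlocks_multiply, hP.2]⟩
  have iQ : IsIdem (fun x => Matrix.fromBlocks (0 : Matrix ι ι ℂ) 0 0 (Q x)) :=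
    ⟨by fun_prop, fun x => by simp [fromBlocks_multiply, hQ.2]⟩
  have e1 : φ.val (fun x => Matrix.fromBlocks (P x) 0 0 (0 : Matrix κ κ ℂ)) = φ.val P := by
    refine φ.equiv iP hP (u := fun x => Matrix.fromRows (P x) 0)
      (v := fun x => Matrix.fromCols (P x) 0) ?_ ?_ (fun x => ?_) (fun x => ?_)
    · refine continuous_matrix fun i j => ?_
      rcases i with i | i
      · exact hP1.matrix_elem i j
      · exact continuous_const
    · refine continuous_matrix fun i j => ?_
      rcases j with j | j
      · exact hP1.matrix_elem i j
      · exact continuous_const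
    · rw [Matrix.fromRows_mul_fromCols]; simp [hP.2]
    · rw [Matrix.fromCols_mul_fromRows]; simp [hP.2]
  have e2 : φ.val (fun x => Matrix.fromBlocks (0 : Matrix ι ι ℂ) 0 0 (Q x)) = φ.val Q := by
    refine φ.equiv iQ hQ (u := fun x => Matrix.fromRows 0 (Q x))
      (v := fun x => Matrix.fromCols 0 (Q x)) ?_ ?_ (fun x => ?_) (fun x => ?_)
    · refine continuous_matrix fun i j => ?_
      rcases i with i | i
      · exact continuous_const
      · exact hQ1.matrix_elem i j
    · refine continuous_matrix fun i j => ?_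
      rcases j with j | j
      · exact continuous_const
      · exact hQ1.matrix_elem i j
    · rw [Matrix.fromRows_mul_fromCols]; simp [hQ.2]
    · rw [Matrix.fromCols_mul_fromRows]; simp [hQ.2]
  rw [← e1, ← e2, ← φ.add' iP iQ (by simp [fromBlocks_multiply]) (by simp [fromBlocks_multiply])]
  simp [fromBlocks_add]

end IdemFun

namespace GLFun

variable {Y ι κ : Type} [TopologicalSpace Y]
  [Fintype ι] [DecidableEq ι] [Fintype κ] [DecidableEq κ] (μ : GLFun Y)

theorem congr {g h : Y → Matrix ι ι ℂ} (H : ∀ x, g x = h x) : μ.val g = μ.val h := by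
  rw [funext H]

theorem val_one : μ.val (fun _ => (1 : Matrix ι ι ℂ)) = 0 := by
  have := μ.mul' (isGL_one (ι := ι)) isGL_one
  simpa using this

theorem of_mul_eq_one {g h : Y → Matrix ι ι ℂ} (hg : IsGL g) (hh : IsGL h)
    (H : ∀ y, g y * h y = 1) : μ.val g + μ.val h = 0 := by
  rw [← μ.mul' hg hh, ← μ.val_one (ι := ι)]
  exact μ.congr H

theorem conj {g h W : Y → Matrix ι ι ℂ} (hg : IsGL g) (hh : IsGL h) (hW : IsGL W)
    (H : ∀ y, W y * g y = h y * W y) : μ.val g = μ.val h := by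
  have h1 := μ.mul' hW hg
  have h2 := μ.mul' hh hW
  rw [μ.congr H] at h1
  omega

theorem homotopy {G : I × Y → Matrix ι ι ℂ} (hG : IsGL G) {g h : Y → Matrix ι ι ℂ}
    (h0 : ∀ y, G (0, y) = g y) (h1 : ∀ y, G (1, y) = h y) : μ.val g = μ.val h := by
  rw [← funext h0, ← funext h1]
  exact μ.homotopy' hG

theorem block {g : Y → Matrix ι ι ℂ} {h : Y → Matrix κ κ ℂ} (hg : IsGL g) (hh : IsGL h) :
    μ.val (fun y => fromBlocks (g y) 0 0 (h y)) = μ.val g + μ.val h := by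
  rw [← μ.block1' (κ := κ) hg, ← μ.block2' (κ := ι) hh,
    ← μ.mul' (hg.fromBlocks isGL_one) (isGL_one.fromBlocks hh)]
  exact μ.congr fun y => by simp [fromBlocks_multiply]

/-- Invariance under conjugation of corners. -/
theorem corner {E G : Y → Matrix κ κ ℂ} (hE : IsIdem E) (hG : IsGL G)
    (hc : ∀ y, E y * G y = G y * E y) {u : Y → Matrix ι κ ℂ} {v : Y → Matrix κ ι ℂ}
    (hu : Continuous u) (hv : Continuous v) (huv : ∀ y, v y * u y = E y)
    (huE : ∀ y, u y * E y = u y) (hEv : ∀ y, E y * v y = v y) :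
    μ.val (fun y => 1 - u y * v y + u y * G y * v y) = μ.val (fun y => 1 - E y + E y * G y) := by
  have hE1 := hE.1
  have hG1 := hG.1
  have i1 : ∀ y, u y * v y * (u y * v y) = u y * v y := fun y => by
    rw [Matrix.mul_assoc, ← Matrix.mul_assoc (v y), huv, hEv]
  have i2 : ∀ y, u y * v y * u y = u y := fun y => by
    rw [Matrix.mul_assoc, huv, huE]
  have i3 : ∀ y, v y * (u y * v y) = v y := fun y => by
    rw [← Matrix.mul_assoc, huv, hEv]
  have g1 : IsGL fun y => 1 - E y + E y * G y := hG.corner hE hc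
  have hmul : ∀ (A B : Matrix κ κ ℂ) (y : Y), E y * A = A * E y →
      (1 - u y * v y + u y * A * v y) * (1 - u y * v y + u y * B * v y)
        = 1 - u y * v y + u y * (A * B) * v y := fun A B y hA => by
    have e1 : u y * A * v y * (u y * v y) = u y * A * v y := by
      rw [Matrix.mul_assoc (u y * A), i3]
    have e2 : u y * v y * (u y * B * v y) = u y * B * v y := by
      rw [Matrix.mul_assoc (u y) B, ← Matrix.mul_assoc (u y * v y), i2]
    have e3 : u y * A * v y * (u y * B * v y) = u y * (A * B) * v y := by
      calc u y * A * v y * (u y * B * v y) = u y * (A * (v y * u y)) * (B * v y) := by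
            simp only [Matrix.mul_assoc]
        _ = u y * E y * A * (B * v y) := by rw [huv, ← hA]; simp only [Matrix.mul_assoc]
        _ = _ := by rw [huE]; simp only [Matrix.mul_assoc]
    rw [mul_add, add_mul, add_mul, e3]
    simp only [sub_mul, mul_sub, one_mul, mul_one, i1, e1, e2]
    abel
  have g2 : IsGL fun y => 1 - u y * v y + u y * G y * v y := by
    refine IsGL.of_mul (h := fun y => 1 - u y * v y + u y * (G y)⁻¹ * v y) (by fun_prop)
      fun y => ?_
    rw [hmul _ _ _ (hc y), hG.mul_inv]
    simp
  rw [← μ.block1' (κ := κ) g2, ← μ.block2' (κ := ι) g1]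
  have z1 : ∀ y, (1 - u y * v y) * u y = 0 := fun y => by rw [Matrix.sub_mul, i2]; simp
  have z2 : ∀ y, v y * (1 - u y * v y) = 0 := fun y => by rw [Matrix.mul_sub, i3]; simp
  have z3 : ∀ y, u y * (1 - E y) = 0 := fun y => by rw [Matrix.mul_sub, huE]; simp
  have z4 : ∀ y, (1 - E y) * v y = 0 := fun y => by rw [Matrix.sub_mul, hEv]; simp
  have z5 : ∀ y, (1 - u y * v y) * (1 - u y * v y) = 1 - u y * v y := fun y => by
    simp [mul_sub, sub_mul, i1]
  have z6 : ∀ y, (1 - E y) * (1 - E y) = 1 - E y := fun y => hE.compl.2 y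
  have hW : IsGL fun y => Matrix.fromBlocks (1 - u y * v y) (u y) (v y) (1 - E y) := by
    refine IsGL.of_mul
      (h := fun y => Matrix.fromBlocks (1 - u y * v y) (u y) (v y) (1 - E y)) (by fun_prop)
      fun y => ?_
    rw [fromBlocks_multiply, z1, z2, z3, z4, z5, z6, huv]
    simp
  refine μ.conj (g2.fromBlocks isGL_one) (isGL_one.fromBlocks g1) hW fun y => ?_
  have c1 : (1 - u y * v y) * (u y * G y * v y) = 0 := by
    rw [Matrix.mul_assoc, ← Matrix.mul_assoc, z1, Matrix.zero_mul]
  have c2 : v y * (u y * G y * v y) = E y * G y * v y := by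
    simp only [← Matrix.mul_assoc, huv]
  rw [fromBlocks_multiply, fromBlocks_multiply]
  simp only [Matrix.mul_zero, Matrix.zero_mul, add_zero, zero_add, Matrix.mul_one, Matrix.one_mul,
    Matrix.mul_add, Matrix.add_mul, c1, c2, z2, z4, z5, z6]
  rw [Matrix.mul_assoc (E y) (G y) (1 - E y), Matrix.mul_sub (G y), Matrix.mul_sub (E y), ← hc y,
    ← Matrix.mul_assoc (E y) (E y), hE.2]
  simp

/-- Homotopy invariance along straight segments. -/
theorem segment {g h : Y → Matrix ι ι ℂ} (hg : Continuous g) (hh : Continuous h)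
    (H : ∀ y, ∀ t : ℝ, 0 ≤ t → t ≤ 1 → IsUnit ((1 - (t : ℂ)) • g y + (t : ℂ) • h y)) :
    μ.val g = μ.val h := by
  refine μ.homotopy (G := fun p => (1 - ((p.1 : ℝ) : ℂ)) • g p.2 + ((p.1 : ℝ) : ℂ) • h p.2)
    ⟨by fun_prop, fun p => H _ _ p.1.2.1 p.1.2.2⟩ (by simp) (by simp)

theorem pos_smul {g : Y → Matrix ι ι ℂ} (hg : IsGL g) {δ : Y → ℝ} (hδ : Continuous δ)
    (hpos : ∀ y, 0 < δ y) : μ.val (fun y => (δ y : ℂ) • g y) = μ.val g := by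
  have hg1 := hg.1
  symm
  refine μ.segment hg1 (by fun_prop) fun y t h0 h1 => ?_
  have : (1 - (t : ℂ)) • g y + (t : ℂ) • (δ y : ℂ) • g y = ((1 - t + t * δ y : ℝ) : ℂ) • g y := by
    rw [smul_smul, ← add_smul]; push_cast; rfl
  rw [this]
  have hp : 0 < 1 - t + t * δ y := by
    rcases eq_or_lt_of_le h1 with rfl | h1
    · simpa using hpos y
    · have := mul_nonneg h0 (hpos y).le; linarith
  exact isUnit_smul (by exact_mod_cast hp.ne') (hg.2 y)

theorem blockDiagonal {K : Type} [Fintype K] [DecidableEq K] {g : K → Y → Matrix ι ι ℂ}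
    (hg : ∀ k, IsGL (g k)) :
    μ.val (fun y => Matrix.blockDiagonal fun k => g k y) = ∑ k, μ.val (g k) := by
  have bdGL : ∀ f : K → Y → Matrix ι ι ℂ, (∀ k, IsGL (f k)) →
      IsGL (fun y => Matrix.blockDiagonal fun k => f k y) := fun f hf => by
    refine IsGL.of_mul (h := fun y => Matrix.blockDiagonal fun k => (f k y)⁻¹) ?_ fun y => ?_
    · have := fun k => (hf k).1
      fun_prop
    · rw [← Matrix.blockDiagonal_mul]
      simp only [(hf _).mul_inv]
      exact Matrix.blockDiagonal_one
  have single : ∀ k, μ.val (fun y => Matrix.blockDiagonal fun j => if j = k then g k y else 1)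
      = μ.val (g k) := fun k => by
    let u : Matrix (ι × K) ι ℂ := Matrix.of fun p i => if p.2 = k ∧ p.1 = i then 1 else 0
    let v : Matrix ι (ι × K) ℂ := Matrix.of fun i p => if p.2 = k ∧ p.1 = i then 1 else 0
    have huv : v * u = 1 := by
      ext i j
      simp [u, v, Matrix.mul_apply, Fintype.sum_prod_type, Matrix.one_apply, ite_and, eq_comm]
    have := μ.corner (E := fun _ => (1 : Matrix ι ι ℂ)) (G := g k) isIdem_one (hg k) (by simp)
      (u := fun _ => u) (v := fun _ => v) continuous_const continuous_const (fun _ => huv)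
      (by simp) (by simp)
    rw [μ.congr (h := g k) (fun y => by simp)] at this
    · rw [← this]
      refine μ.congr fun y => ?_
      ext ⟨i, a⟩ ⟨j, b⟩
      simp only [u, v, Matrix.add_apply, Matrix.sub_apply, Matrix.mul_apply, Matrix.of_apply,
        ite_and, Matrix.blockDiagonal_apply, Matrix.one_apply, Prod.mk.injEq]
      by_cases ha : a = k <;> by_cases hb : b = k
      · subst ha; subst hb
        by_cases hij : i = j <;> simp [hij]
      · have : ¬ k = b := fun h => hb h.symm
        subst ha; simp [hb, this]
      · subst hb; simp [ha]
      · by_cases hab : a = b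
        · subst hab; simp [ha, Matrix.one_apply]
        · simp [ha, hb, hab]
  have key : ∀ s : Finset K,
      μ.val (fun y => Matrix.blockDiagonal fun k => if k ∈ s then g k y else 1)
        = ∑ k ∈ s, μ.val (g k) := fun s => by
    induction s using Finset.induction_on with
    | empty =>
      simp only [Finset.notMem_empty, if_false, Finset.sum_empty]
      rw [← μ.val_one (ι := ι × K)]
      exact μ.congr fun y => Matrix.blockDiagonal_one
    | insert k s hk ih =>
      rw [Finset.sum_insert hk, ← ih, ← single k, ← μ.mul']
      · refine μ.congr fun y => ?_
        rw [← Matrix.blockDiagonal_mul]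
        congr 1
        funext j
        by_cases hj : j = k
        · subst hj; simp [hk]
        · simp [hj]
      · refine bdGL (fun j y => if j = k then g k y else 1) fun j => ?_
        by_cases hj : j = k
        · simpa [hj] using hg k
        · simpa [hj] using isGL_one
      · refine bdGL (fun j y => if j ∈ s then g j y else 1) fun j => ?_
        by_cases hj : j ∈ s
        · simpa [hj] using hg j
        · simpa [hj] using isGL_one
  simpa using key Finset.univ

end GLFun
end SphereParallel

namespace SphereParallel

open Matrix unitInterval

section Average

variable {ι J : Type} [Fintype ι] [DecidableEq ι]

/-- The average of `1` over the operators `T ↦ a j * T * b j`. -/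
noncomputable def clAvg (l : List J) (a b : J → Matrix ι ι ℂ) : Matrix ι ι ℂ :=
  l.foldr (fun j T => (1 / 2 : ℂ) • (T + a j * T * b j)) 1

theorem clAvg_self (l : List J) (a : J → Matrix ι ι ℂ) (ha : ∀ j, a j * a j = 1) :
    clAvg l a a = 1 := by
  induction l with
  | nil => rfl
  | cons j l ih =>
    change (1 / 2 : ℂ) • (clAvg l a a + a j * clAvg l a a * a j) = 1
    rw [ih, mul_one, ha, ← two_smul ℂ (1 : Matrix ι ι ℂ), smul_smul]; norm_num

theorem clAvg_fixed (l : List J) (a b : J → Matrix ι ι ℂ) (ha : ∀ j, a j * a j = 1)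
    (hb : ∀ j, b j * b j = 1) (s : J → J → ℂ) (hs : ∀ i j, s i j * s i j = 1)
    (hsa : ∀ i j, a i * a j = s i j • (a j * a i)) (hsb : ∀ i j, b i * b j = s i j • (b j * b i))
    (j : J) (hj : j ∈ l) : a j * clAvg l a b * b j = clAvg l a b := by
  induction l with
  | nil => simp at hj
  | cons i l ih =>
    change a j * ((1 / 2 : ℂ) • (clAvg l a b + a i * clAvg l a b * b i)) * b j =
      (1 / 2 : ℂ) • (clAvg l a b + a i * clAvg l a b * b i)
    rw [mul_smul_comm, smul_mul_assoc, mul_add, add_mul]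
    congr 1
    rcases List.mem_cons.1 hj with rfl | hj
    · have : a j * (a j * clAvg l a b * b j) * b j = clAvg l a b := by
        calc _ = a j * a j * clAvg l a b * (b j * b j) := by noncomm_ring
          _ = _ := by rw [ha, hb]; simp
      rw [this, add_comm]
    · have : a j * (a i * clAvg l a b * b i) * b j = a i * (a j * clAvg l a b * b j) * b i := by
        calc _ = a j * a i * clAvg l a b * (b i * b j) := by noncomm_ring
          _ = (s j i * s j i) • (a j * a i * clAvg l a b * (b i * b j)) := by rw [hs, one_smul]
          _ = a j * a i * (s j i • clAvg l a b) * (s j i • (b i * b j)) := by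
            simp only [mul_smul_comm, smul_mul_assoc, smul_smul]
          _ = s j i • (a j * a i) * clAvg l a b * (b j * b i) := by
            rw [← hsb]; simp only [mul_smul_comm, smul_mul_assoc]
          _ = (s j i * s j i) • (a i * a j) * clAvg l a b * (b j * b i) := by
            rw [hsa j i, smul_smul]
          _ = _ := by rw [hs, one_smul]; noncomm_ring
      rw [this, ih hj]

theorem clAvg_comm (l : List J) (a b : J → Matrix ι ι ℂ) (M : Matrix ι ι ℂ)
    (h : ∀ j, (M * a j = a j * M ∧ M * b j = b j * M) ∨
      (M * a j = -(a j * M) ∧ M * b j = -(b j * M))) : M * clAvg l a b = clAvg l a b * M := by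
  induction l with
  | nil => simp [clAvg]
  | cons i l ih =>
    change M * ((1 / 2 : ℂ) • (clAvg l a b + a i * clAvg l a b * b i)) =
      ((1 / 2 : ℂ) • (clAvg l a b + a i * clAvg l a b * b i)) * M
    rw [mul_smul_comm, smul_mul_assoc, mul_add, add_mul, ih]
    congr 2
    rcases h i with ⟨h1, h2⟩ | ⟨h1, h2⟩
    · calc _ = M * a i * clAvg l a b * b i := by noncomm_ring
        _ = a i * (M * clAvg l a b) * b i := by rw [h1]; noncomm_ring
        _ = a i * clAvg l a b * (M * b i) := by rw [ih]; noncomm_ring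
        _ = _ := by rw [h2]; noncomm_ring
    · calc _ = M * a i * clAvg l a b * b i := by noncomm_ring
        _ = -(a i * (M * clAvg l a b) * b i) := by rw [h1]; noncomm_ring
        _ = -(a i * clAvg l a b * (M * b i)) := by rw [ih]; noncomm_ring
        _ = _ := by rw [h2]; noncomm_ring

theorem continuous_clAvg {Z : Type} [TopologicalSpace Z] (l : List J)
    {a b : J → Z → Matrix ι ι ℂ} (ha : ∀ j, Continuous (a j)) (hb : ∀ j, Continuous (b j)) :
    Continuous fun z => clAvg l (fun j => a j z) (fun j => b j z) := by
  induction l with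
  | nil => exact continuous_const
  | cons i l ih =>
    change Continuous fun z => (1 / 2 : ℂ) • (clAvg l (fun j => a j z) (fun j => b j z) +
      a i z * clAvg l (fun j => a j z) (fun j => b j z) * b i z)
    have := ha i
    have := hb i
    fun_prop

/-- The rescaling of a matrix by a root of its determinant. -/
noncomputable def normDet (T : Matrix ι ι ℂ) : Matrix ι ι ℂ :=
  (T.det ^ ((Fintype.card ι : ℂ)⁻¹))⁻¹ • T

theorem det_normDet {T : Matrix ι ι ℂ} (h : T.det ≠ 0) : (normDet T).det = 1 := by
  rw [normDet, Matrix.det_smul]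
  rcases Nat.eq_zero_or_pos (Fintype.card ι) with h0 | h0
  · have := Fintype.card_eq_zero_iff.1 h0
    simp
  · rw [inv_pow, Complex.cpow_nat_inv_pow _ h0.ne', inv_mul_cancel₀ h]

end Average

section Transport

variable {X ι J : Type} [TopologicalSpace X] [CompactSpace X] [Fintype ι] [DecidableEq ι]
  [Fintype J]

theorem exists_uniform_near_diagonal {F : I × I × X → ℂ} (hF : Continuous F)
    (h1 : ∀ t x, F (t, t, x) = 1) :
    ∃ δ > 0, ∀ t s x, dist s t < δ → F (t, s, x) ∈ Complex.slitPlane := by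
  let f : C((I × I) × X, ℂ) := ⟨fun p => F (p.1.1, p.1.2, p.2), by fun_prop⟩
  have hu := CompactSpace.uniformContinuous_of_continuous f.curry.continuous
  obtain ⟨δ, hδ, H⟩ := Metric.uniformContinuous_iff.1 hu 1 one_pos
  refine ⟨δ, hδ, fun t s x hd => ?_⟩
  have h2 := H (a := (t, s)) (b := (t, t)) (by
    rw [Prod.dist_eq]; exact max_lt (by simpa using hδ) hd)
  have h3 := lt_of_le_of_lt (ContinuousMap.dist_apply_le_dist x) h2
  have h4 : dist (F (t, s, x)) 1 < 1 := by rw [← h1 t x]; exact h3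
  exact Complex.ball_one_subset_slitPlane (Metric.mem_ball.2 h4)

theorem exists_partition {δ : ℝ} (hδ : 0 < δ) : ∃ (n : ℕ) (c : ℕ → I), c 0 = 0 ∧ c n = 1 ∧
    ∀ k (t : I), dist (min t (c k)) (min t (c (k + 1))) < δ := by
  obtain ⟨n, hn⟩ := exists_nat_one_div_lt hδ
  refine ⟨n + 1, fun k => Set.projIcc 0 1 zero_le_one ((k : ℝ) / (n + 1)), ?_, ?_,
    fun k t => lt_of_le_of_lt ?_ hn⟩
  · apply Subtype.ext
    simp
  · apply Subtype.ext
    have : ((n + 1 : ℕ) : ℝ) / ((n : ℝ) + 1) = 1 := by push_cast; exact div_self (by positivity)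
    simp only [this]; simp
  · beta_reduce
    generalize hx : Set.projIcc (0 : ℝ) 1 zero_le_one ((k : ℝ) / (n + 1)) = x
    generalize hy : Set.projIcc (0 : ℝ) 1 zero_le_one (((k + 1 : ℕ) : ℝ) / (n + 1)) = y
    have e1 : |(x : ℝ) - y| ≤ 1 / ((n : ℝ) + 1) := by
      rw [← hx, ← hy]
      refine (Set.abs_projIcc_sub_projIcc _).trans ?_
      rw [← sub_div, abs_div, abs_of_pos (a := (n : ℝ) + 1) (by positivity)]
      push_cast
      simp
    refine le_trans ?_ e1
    rw [Subtype.dist_eq, Real.dist_eq]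
    have e2 : ∀ a b : I, ((min a b : I) : ℝ) = min (a : ℝ) b := fun a b =>
      Monotone.map_min (f := Subtype.val) fun _ _ h => h
    rw [e2, e2]
    exact (abs_min_sub_min_le_max _ _ _ _).trans (by simp)

theorem local_transport (γ : J → I × X → Matrix ι ι ℂ) (hc : ∀ j, Continuous (γ j))
    (hsq : ∀ j p, γ j p * γ j p = 1) (s : J → J → ℂ) (hs : ∀ i j, s i j * s i j = 1)
    (hcomm : ∀ i j p, γ i p * γ j p = s i j • (γ j p * γ i p)) :
    ∃ δ > 0, ∃ N : I → I → X → Matrix ι ι ℂ,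
      (∀ a b : I × X → I, Continuous a → Continuous b → (∀ p, dist (b p) (a p) < δ) →
        Continuous fun p => N (a p) (b p) p.2) ∧ (∀ t x, N t t x = 1) ∧
      (∀ t r x, dist r t < δ → (N t r x).det = 1) ∧
      (∀ j t r x, N t r x * γ j (r, x) = γ j (t, x) * N t r x) ∧
      ∀ M : Matrix ι ι ℂ, (∀ j, (∀ p, M * γ j p = γ j p * M) ∨ (∀ p, M * γ j p = -(γ j p * M))) →
        ∀ t r x, M * N t r x = N t r x * M := by
  classical
  obtain ⟨l, hl⟩ : ∃ l : List J, ∀ j, j ∈ l := ⟨Finset.univ.toList, fun j => by simp⟩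
  obtain ⟨Θ, hΘ, hΘ1, hfix, hcm⟩ : ∃ Θ : I → I → X → Matrix ι ι ℂ,
      (Continuous fun q : I × I × X => Θ q.1 q.2.1 q.2.2) ∧ (∀ t x, Θ t t x = 1) ∧
      (∀ t r x j, γ j (t, x) * Θ t r x * γ j (r, x) = Θ t r x) ∧
      (∀ M : Matrix ι ι ℂ,
      (∀ j, (∀ p, M * γ j p = γ j p * M) ∨ (∀ p, M * γ j p = -(γ j p * M))) →
      ∀ t r x, M * Θ t r x = Θ t r x * M) := by
    refine ⟨fun t r x => clAvg l (fun j => γ j (t, x)) (fun j => γ j (r, x)), ?_, ?_, ?_, ?_⟩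
    · have ha : ∀ j, Continuous fun q : I × I × X => γ j (q.1, q.2.2) := fun j => by
        have := hc j; fun_prop
      have hb : ∀ j, Continuous fun q : I × I × X => γ j (q.2.1, q.2.2) := fun j => by
        have := hc j; fun_prop
      exact continuous_clAvg l ha hb
    · exact fun t x => clAvg_self l _ fun j => hsq _ _
    · intro t r x j
      exact clAvg_fixed l (fun j => γ j (t, x)) (fun j => γ j (r, x)) (fun j => hsq _ _)
          (fun j => hsq _ _) s hs (fun i j => hcomm _ _ _) (fun i j => hcomm _ _ _) j (hl j)
    · intro M hM t r x
      refine clAvg_comm l _ _ M fun j => ?_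
      rcases hM j with h | h
      · exact Or.inl ⟨h _, h _⟩
      · exact Or.inr ⟨h _, h _⟩
  obtain ⟨δ, hδ, hslit⟩ := exists_uniform_near_diagonal (F := fun q => (Θ q.1 q.2.1 q.2.2).det)
    hΘ.matrix_det (fun t x => by rw [hΘ1, det_one])
  refine ⟨δ, hδ, fun t r x => normDet (Θ t r x), fun a b ha hb hab => ?_, fun t x => ?_,
    fun t r x hd => ?_, fun j t r x => ?_, fun M hM t r x => ?_⟩
  · have h1 : Continuous fun p : I × X => Θ (a p) (b p) p.2 :=
      hΘ.comp (f := fun p : I × X => (a p, b p, p.2)) (by fun_prop)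
    have h2 : ∀ p : I × X, (Θ (a p) (b p) p.2).det ∈ Complex.slitPlane :=
      fun p => hslit _ _ _ (hab p)
    have h3 : Continuous fun p : I × X =>
        (Θ (a p) (b p) p.2).det ^ ((Fintype.card ι : ℂ)⁻¹) :=
      h1.matrix_det.cpow continuous_const h2
    have h4 : ∀ p : I × X, (Θ (a p) (b p) p.2).det ^ ((Fintype.card ι : ℂ)⁻¹) ≠ 0 := fun p => by
      have := Complex.slitPlane_ne_zero (h2 p)
      simp [Complex.cpow_eq_zero_iff, this]
    exact (h3.inv₀ h4).smul h1
  · simp [hΘ1, normDet]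
  · exact det_normDet (Complex.slitPlane_ne_zero (hslit _ _ _ hd))
  · simp only [normDet, smul_mul_assoc, mul_smul_comm]
    congr 1
    conv_lhs => rw [← hfix t r x j]
    rw [mul_assoc, hsq, mul_one]
  · simp only [normDet, smul_mul_assoc, mul_smul_comm]
    rw [hcm M hM]

/-- Families of involutions with fixed commutation signs can be trivialized along an interval. -/
theorem transport (γ : J → I × X → Matrix ι ι ℂ) (hc : ∀ j, Continuous (γ j))
    (hsq : ∀ j p, γ j p * γ j p = 1) (s : J → J → ℂ) (hs : ∀ i j, s i j * s i j = 1)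
    (hcomm : ∀ i j p, γ i p * γ j p = s i j • (γ j p * γ i p)) :
    ∃ A : I × X → Matrix ι ι ℂ, Continuous A ∧ (∀ x, A (0, x) = 1) ∧ (∀ p, (A p).det = 1) ∧
      (∀ j t x, A (t, x) * γ j (0, x) = γ j (t, x) * A (t, x)) ∧
      ∀ M : Matrix ι ι ℂ, (∀ j, (∀ p, M * γ j p = γ j p * M) ∨ (∀ p, M * γ j p = -(γ j p * M))) →
        ∀ p, M * A p = A p * M := by
  obtain ⟨δ, hδ, N, N1, N2, N3, N4, N5⟩ := local_transport γ hc hsq s hs hcomm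
  obtain ⟨n, c, c0, cn, hcd⟩ := exists_partition hδ
  have key : ∀ k, ∃ A : I × X → Matrix ι ι ℂ,
      Continuous A ∧ (∀ x, A (0, x) = 1) ∧ (∀ p, (A p).det = 1) ∧
      (∀ j t x, A (t, x) * γ j (0, x) = γ j (min t (c k), x) * A (t, x)) ∧
      ∀ M : Matrix ι ι ℂ, (∀ j, (∀ p, M * γ j p = γ j p * M) ∨ (∀ p, M * γ j p = -(γ j p * M))) →
        ∀ p, M * A p = A p * M := by
    intro k
    induction k with
    | zero =>
      refine ⟨fun _ => 1, continuous_const, fun x => rfl, fun p => det_one, fun j t x => ?_,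
        fun M _ p => by simp⟩
      have : min t (c 0) = 0 := by rw [c0]; exact min_eq_right t.2.1
      rw [this, one_mul, mul_one]
    | succ k ih =>
      obtain ⟨A, i1, i2, i3, i4, i5⟩ := ih
      refine ⟨fun p => N (min p.1 (c (k + 1))) (min p.1 (c k)) p.2 * A p,
        (N1 _ _ (by fun_prop) (by fun_prop) fun p => hcd k p.1).matrix_mul i1,
        fun x => ?_, fun p => ?_, fun j t x => ?_, fun M hM p => ?_⟩
      · have e : ∀ k, min (0 : I) (c k) = 0 := fun k => min_eq_left (c k).2.1
        simp only [i2, e, N2, mul_one]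
      · rw [det_mul, i3, mul_one, N3 _ _ _ (hcd k p.1)]
      · rw [mul_assoc, i4, ← mul_assoc, ← mul_assoc, N4]
      · rw [← mul_assoc, mul_assoc _ _ M, ← i5 M hM, ← mul_assoc, N5 M hM]
  obtain ⟨A, i1, i2, i3, i4, i5⟩ := key n
  refine ⟨A, i1, i2, i3, fun j t x => ?_, i5⟩
  rw [i4, cn, (min_eq_left t.2.2 : min t 1 = t)]

/-- Commuting families of idempotents can be trivialized along an interval. -/
theorem idem_transport (P : J → I × X → Matrix ι ι ℂ) (hP : ∀ j, IsIdem (P j))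
    (hcomm : ∀ i j p, P i p * P j p = P j p * P i p) :
    ∃ A : I × X → Matrix ι ι ℂ, IsGL A ∧ (∀ x, A (0, x) = 1) ∧
      ∀ j t x, A (t, x) * P j (0, x) = P j (t, x) * A (t, x) := by
  obtain ⟨A, h1, h2, h3, h4, -⟩ := transport (fun j p => (2 : ℂ) • P j p - 1)
    (fun j => by have := (hP j).1; fun_prop)
    (fun j p => by
      have := (hP j).2 p
      simp only [sub_mul, mul_sub, smul_mul_smul_comm, this, mul_one, one_mul]
      module)
    (fun _ _ => 1) (by simp)
    (fun i j p => by
      have := hcomm i j p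
      simp only [sub_mul, mul_sub, smul_mul_smul_comm, this, mul_one, one_mul]
      module)
  refine ⟨A, ⟨h1, fun p => ?_⟩, h2, fun j t x => ?_⟩
  · rw [Matrix.isUnit_iff_isUnit_det, h3]; exact isUnit_one
  · have := h4 j t x
    simp only [mul_sub, sub_mul, mul_smul_comm, smul_mul_assoc, mul_one, one_mul,
      sub_left_inj] at this
    exact smul_right_injective _ (two_ne_zero' ℂ) this

theorem IdemFun.homotopy (φ : IdemFun X) {P : I × X → Matrix ι ι ℂ} (hP : IsIdem P) :
    φ.val (fun x => P (0, x)) = φ.val (fun x => P (1, x)) := by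
  obtain ⟨A, h1, h2, h3⟩ := idem_transport (fun _ : Unit => P) (fun _ => hP) (fun _ _ _ => rfl)
  exact φ.conj (hP.comp (by fun_prop)) (hP.comp (by fun_prop))
    (h1.comp (f := fun x => (1, x)) (by fun_prop)) fun x => h3 () 1 x

end Transport
end SphereParallel

namespace SphereParallel

open Matrix unitInterval Filter Topology

section CircleAverage

variable {ι κ l : Type} [Fintype ι] [DecidableEq ι] [Fintype κ] [DecidableEq κ]

/-- The average of a function over the unit circle. -/
noncomputable def savg (f : Circle → ℂ) : ℂ :=
  (2 * Real.pi : ℂ)⁻¹ * ∫ θ in (0 : ℝ)..(2 * Real.pi), f (Circle.exp θ)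

/-- The entrywise average of a matrix valued function over the unit circle. -/
noncomputable def cavg {m n : Type} (f : Circle → Matrix m n ℂ) : Matrix m n ℂ :=
  Matrix.of fun i j => savg fun z => f z i j

theorem continuous_comp_exp {f : Circle → ℂ} (hf : Continuous f) :
    Continuous fun θ : ℝ => f (Circle.exp θ) := hf.comp Circle.exp.continuous

theorem savg_add {f g : Circle → ℂ} (hf : Continuous f) (hg : Continuous g) :
    savg (fun z => f z + g z) = savg f + savg g := by
  simp only [savg]
  rw [intervalIntegral.integral_add ((continuous_comp_exp hf).intervalIntegrable _ _)
    ((continuous_comp_exp hg).intervalIntegrable _ _), mul_add]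

theorem savg_const_mul (c : ℂ) (f : Circle → ℂ) : savg (fun z => c * f z) = c * savg f := by
  simp only [savg, intervalIntegral.integral_const_mul]; ring

theorem savg_mul_const (c : ℂ) (f : Circle → ℂ) : savg (fun z => f z * c) = savg f * c := by
  simp only [savg, intervalIntegral.integral_mul_const]; ring

theorem savg_sum (s : Finset κ) {f : κ → Circle → ℂ} (hf : ∀ k, Continuous (f k)) :
    savg (fun z => ∑ k ∈ s, f k z) = ∑ k ∈ s, savg (f k) := by
  simp only [savg]
  rw [intervalIntegral.integral_finsetSum
    (fun k _ => (continuous_comp_exp (hf k)).intervalIntegrable _ _), Finset.mul_sum]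

theorem savg_const (c : ℂ) : savg (fun _ => c) = c := by
  have : (2 * Real.pi : ℂ) ≠ 0 := by exact_mod_cast Real.two_pi_pos.ne'
  simp only [savg, intervalIntegral.integral_const, sub_zero, Complex.real_smul]
  push_cast
  field_simp

theorem savg_zpow {n : ℤ} (hn : n ≠ 0) : savg (fun z => (z : ℂ) ^ n) = 0 := by
  have h1 : ∀ θ : ℝ, ((Circle.exp θ : Circle) : ℂ) ^ n = Complex.exp ((n * Complex.I) * θ) :=
    fun θ => by
      rw [Circle.coe_exp, ← Complex.exp_int_mul]; congr 1; ring
  simp only [savg, h1]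
  rw [integral_exp_mul_complex (by simp [hn])]
  have : (n * Complex.I) * ((2 * Real.pi : ℝ) : ℂ) = n * (2 * Real.pi * Complex.I) := by
    push_cast; ring
  rw [this, Complex.exp_int_mul_two_pi_mul_I]
  simp

theorem continuous_savg {Y : Type} [TopologicalSpace Y] {f : Y → Circle → ℂ}
    (hf : Continuous fun p : Y × Circle => f p.1 p.2) : Continuous fun y => savg (f y) := by
  refine continuous_const.mul ?_
  refine intervalIntegral.continuous_parametric_intervalIntegral_of_continuous'
    (f := fun y θ => f y (Circle.exp θ)) ?_ _ _
  exact hf.comp (f := fun p : Y × ℝ => (p.1, Circle.exp p.2)) (by fun_prop)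

theorem savg_tendsto_zero (f : Circle → ℂ) {k : ℕ → ℤ}
    (hk : Tendsto k atTop cofinite) :
    Tendsto (fun n => savg fun z => (z : ℂ) ^ (-k n) * f z) atTop (𝓝 0) := by
  have h1 := Real.tendsto_integral_exp_smul_cocompact
    (Set.indicator (Set.Ioc 0 (2 * Real.pi)) fun θ => f (Circle.exp θ))
  have h2 : Tendsto (fun n => (k n : ℝ) / (2 * Real.pi)) atTop (cocompact ℝ) := by
    have e1 : Tendsto (fun n => (k n : ℝ)) atTop (cocompact ℝ) :=
      (Int.isClosedEmbedding_coe_real.tendsto_cocompact.comp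
        (by rw [cocompact_eq_cofinite]; exact hk))
    have e2 : Tendsto (fun x : ℝ => x / (2 * Real.pi)) (cocompact ℝ) (cocompact ℝ) :=
      (Homeomorph.mulRight₀ (2 * Real.pi)⁻¹
        (inv_ne_zero Real.two_pi_pos.ne')).isClosedEmbedding.tendsto_cocompact
    exact e2.comp e1
  have h3 := (h1.comp h2).const_mul ((2 * Real.pi : ℂ)⁻¹)
  rw [mul_zero] at h3
  refine h3.congr fun n => ?_
  simp only [savg, Function.comp]
  congr 1
  rw [intervalIntegral.integral_of_le Real.two_pi_pos.le,
    ← MeasureTheory.integral_indicator measurableSet_Ioc]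
  refine MeasureTheory.integral_congr_ae (Eventually.of_forall fun v => ?_)
  by_cases hv : v ∈ Set.Ioc 0 (2 * Real.pi)
  · simp only [Set.indicator_of_mem hv]
    rw [Circle.smul_def, smul_eq_mul, Real.fourierChar_apply, Circle.coe_exp,
      ← Complex.exp_int_mul]
    congr 2
    have : (Real.pi : ℂ) ≠ 0 := by exact_mod_cast Real.pi_ne_zero
    push_cast
    field_simp
  · simp [Set.indicator_of_notMem hv]

theorem cavg_mul_left {m n : Type} (U : Matrix m ι ℂ) {f : Circle → Matrix ι n ℂ}
    (hf : Continuous f) : cavg (fun z => U * f z) = U * cavg f := by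
  ext i j
  simp only [cavg, Matrix.of_apply, Matrix.mul_apply]
  have hc : ∀ k, Continuous fun z => U i k * f z k j := fun k =>
    continuous_const.mul (hf.matrix_elem k j)
  rw [savg_sum (f := fun k z => U i k * f z k j) _ hc]
  simp only [savg_const_mul]

theorem cavg_mul_right {m n : Type} (U : Matrix ι n ℂ) {f : Circle → Matrix m ι ℂ}
    (hf : Continuous f) : cavg (fun z => f z * U) = cavg f * U := by
  ext i j
  simp only [cavg, Matrix.of_apply, Matrix.mul_apply]
  have hc : ∀ k, Continuous fun z => f z i k * U k j := fun k =>
    (hf.matrix_elem i k).mul continuous_const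
  rw [savg_sum (f := fun k z => f z i k * U k j) _ hc]
  simp only [savg_mul_const]

theorem cavg_add {m n : Type} {f g : Circle → Matrix m n ℂ} (hf : Continuous f)
    (hg : Continuous g) : cavg (fun z => f z + g z) = cavg f + cavg g := by
  ext i j
  exact savg_add (hf.matrix_elem i j) (hg.matrix_elem i j)

theorem cavg_const {m n : Type} (M : Matrix m n ℂ) : cavg (fun _ => M) = M := by
  ext i j
  exact savg_const _

theorem cavg_zpow {n : ℤ} (hn : n ≠ 0) (M : Matrix ι κ ℂ) :
    cavg (fun z => (z : ℂ) ^ n • M) = 0 := by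
  ext i j
  simp only [cavg, Matrix.of_apply, Matrix.smul_apply, smul_eq_mul, savg_mul_const, savg_zpow hn]
  simp

theorem continuous_cavg {Y m n : Type} [TopologicalSpace Y] {f : Y → Circle → Matrix m n ℂ}
    (hf : Continuous fun p : Y × Circle => f p.1 p.2) : Continuous fun y => cavg (f y) :=
  continuous_matrix fun i j => continuous_savg (f := fun y z => f y z i j) (hf.matrix_elem i j)

theorem cavg_tendsto_zero {m n : Type} (f : Circle → Matrix m n ℂ) {k : ℕ → ℤ}
    (hk : Tendsto k atTop cofinite) :
    Tendsto (fun n => cavg fun z => (z : ℂ) ^ (-k n) • f z) atTop (𝓝 0) := by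
  refine tendsto_pi_nhds.2 fun i => tendsto_pi_nhds.2 fun j => ?_
  exact savg_tendsto_zero (fun z => f z i j) hk

theorem cavg_fromBlocks {n m n' m' : Type} (f : Circle → Matrix n m ℂ)
    (g : Circle → Matrix n' m' ℂ) :
    cavg (fun z => fromBlocks (f z) 0 0 (g z)) = fromBlocks (cavg f) 0 0 (cavg g) := by
  ext i j
  rcases i with i | i <;> rcases j with j | j <;> simp [cavg, savg_const]

end CircleAverage

section Pencil

variable {ι κ : Type} [Fintype ι] [DecidableEq ι] [Fintype κ] [DecidableEq κ]

/-- The pencil `a + z b` is invertible on the unit circle. -/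
def Pencil (a b : Matrix ι ι ℂ) : Prop := ∀ z : Circle, IsUnit (a + (z : ℂ) • b)

/-- The spectral idempotent of a pencil. -/
noncomputable def pq (a b : Matrix ι ι ℂ) : Matrix ι ι ℂ :=
  cavg fun z => (z : ℂ) • (b * (a + (z : ℂ) • b)⁻¹)

/-- The Laurent coefficients of the inverse of a pencil. -/
noncomputable def pcoeff (a b : Matrix ι ι ℂ) (n : ℤ) : Matrix ι ι ℂ :=
  cavg fun z => (z : ℂ) ^ (-n) • (a + (z : ℂ) • b)⁻¹

variable {a b : Matrix ι ι ℂ}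

theorem Pencil.isGL (h : Pencil a b) : IsGL fun z : Circle => a + (z : ℂ) • b :=
  ⟨by fun_prop, h⟩

theorem continuous_circle_zpow (n : ℤ) : Continuous fun z : Circle => (z : ℂ) ^ n :=
  Continuous.zpow₀ (by fun_prop) n fun z => Or.inl z.coe_ne_zero

theorem Pencil.pcoeff_cont (h : Pencil a b) (n : ℤ) :
    Continuous fun z : Circle => (z : ℂ) ^ (-n) • (a + (z : ℂ) • b)⁻¹ :=
  (continuous_circle_zpow _).smul h.isGL.inv.1

theorem Pencil.rel_left (h : Pencil a b) (n : ℤ) :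
    a * pcoeff a b n + b * pcoeff a b (n - 1) = if n = 0 then 1 else 0 := by
  have c1 := h.pcoeff_cont n
  have c2 := h.pcoeff_cont (n - 1)
  rw [pcoeff, pcoeff, ← cavg_mul_left _ c1, ← cavg_mul_left _ c2,
    ← cavg_add (by fun_prop) (by fun_prop)]
  have : ∀ z : Circle, a * ((z : ℂ) ^ (-n) • (a + (z : ℂ) • b)⁻¹) +
      b * ((z : ℂ) ^ (-(n - 1)) • (a + (z : ℂ) • b)⁻¹) = (z : ℂ) ^ (-n) • 1 := fun z => by
    have e : (z : ℂ) ^ (-(n - 1)) = (z : ℂ) ^ (-n) * z := by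
      rw [show -(n - 1) = -n + 1 by ring, zpow_add_one₀ z.coe_ne_zero]
    rw [← h.isGL.mul_inv z, e, add_mul, smul_add]
    simp only [mul_smul_comm, smul_mul_assoc, smul_smul]
  simp only [this]
  split_ifs with hn
  · subst hn; simp [cavg_const]
  · exact cavg_zpow (by simpa using hn) _

theorem Pencil.rel_right (h : Pencil a b) (n : ℤ) :
    pcoeff a b n * a + pcoeff a b (n - 1) * b = if n = 0 then 1 else 0 := by
  have c1 := h.pcoeff_cont n
  have c2 := h.pcoeff_cont (n - 1)
  rw [pcoeff, pcoeff, ← cavg_mul_right _ c1, ← cavg_mul_right _ c2,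
    ← cavg_add (by fun_prop) (by fun_prop)]
  have : ∀ z : Circle, ((z : ℂ) ^ (-n) • (a + (z : ℂ) • b)⁻¹) * a +
      ((z : ℂ) ^ (-(n - 1)) • (a + (z : ℂ) • b)⁻¹) * b = (z : ℂ) ^ (-n) • 1 := fun z => by
    have e : (z : ℂ) ^ (-(n - 1)) = (z : ℂ) ^ (-n) * z := by
      rw [show -(n - 1) = -n + 1 by ring, zpow_add_one₀ z.coe_ne_zero]
    rw [← h.isGL.inv_mul z, e, mul_add, smul_add]
    simp only [mul_smul_comm, smul_mul_assoc, smul_smul]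
  simp only [this]
  split_ifs with hn
  · subst hn; simp [cavg_const]
  · exact cavg_zpow (by simpa using hn) _

theorem pcoeff_tendsto (a b : Matrix ι ι ℂ) {k : ℕ → ℤ} (hk : Tendsto k atTop cofinite) :
    Tendsto (fun n => pcoeff a b (k n)) atTop (𝓝 0) := cavg_tendsto_zero _ hk

theorem Pencil.pq_eq (h : Pencil a b) : pq a b = b * pcoeff a b (-1) := by
  have c1 := h.pcoeff_cont (-1)
  rw [pcoeff, ← cavg_mul_left _ c1, pq]
  simp

/-- The spectral idempotent acting on the source. -/
noncomputable def pqt (a b : Matrix ι ι ℂ) : Matrix ι ι ℂ := pcoeff a b (-1) * b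

theorem Pencil.pq_mul_left (h : Pencil a b) : pq a b * a = a * pqt a b := by
  have h1 := h.rel_right (-1)
  have h2 := h.rel_left (-1)
  norm_num at h1 h2
  rw [h.pq_eq, pqt, mul_assoc, ← mul_assoc a, eq_neg_of_add_eq_zero_left h1,
    eq_neg_of_add_eq_zero_left h2]
  simp [mul_assoc]

theorem Pencil.pq_mul_right (h : Pencil a b) : pq a b * b = b * pqt a b := by
  rw [h.pq_eq, pqt, mul_assoc]

theorem tendsto_natCast_cofinite : Tendsto (fun n : ℕ => (n : ℤ)) atTop cofinite := by
  rw [← Nat.cofinite_eq_atTop]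
  exact Nat.cast_injective.tendsto_cofinite

theorem tendsto_negSucc_cofinite : Tendsto (fun n : ℕ => -1 - (n : ℤ)) atTop cofinite := by
  rw [← Nat.cofinite_eq_atTop]
  refine Function.Injective.tendsto_cofinite fun m n h => ?_
  simpa using h

theorem eq_zero_of_tendsto {W : Matrix ι ι ℂ} {f : ℕ → Matrix ι ι ℂ}
    (hf : Tendsto f atTop (𝓝 0)) (h : ∀ n, f n = W) : W = 0 :=
  tendsto_nhds_unique (tendsto_const_nhds.congr fun n => (h n).symm) hf

/-- The source idempotent fixes kernels of the pencil inside the disc. -/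
theorem Pencil.pqt_inside (h : Pencil a b) {ω : ℂ} (hω : ‖ω‖ < 1) {W : Matrix ι ι ℂ}
    (hW : (a + ω • b) * W = 0) : pqt a b * W = W := by
  have haW : a * W = -(ω • (b * W)) := by
    rw [add_mul, smul_mul_assoc] at hW
    exact eq_neg_of_add_eq_zero_left hW
  have step : ∀ n : ℤ, pcoeff a b (n - 1) * (b * W) =
      (if n = 0 then W else 0) + ω • (pcoeff a b n * (b * W)) := fun n => by
    have := congrArg (· * W) (h.rel_right n)
    simp only [add_mul, mul_assoc, haW] at this
    rw [mul_neg, mul_smul_comm] at this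
    have e : (if n = 0 then (1 : Matrix ι ι ℂ) else 0) * W = if n = 0 then W else 0 := by
      split_ifs <;> simp
    rw [← e, ← this]; abel
  have h0 : pcoeff a b 0 * (b * W) = 0 := by
    refine eq_zero_of_tendsto (f := fun n : ℕ => ω ^ n • (pcoeff a b n * (b * W))) ?_ fun n => ?_
    · have t1 := (pcoeff_tendsto a b tendsto_natCast_cofinite)
      have t2 : Tendsto (fun n : ℕ => pcoeff a b n * (b * W)) atTop
          (𝓝 ((0 : Matrix ι ι ℂ) * (b * W))) :=
        ((show Continuous fun M : Matrix ι ι ℂ => M * (b * W) by fun_prop).tendsto 0).comp t1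
      have t3 := (tendsto_pow_atTop_nhds_zero_of_norm_lt_one hω).smul t2
      simpa using t3
    · induction n with
      | zero => simp
      | succ n ih =>
        rw [← ih]
        have := step (n + 1)
        rw [add_sub_cancel_right, if_neg (by omega), zero_add] at this
        rw [this, smul_smul, pow_succ]
        push_cast
        rfl
  have := step 0
  rw [h0] at this
  simpa [pqt, mul_assoc] using this

/-- The source idempotent kills kernels of the pencil outside the disc. -/
theorem Pencil.pqt_outside (h : Pencil a b) {ω : ℂ} (hω : ‖ω‖ < 1) {W : Matrix ι ι ℂ}
    (hW : (ω • a + b) * W = 0) : pqt a b * W = 0 := by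
  have hbW : b * W = -(ω • (a * W)) := by
    rw [add_mul, smul_mul_assoc] at hW
    exact eq_neg_of_add_eq_zero_right hW
  have step : ∀ n : ℤ, n ≠ 0 → pcoeff a b n * (b * W) =
      ω • (pcoeff a b (n - 1) * (b * W)) := fun n hn => by
    have := congrArg (· * W) (h.rel_right n)
    simp only [add_mul, mul_assoc, if_neg hn, zero_mul] at this
    conv_lhs => rw [hbW]
    rw [mul_neg, mul_smul_comm, eq_neg_of_add_eq_zero_left this]
    simp
  rw [pqt, mul_assoc]
  refine eq_zero_of_tendsto
    (f := fun n : ℕ => ω ^ n • (pcoeff a b (-1 - n) * (b * W))) ?_ fun n => ?_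
  · have t1 := (pcoeff_tendsto a b tendsto_negSucc_cofinite)
    have t2 : Tendsto (fun n : ℕ => pcoeff a b (-1 - n) * (b * W)) atTop
          (𝓝 ((0 : Matrix ι ι ℂ) * (b * W))) :=
      ((show Continuous fun M : Matrix ι ι ℂ => M * (b * W) by fun_prop).tendsto 0).comp t1
    have t3 := (tendsto_pow_atTop_nhds_zero_of_norm_lt_one hω).smul t2
    simpa using t3
  · induction n with
    | zero => simp
    | succ n ih =>
      rw [← ih, step (-1 - n) (by omega), smul_smul, pow_succ]
      congr 3
      push_cast; ring

theorem pcoeff_product_tendsto (a b : Matrix ι ι ℂ) :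
    Tendsto (fun n : ℕ => b * pcoeff a b (-1 - n) * (a * pcoeff a b n)) atTop (𝓝 0) := by
  have t1 : Tendsto (fun n : ℕ => pcoeff a b (-1 - n)) atTop (𝓝 0) :=
    pcoeff_tendsto a b tendsto_negSucc_cofinite
  have t2 : Tendsto (fun n : ℕ => pcoeff a b n) atTop (𝓝 0) :=
    pcoeff_tendsto a b tendsto_natCast_cofinite
  have t3 : Tendsto (fun n : ℕ => b * pcoeff a b (-1 - n)) atTop (𝓝 0) := by
    have := ((show Continuous fun M : Matrix ι ι ℂ => b * M by fun_prop).tendsto 0).comp t1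
    rwa [mul_zero] at this
  have t4 : Tendsto (fun n : ℕ => a * pcoeff a b n) atTop (𝓝 0) := by
    have := ((show Continuous fun M : Matrix ι ι ℂ => a * M by fun_prop).tendsto 0).comp t2
    rwa [mul_zero] at this
  have := t3.mul t4
  rwa [mul_zero] at this

theorem Pencil.pq_idem (h : Pencil a b) : pq a b * pq a b = pq a b := by
  have hQ : 1 - pq a b = a * pcoeff a b 0 := by
    have := h.rel_left 0
    simp only [if_true, zero_sub] at this
    rw [h.pq_eq, ← this]; abel
  have h1 : pq a b * (1 - pq a b) = 0 := by
    refine eq_zero_of_tendsto (pcoeff_product_tendsto a b) fun n => ?_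
    induction n with
    | zero => rw [hQ, h.pq_eq]; simp
    | succ n ih =>
      rw [← ih]
      have r1 := h.rel_left (n + 1)
      have r2 := h.rel_right (-1 - n)
      rw [if_neg (by omega)] at r1 r2
      have r3 := eq_neg_of_add_eq_zero_left r1
      have r4 := eq_neg_of_add_eq_zero_left r2
      rw [add_sub_cancel_right] at r3
      have e : (-1 - ((n + 1 : ℕ) : ℤ)) = -1 - n - 1 := by push_cast; ring
      rw [e]
      push_cast
      rw [r3, mul_assoc b (pcoeff a b (-1 - n)), ← mul_assoc (pcoeff a b (-1 - n)) a, r4]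
      simp only [mul_neg, neg_mul, mul_assoc]
  rw [mul_sub, mul_one, sub_eq_zero] at h1
  exact h1.symm

theorem Pencil.pqt_idem (h : Pencil a b) : pqt a b * pqt a b = pqt a b := by
  have e0 := h.pq_idem
  have ha := h.pq_mul_left
  have hb := h.pq_mul_right
  have k : ∀ z : Circle, (a + (z : ℂ) • b) * (pqt a b * pqt a b) = (a + (z : ℂ) • b) * pqt a b :=
    fun z => by
      have : (a + (z : ℂ) • b) * pqt a b = pq a b * (a + (z : ℂ) • b) := by
        rw [add_mul, mul_add, ha, smul_mul_assoc, mul_smul_comm, hb]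
      rw [← mul_assoc, this, mul_assoc, this, ← mul_assoc, e0]
  exact (h 1).mul_left_cancel (k 1)

theorem isUnit_of_mul_eq_zero {P : Matrix ι ι ℂ} (h : ∀ W : Matrix ι ι ℂ, P * W = 0 → W = 0) :
    IsUnit P := by
  rw [Matrix.isUnit_iff_isUnit_det, isUnit_iff_ne_zero]
  intro hd
  obtain ⟨v, hv, hPv⟩ := Matrix.exists_mulVec_eq_zero_iff.2 hd
  refine hv (funext fun i => ?_)
  have := h (Matrix.of fun i _ => v i) (by
    ext i j
    exact congrFun hPv i)
  exact congrFun (congrFun this i) i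

theorem Pencil.homotopy_isUnit (h : Pencil a b) {r : ℝ} (h0 : 0 ≤ r) (h1 : r ≤ 1) (z : Circle) :
    IsUnit ((1 - pq a b) * (a + ((r : ℂ) * z) • b) + pq a b * ((r : ℂ) • a + (z : ℂ) • b)) := by
  rcases eq_or_lt_of_le h1 with rfl | h1
  · have : (1 - pq a b) * (a + (((1 : ℝ) : ℂ) * z) • b) +
        pq a b * (((1 : ℝ) : ℂ) • a + (z : ℂ) • b) = a + (z : ℂ) • b := by
      simp only [Complex.ofReal_one, one_mul, one_smul, sub_mul]; abel
    rw [this]; exact h z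
  refine isUnit_of_mul_eq_zero fun W hW => ?_
  have hQ := h.pq_idem
  have ha := h.pq_mul_left
  have hb := h.pq_mul_right
  have hr : ‖(r : ℂ)‖ < 1 := by rw [Complex.norm_real, Real.norm_of_nonneg h0]; exact h1
  have cm : ∀ c d : ℂ, pq a b * (c • a + d • b) = (c • a + d • b) * pqt a b := fun c d => by
    rw [add_mul, mul_add, mul_smul_comm, mul_smul_comm, smul_mul_assoc, smul_mul_assoc, ha, hb]
  have k1 : ((r : ℂ) • a + (z : ℂ) • b) * (pqt a b * W) = 0 := by
    rw [← mul_assoc, ← cm]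
    have := congrArg (pq a b * ·) hW
    simp only [add_mul, mul_add, sub_mul, mul_sub, one_mul, ← mul_assoc, hQ, mul_zero] at this
    simpa [mul_add, add_mul] using this
  have k2 : (a + ((r : ℂ) * z) • b) * (W - pqt a b * W) = 0 := by
    have e : a + ((r : ℂ) * z) • b = (1 : ℂ) • a + ((r : ℂ) * z) • b := by rw [one_smul]
    have e2 : (a + ((r : ℂ) * z) • b) * (W - pqt a b * W) =
        ((1 - pq a b) * (a + ((r : ℂ) * z) • b)) * W := by
      rw [mul_sub, ← mul_assoc, e, ← cm, ← e, sub_mul, sub_mul, one_mul]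
    rw [e2]
    have := congrArg ((1 - pq a b) * ·) hW
    have z1 : (1 - pq a b) * pq a b = 0 := by rw [sub_mul, hQ]; simp
    have z2 : (1 - pq a b) * (1 - pq a b) = 1 - pq a b := by rw [mul_sub, z1]; simp
    simp only [add_mul, mul_zero] at this
    rw [mul_add, ← mul_assoc, ← mul_assoc, ← mul_assoc, ← mul_assoc (1 - pq a b) (pq a b), z1,
      z2] at this
    simpa using this
  have w1 : pqt a b * W = 0 := by
    have k3 : (((r : ℂ) * (z : ℂ)⁻¹) • a + b) * (pqt a b * W) = 0 := by
      have : (((r : ℂ) * (z : ℂ)⁻¹) • a + b) = (z : ℂ)⁻¹ • ((r : ℂ) • a + (z : ℂ) • b) := by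
        rw [smul_add, smul_smul, smul_smul, inv_mul_cancel₀ z.coe_ne_zero, one_smul, mul_comm]
      rw [this, smul_mul_assoc, k1, smul_zero]
    have := h.pqt_outside (ω := (r : ℂ) * (z : ℂ)⁻¹) (by
      rw [norm_mul, norm_inv, Circle.norm_coe, inv_one, mul_one]; exact hr) k3
    rwa [← mul_assoc, h.pqt_idem] at this
  have w2 := h.pqt_inside (ω := (r : ℂ) * z) (by
    rw [norm_mul, Circle.norm_coe, mul_one]; exact hr) k2
  rw [w1, sub_zero, w1] at w2
  exact w2.symm

theorem Pencil.fromBlocks {c d : Matrix κ κ ℂ} (h : Pencil a b) (h' : Pencil c d) :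
    Pencil (fromBlocks a 0 0 c) (fromBlocks b 0 0 d) ∧
      pq (Matrix.fromBlocks a 0 0 c) (Matrix.fromBlocks b 0 0 d) =
        Matrix.fromBlocks (pq a b) 0 0 (pq c d) := by
  have e : ∀ z : ℂ, Matrix.fromBlocks a 0 0 c + z • Matrix.fromBlocks b 0 0 d =
      Matrix.fromBlocks (a + z • b) 0 0 (c + z • d) := fun z => by
    simp [fromBlocks_smul, fromBlocks_add]
  refine ⟨fun z => by rw [e]; exact isUnit_fromBlocks_diag (h z) (h' z), ?_⟩
  rw [pq, pq, pq, ← cavg_fromBlocks]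
  congr 1
  funext z
  have hinv : (Matrix.fromBlocks (a + (z : ℂ) • b) 0 0 (c + (z : ℂ) • d))⁻¹ =
      Matrix.fromBlocks (a + (z : ℂ) • b)⁻¹ 0 0 (c + (z : ℂ) • d)⁻¹ := by
    refine Matrix.inv_eq_right_inv ?_
    rw [fromBlocks_multiply, h.isGL.mul_inv, h'.isGL.mul_inv]
    simp
  rw [e, hinv, fromBlocks_multiply, fromBlocks_smul]
  simp

theorem pq_zero_right : pq a 0 = 0 := by
  simp [pq, cavg_const]

theorem pq_zero_left : pq (0 : Matrix ι ι ℂ) 1 = 1 := by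
  have : ∀ z : Circle, (z : ℂ) • ((1 : Matrix ι ι ℂ) * (0 + (z : ℂ) • (1 : Matrix ι ι ℂ))⁻¹) = 1 :=
    fun z => by
      rw [one_mul, zero_add, Matrix.inv_eq_right_inv (B := (z : ℂ)⁻¹ • (1 : Matrix ι ι ℂ))]
      · rw [smul_smul, mul_inv_cancel₀ z.coe_ne_zero, one_smul]
      · rw [smul_mul_smul_comm, mul_inv_cancel₀ z.coe_ne_zero, one_smul, mul_one]
  simp only [pq, this, cavg_const]

theorem idem_pencil_mul {E : Matrix ι ι ℂ} (hE : E * E = E) {z w : ℂ} (hzw : z * w = 1) :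
    (1 - E + z • E) * (1 - E + w • E) = 1 := by
  have h1 : (z • E) * (w • E) = E := by rw [smul_mul_smul_comm, hzw, hE, one_smul]
  have h2 : (1 - E) * (w • E) = 0 := by rw [mul_smul_comm, sub_mul, hE]; simp
  have h3 : (z • E) * (1 - E) = 0 := by rw [smul_mul_assoc, mul_sub, hE]; simp
  have h4 : (1 - E) * (1 - E) = 1 - E := by rw [mul_sub, sub_mul, sub_mul, hE]; simp
  rw [add_mul, mul_add, mul_add, h1, h2, h3, h4]
  simp

theorem pq_idem_pencil {E : Matrix ι ι ℂ} (hE : E * E = E) :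
    Pencil (1 - E) E ∧ pq (1 - E) E = E := by
  have hz : ∀ z : Circle, (1 - E + (z : ℂ) • E) * (1 - E + (z : ℂ)⁻¹ • E) = 1 := fun z =>
    idem_pencil_mul hE (mul_inv_cancel₀ z.coe_ne_zero)
  refine ⟨fun z => isUnit_of_mul_eq_one (hz z), ?_⟩
  have : ∀ z : Circle, (z : ℂ) • (E * (1 - E + (z : ℂ) • E)⁻¹) = E := fun z => by
    rw [Matrix.inv_eq_right_inv (hz z), mul_add, mul_sub, mul_smul_comm, hE, smul_add, smul_smul,
      mul_inv_cancel₀ z.coe_ne_zero]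
    simp
  simp only [pq, this, cavg_const]

theorem continuous_pq {Y : Type} [TopologicalSpace Y] {a b : Y → Matrix ι ι ℂ} (ha : Continuous a)
    (hb : Continuous b) (h : ∀ y, Pencil (a y) (b y)) : Continuous fun y => pq (a y) (b y) := by
  refine continuous_cavg (f := fun y z => (z : ℂ) • (b y * (a y + (z : ℂ) • b y)⁻¹)) ?_
  have : IsGL fun p : Y × Circle => a p.1 + (p.2 : ℂ) • b p.1 :=
    ⟨by fun_prop, fun p => h p.1 p.2⟩
  have := this.inv.1
  fun_prop

theorem isIdem_pq {Y : Type} [TopologicalSpace Y] {a b : Y → Matrix ι ι ℂ} (ha : Continuous a)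
    (hb : Continuous b) (h : ∀ y, Pencil (a y) (b y)) : IsIdem fun y => pq (a y) (b y) :=
  ⟨continuous_pq ha hb h, fun y => (h y).pq_idem⟩

end Pencil
end SphereParallel

namespace SphereParallel

open Matrix unitInterval Filter Topology

section Index

variable {X : Type} [TopologicalSpace X]
variable {ι κ : Type} [Fintype ι] [DecidableEq ι] [Fintype κ] [DecidableEq κ]

/-- Evaluation of a family of matrix polynomials of degree at most `d + 1`. -/
def ev (d : ℕ) (p : ℕ → X → Matrix ι ι ℂ) (y : X × Circle) : Matrix ι ι ℂ :=
  ∑ i ∈ Finset.range (d + 2), (y.2 : ℂ) ^ i • p i y.1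

/-- A continuous family of polynomials which is invertible on the circle. -/
def Valid (d : ℕ) (p : ℕ → X → Matrix ι ι ℂ) : Prop :=
  (∀ i, Continuous (p i)) ∧ ∀ y, IsUnit (ev d p y)

/-- The linearisation `[[p₀, p'], [-z, 1]]` of a polynomial `p = p₀ + z p'`. -/
def hig (p : ℕ → X → Matrix ι ι ℂ) (i : ℕ) (x : X) : Matrix (ι ⊕ ι) (ι ⊕ ι) ℂ :=
  fromBlocks (if i = 0 then p 0 x else 0) (p (i + 1) x) (if i = 1 then -1 else 0)
    (if i = 0 then 1 else 0)

/-- The index of a family of invertible matrix polynomials. -/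
noncomputable def ind (φ : IdemFun X) : (d : ℕ) → {ι : Type} → [Fintype ι] → [DecidableEq ι] →
    (ℕ → X → Matrix ι ι ℂ) → ℤ
  | 0, _, _, _, p => φ.val fun x => pq (p 0 x) (p 1 x)
  | d + 1, _, _, _, p => ind φ d (hig p)

theorem continuous_ev (d : ℕ) {p : ℕ → X → Matrix ι ι ℂ} (hp : ∀ i, Continuous (p i)) :
    Continuous (ev d p) := by
  refine continuous_finsetSum _ fun i _ => ?_
  have := hp i
  fun_prop

theorem Valid.isGL {d : ℕ} {p : ℕ → X → Matrix ι ι ℂ} (h : Valid d p) : IsGL (ev d p) :=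
  ⟨continuous_ev d h.1, h.2⟩

theorem Valid.pencil {p : ℕ → X → Matrix ι ι ℂ} (h : Valid 0 p) (x : X) :
    Pencil (p 0 x) (p 1 x) := fun z => by
  simpa [ev, Finset.sum_range_succ] using h.2 (x, z)

theorem sum_shift (d : ℕ) (p : ℕ → X → Matrix ι ι ℂ) (y : X × Circle) :
    p 0 y.1 + (y.2 : ℂ) • (∑ i ∈ Finset.range d, (y.2 : ℂ) ^ i • p (i + 1) y.1) =
      ∑ i ∈ Finset.range (d + 1), (y.2 : ℂ) ^ i • p i y.1 := by
  rw [Finset.sum_range_succ', Finset.smul_sum, add_comm]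
  simp [smul_smul, pow_succ, mul_comm]

theorem sum_delta_zero (d : ℕ) (z : ℂ) (M : Matrix ι ι ℂ) :
    ∑ i ∈ Finset.range (d + 2), z ^ i • (if i = 0 then M else 0) = M := by
  rw [Finset.sum_eq_single 0] <;> simp +contextual

theorem sum_delta_one (d : ℕ) (z : ℂ) (M : Matrix ι ι ℂ) :
    ∑ i ∈ Finset.range (d + 2), z ^ i • (if i = 1 then M else 0) = z • M := by
  rw [Finset.sum_eq_single 1] <;> simp +contextual

theorem sum_fromBlocks (s : Finset ℕ) (a : ℕ → Matrix ι ι ℂ) (b : ℕ → Matrix ι κ ℂ)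
    (c : ℕ → Matrix κ ι ℂ) (e : ℕ → Matrix κ κ ℂ) :
    ∑ i ∈ s, fromBlocks (a i) (b i) (c i) (e i) =
      fromBlocks (∑ i ∈ s, a i) (∑ i ∈ s, b i) (∑ i ∈ s, c i) (∑ i ∈ s, e i) := by
  induction s using Finset.cons_induction with
  | empty => simp
  | cons a s ha ih => simp only [Finset.sum_cons, ih, fromBlocks_add]

theorem ev_hig (d : ℕ) (p : ℕ → X → Matrix ι ι ℂ) (y : X × Circle) :
    ev d (hig p) y = fromBlocks (p 0 y.1)
      (∑ i ∈ Finset.range (d + 2), (y.2 : ℂ) ^ i • p (i + 1) y.1) (-((y.2 : ℂ) • 1)) 1 := by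
  simp only [ev, hig, fromBlocks_smul, sum_fromBlocks, sum_delta_zero, sum_delta_one, smul_neg]

theorem isUnit_upper {m : Type} [Fintype m] [DecidableEq m] (b : Matrix ι m ℂ) :
    IsUnit (fromBlocks (1 : Matrix ι ι ℂ) b 0 (1 : Matrix m m ℂ)) :=
  isUnit_of_mul_eq_one (b := fromBlocks 1 (-b) 0 1) (by simp [fromBlocks_multiply])

theorem isUnit_lower {m : Type} [Fintype m] [DecidableEq m] (b : Matrix m ι ℂ) :
    IsUnit (fromBlocks (1 : Matrix ι ι ℂ) 0 b (1 : Matrix m m ℂ)) :=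
  isUnit_of_mul_eq_one (b := fromBlocks 1 0 (-b) 1) (by simp [fromBlocks_multiply])

theorem elementary_factor (p b c : Matrix ι ι ℂ) :
    fromBlocks 1 b 0 1 * fromBlocks p 0 0 1 * fromBlocks 1 0 c 1 =
      fromBlocks (p + b * c) b c 1 := by
  simp [fromBlocks_multiply]

theorem isUnit_elementary {p : Matrix ι ι ℂ} (hp : IsUnit p) (b c : Matrix ι ι ℂ) :
    IsUnit (fromBlocks (p + b * c) b c 1) := by
  rw [← elementary_factor]
  exact ((isUnit_upper b).mul (isUnit_fromBlocks_diag hp isUnit_one)).mul (isUnit_lower c)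

theorem ev_hig_factor (d : ℕ) (p : ℕ → X → Matrix ι ι ℂ) (y : X × Circle) :
    ev d (hig p) y = fromBlocks 1 (∑ i ∈ Finset.range (d + 2), (y.2 : ℂ) ^ i • p (i + 1) y.1) 0 1 *
      fromBlocks (ev (d + 1) p y) 0 0 1 * fromBlocks 1 0 (-((y.2 : ℂ) • 1)) 1 := by
  rw [elementary_factor, ev_hig, ev, ← sum_shift (d + 2)]
  congr 1
  simp

theorem continuous_hig {p : ℕ → X → Matrix ι ι ℂ} (hp : ∀ i, Continuous (p i)) (i : ℕ) :
    Continuous (hig p i) := by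
  have h1 := hp (i + 1)
  have h0 : Continuous fun x => if i = 0 then p 0 x else 0 := by
    have := hp 0
    split_ifs <;> fun_prop
  have : hig p i = fun x => hig p i x := rfl
  rw [this]
  unfold hig
  fun_prop

theorem Valid.hig {d : ℕ} {p : ℕ → X → Matrix ι ι ℂ} (h : Valid (d + 1) p) :
    Valid d (hig p) := by
  refine ⟨continuous_hig h.1, fun y => ?_⟩
  rw [ev_hig_factor]
  exact ((isUnit_upper _).mul (isUnit_fromBlocks_diag (h.2 y) isUnit_one)).mul (isUnit_lower _)

variable (φ : IdemFun X)

theorem ind_congr (d : ℕ) {p q : ℕ → X → Matrix ι ι ℂ} (h : ∀ i x, p i x = q i x) :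
    ind φ d p = ind φ d q := by
  rw [show p = q from funext fun i => funext (h i)]

theorem ind_homotopy [CompactSpace X] (d : ℕ) {ι : Type} [Fintype ι] [DecidableEq ι]
    {p : ℕ → I × X → Matrix ι ι ℂ} (hp : Valid d p) :
    ind φ d (fun i x => p i (0, x)) = ind φ d (fun i x => p i (1, x)) := by
  induction d generalizing ι with
  | zero =>
    exact φ.homotopy (P := fun y => pq (p 0 y) (p 1 y)) (isIdem_pq (hp.1 0) (hp.1 1) hp.pencil)
  | succ d ih => exact ih hp.hig

theorem ind_segment [CompactSpace X] (d : ℕ) {p q : ℕ → X → Matrix ι ι ℂ}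
    (hp : ∀ i, Continuous (p i)) (hq : ∀ i, Continuous (q i))
    (H : ∀ y, ∀ t : ℝ, 0 ≤ t → t ≤ 1 → IsUnit ((1 - (t : ℂ)) • ev d p y + (t : ℂ) • ev d q y)) :
    ind φ d p = ind φ d q := by
  have h := ind_homotopy φ d (p := fun i (y : I × X) => (1 - ((y.1 : ℝ) : ℂ)) • p i y.2 +
    ((y.1 : ℝ) : ℂ) • q i y.2) ⟨fun i => by have := hp i; have := hq i; fun_prop, fun y => by
      have := H (y.1.2, y.2) y.1.1 y.1.1.2.1 y.1.1.2.2
      convert this using 1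
      simp only [ev, Finset.smul_sum, ← Finset.sum_add_distrib]
      refine Finset.sum_congr rfl fun i _ => ?_
      rw [smul_add, smul_comm, smul_comm (((y.1.1 : ℝ) : ℂ))]⟩
  simpa using h

theorem Pencil.sandwich_rect {a b : Matrix ι ι ℂ} (h : Pencil a b) {U : Matrix κ ι ℂ}
    {U' : Matrix ι κ ℂ} {V : Matrix ι κ ℂ} {V' : Matrix κ ι ℂ} (h1 : U * U' = 1)
    (h2 : U' * U = 1) (h3 : V * V' = 1) (h4 : V' * V = 1) :
    Pencil (U * a * V) (U * b * V) ∧ pq (U * a * V) (U * b * V) = U * pq a b * U' := by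
  have e : ∀ z : ℂ, U * a * V + z • (U * b * V) = U * (a + z • b) * V := fun z => by
    simp only [Matrix.mul_add, Matrix.add_mul, Matrix.mul_smul, Matrix.smul_mul]
  have hinv : ∀ z : Circle, U * (a + (z : ℂ) • b) * V * (V' * (a + (z : ℂ) • b)⁻¹ * U') = 1 :=
    fun z => by
      have : (a + (z : ℂ) • b) * (a + (z : ℂ) • b)⁻¹ = 1 := h.isGL.mul_inv z
      calc _ = U * ((a + (z : ℂ) • b) * (V * V') * (a + (z : ℂ) • b)⁻¹) * U' := by
            simp only [Matrix.mul_assoc]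
        _ = 1 := by rw [h3, mul_one, this, Matrix.mul_one, h1]
  refine ⟨fun z => by rw [e]; exact isUnit_of_mul_eq_one (hinv z), ?_⟩
  have c2 : Continuous fun z : Circle => (z : ℂ) • (b * (a + (z : ℂ) • b)⁻¹) := by
    have := h.isGL.inv.1
    fun_prop
  have c3 : Continuous fun z : Circle => (z : ℂ) • (b * (a + (z : ℂ) • b)⁻¹) * U' := by
    fun_prop
  have e3 : U * pq a b * U' = cavg fun z : Circle =>
      U * ((z : ℂ) • (b * (a + (z : ℂ) • b)⁻¹) * U') := by
    rw [cavg_mul_left _ c3, cavg_mul_right _ c2, Matrix.mul_assoc]; rfl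
  rw [e3, pq]
  congr 1
  funext z
  rw [e, Matrix.inv_eq_right_inv (hinv z)]
  simp only [Matrix.smul_mul, Matrix.mul_smul, Matrix.mul_assoc]
  rw [← Matrix.mul_assoc V, h3, Matrix.one_mul]

theorem ind_sandwich (d : ℕ) {ι κ : Type} [Fintype ι] [DecidableEq ι] [Fintype κ] [DecidableEq κ]
    {p : ℕ → X → Matrix ι ι ℂ} (hp : Valid d p)
    {U : X → Matrix κ ι ℂ} {U' : X → Matrix ι κ ℂ} {V : X → Matrix ι κ ℂ} {V' : X → Matrix κ ι ℂ}
    (hU : Continuous U) (hU' : Continuous U') (hV : Continuous V) (hV' : Continuous V')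
    (h1 : ∀ x, U x * U' x = 1) (h2 : ∀ x, U' x * U x = 1) (h3 : ∀ x, V x * V' x = 1)
    (h4 : ∀ x, V' x * V x = 1) :
    ind φ d (fun i x => U x * p i x * V x) = ind φ d p := by
  induction d generalizing ι κ with
  | zero =>
    have hs := fun x => (hp.pencil x).sandwich_rect (h1 x) (h2 x) (h3 x) (h4 x)
    have c0 := hp.1 0
    have c1 := hp.1 1
    have i1 := isIdem_pq c0 c1 hp.pencil
    have c2 := i1.1
    refine φ.equiv (isIdem_pq (by fun_prop) (by fun_prop) fun x => (hs x).1) i1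
      (u := fun x => U x) (v := fun x => pq (p 0 x) (p 1 x) * U' x) hU (by fun_prop)
      (fun x => ?_) (fun x => ?_)
    · rw [(hs x).2, Matrix.mul_assoc]
    · rw [Matrix.mul_assoc, h2, Matrix.mul_one]
  | succ d ih =>
    rw [ind, ind, ← ih hp.hig (U := fun x => fromBlocks (U x) 0 0 (V' x))
      (U' := fun x => fromBlocks (U' x) 0 0 (V x))
      (V := fun x => fromBlocks (V x) 0 0 (V x)) (V' := fun x => fromBlocks (V' x) 0 0 (V' x))
      (by fun_prop) (by fun_prop) (by fun_prop) (by fun_prop)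
      (fun x => by simp [fromBlocks_multiply, h1, h4])
      (fun x => by simp [fromBlocks_multiply, h2, h3])
      (fun x => by simp [fromBlocks_multiply, h3]) (fun x => by simp [fromBlocks_multiply, h4])]
    refine ind_congr φ d fun i x => ?_
    simp only [SphereParallel.hig, fromBlocks_multiply]
    congr 1
    · split_ifs <;> simp
    · simp
    · split_ifs <;> simp [h4]
    · split_ifs <;> simp [h4]

theorem ev_fromBlocks (d : ℕ) (p : ℕ → X → Matrix ι ι ℂ) (q : ℕ → X → Matrix κ κ ℂ)
    (y : X × Circle) :
    ev d (fun i x => fromBlocks (p i x) 0 0 (q i x)) y = fromBlocks (ev d p y) 0 0 (ev d q y) := by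
  simp [ev, fromBlocks_smul, sum_fromBlocks]

theorem Valid.fromBlocks {d : ℕ} {p : ℕ → X → Matrix ι ι ℂ} {q : ℕ → X → Matrix κ κ ℂ}
    (hp : Valid d p) (hq : Valid d q) :
    Valid d (fun i x => Matrix.fromBlocks (p i x) 0 0 (q i x)) :=
  ⟨fun i => by have := hp.1 i; have := hq.1 i; fun_prop, fun y => by
    rw [ev_fromBlocks]; exact isUnit_fromBlocks_diag (hp.2 y) (hq.2 y)⟩

theorem submatrix_eq_mul (e : ι ≃ κ) (M : Matrix κ κ ℂ) :
    M.submatrix e e = (1 : Matrix κ κ ℂ).submatrix e id * M *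
      (1 : Matrix κ κ ℂ).submatrix id e := by
  ext i j
  simp [Matrix.mul_apply, Matrix.one_apply]

theorem perm_mul_perm (e : ι ≃ κ) :
    (1 : Matrix κ κ ℂ).submatrix e id * (1 : Matrix κ κ ℂ).submatrix id e = 1 ∧
    (1 : Matrix κ κ ℂ).submatrix id e * (1 : Matrix κ κ ℂ).submatrix e id = 1 := by
  have h : (1 : Matrix κ κ ℂ).submatrix e id * (1 : Matrix κ κ ℂ).submatrix id e = 1 := by
    ext i j
    simp [Matrix.mul_apply, Matrix.one_apply]
  exact ⟨h, (Matrix.mul_eq_one_comm_of_equiv e).1 h⟩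

theorem ind_reindex (d : ℕ) {p : ℕ → X → Matrix κ κ ℂ} (hp : Valid d p) (e : ι ≃ κ) :
    ind φ d (fun i x => (p i x).submatrix e e) = ind φ d p := by
  have := perm_mul_perm e
  simp only [submatrix_eq_mul]
  exact ind_sandwich φ d hp continuous_const continuous_const continuous_const continuous_const
    (fun _ => this.1) (fun _ => this.2) (fun _ => this.2) fun _ => this.1

theorem ind_fromBlocks (d : ℕ) {ι κ : Type} [Fintype ι] [DecidableEq ι] [Fintype κ]
    [DecidableEq κ] {p : ℕ → X → Matrix ι ι ℂ} {q : ℕ → X → Matrix κ κ ℂ}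
    (hp : Valid d p) (hq : Valid d q) :
    ind φ d (fun i x => Matrix.fromBlocks (p i x) 0 0 (q i x)) = ind φ d p + ind φ d q := by
  induction d generalizing ι κ with
  | zero =>
    simp only [ind]
    rw [← φ.fromBlocks (isIdem_pq (hp.1 0) (hp.1 1) hp.pencil)
      (isIdem_pq (hq.1 0) (hq.1 1) hq.pencil)]
    exact φ.congr fun x => ((hp.pencil x).fromBlocks (hq.pencil x)).2
  | succ d ih =>
    simp only [ind]
    rw [← ih hp.hig hq.hig, ← ind_reindex φ d (hp.hig.fromBlocks hq.hig)
      (Equiv.sumSumSumComm ι κ ι κ)]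
    refine ind_congr φ d fun i x => ?_
    ext a b
    rcases a with (a | a) | (a | a) <;> rcases b with (b | b) | (b | b) <;>
      simp only [SphereParallel.hig] <;> split_ifs <;> simp [Matrix.one_apply]

/-- The constant polynomial one. -/
def pone (i : ℕ) (x : X) : Matrix ι ι ℂ := if i = 0 then 1 else 0

/-- The constant polynomial `z`. -/
def pz (i : ℕ) (x : X) : Matrix ι ι ℂ := if i = 1 then 1 else 0

theorem ev_pone (d : ℕ) (y : X × Circle) : ev d (pone (ι := ι)) y = 1 := by
  simp only [ev, pone, sum_delta_zero]

theorem ev_pz (d : ℕ) (y : X × Circle) : ev d (pz (ι := ι)) y = (y.2 : ℂ) • 1 := by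
  simp only [ev, pz, sum_delta_one]

theorem valid_pone (d : ℕ) : Valid d (pone (X := X) (ι := ι)) :=
  ⟨fun i => continuous_const, fun y => by rw [ev_pone]; exact isUnit_one⟩

theorem valid_pz (d : ℕ) : Valid d (pz (X := X) (ι := ι)) :=
  ⟨fun i => continuous_const, fun y => by
    rw [ev_pz]; exact isUnit_smul y.2.coe_ne_zero isUnit_one⟩

variable [CompactSpace X]

theorem ind_raise_aux (d : ℕ) (h1 : ind φ d (pone (ι := ι)) = 0) {p : ℕ → X → Matrix ι ι ℂ}
    (hp : Valid d p) (hd : ∀ x, p (d + 2) x = 0) : ind φ (d + 1) p = ind φ d p := by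
  have key := ind_homotopy φ d (p := fun i (y : I × X) =>
    fromBlocks ((1 - ((y.1 : ℝ) : ℂ) ^ 2) • p i y.2 +
        (((y.1 : ℝ) : ℂ) ^ 2) • (if i = 0 then p 0 y.2 else 0))
      (((y.1 : ℝ) : ℂ) • p (i + 1) y.2) (if i = 1 then -(((y.1 : ℝ) : ℂ) • 1) else 0)
      (if i = 0 then 1 else 0)) ?_
  · have e0 := ind_fromBlocks φ d hp (valid_pone (ι := ι) d)
    rw [h1, add_zero] at e0
    rw [← e0, ind]
    symm
    convert key using 1
    · refine ind_congr φ d fun i x => ?_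
      simp [pone]
    · refine ind_congr φ d fun i x => ?_
      simp [hig]
  · refine ⟨fun i => ?_, fun y => ?_⟩
    · have h1 := hp.1 (i + 1)
      have h2 := hp.1 i
      have h0 : Continuous fun x => if i = 0 then p 0 x else 0 := by
        have := hp.1 0
        split_ifs <;> fun_prop
      have h4 : Continuous fun y : I × X =>
          if i = 1 then -((((y.1 : ℝ) : ℂ)) • (1 : Matrix ι ι ℂ)) else 0 := by
        split_ifs <;> fun_prop
      have h5 : Continuous fun y : I × X => if i = 0 then p 0 y.2 else 0 := h0.comp continuous_snd
      fun_prop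
    · obtain ⟨⟨t, x⟩, z⟩ := y
      have hs := sum_shift (d + 2) p (x, z)
      rw [Finset.sum_range_succ _ (d + 2), hd, smul_zero, add_zero] at hs
      have := isUnit_elementary (hp.2 (x, z))
        (((t : ℝ) : ℂ) • ∑ i ∈ Finset.range (d + 2), (z : ℂ) ^ i • p (i + 1) x)
        (-((z : ℂ) • ((t : ℝ) : ℂ) • 1))
      convert this using 1
      simp only [ev, fromBlocks_smul, sum_fromBlocks, sum_delta_zero, sum_delta_one, smul_neg]
      congr 1
      · simp only [smul_add, Finset.sum_add_distrib]
        have e1 : ∑ i ∈ Finset.range (d + 2), (z : ℂ) ^ i • (((t : ℝ) : ℂ) ^ 2) •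
            (if i = 0 then p 0 x else 0) = (((t : ℝ) : ℂ) ^ 2) • p 0 x := by
          have := sum_delta_zero d (z : ℂ) ((((t : ℝ) : ℂ) ^ 2) • p 0 x)
          rw [← this]
          refine Finset.sum_congr rfl fun i _ => ?_
          split_ifs <;> simp
        rw [e1]
        have e2 : ∑ i ∈ Finset.range (d + 2), (z : ℂ) ^ i • (1 - ((t : ℝ) : ℂ) ^ 2) • p i x =
            (1 - ((t : ℝ) : ℂ) ^ 2) • ∑ i ∈ Finset.range (d + 2), (z : ℂ) ^ i • p i x := by
          rw [Finset.smul_sum]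
          exact Finset.sum_congr rfl fun i _ => smul_comm _ _ _
        rw [e2, ← hs]
        simp only [mul_neg, Matrix.mul_smul, mul_one, smul_smul]
        module
      · rw [Finset.smul_sum]
        exact Finset.sum_congr rfl fun i _ => smul_comm _ _ _

theorem ind_pone (d : ℕ) : ind φ d (pone (ι := ι)) = 0 := by
  induction d with
  | zero =>
    rw [ind, ← φ.val_zero (ι := ι)]
    exact φ.congr fun x => by simp [pone, pq_zero_right]
  | succ d ih => rw [ind_raise_aux φ d ih (valid_pone d) (fun x => by simp [pone]), ih]

theorem ind_raise (d : ℕ) {p : ℕ → X → Matrix ι ι ℂ} (hp : Valid d p)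
    (hd : ∀ x, p (d + 2) x = 0) : ind φ (d + 1) p = ind φ d p :=
  ind_raise_aux φ d (ind_pone φ d) hp hd

theorem ind_pz (d : ℕ) :
    ind φ d (pz (ι := ι)) = φ.val fun _ => (1 : Matrix ι ι ℂ) := by
  induction d with
  | zero =>
    rw [ind]
    exact φ.congr fun x => by simp [pz, pq_zero_left]
  | succ d ih => rw [ind_raise φ d (valid_pz d) (fun x => by simp [pz]), ih]

/-- Multiplication of a polynomial by `z`. -/
def psh (p : ℕ → X → Matrix ι ι ℂ) : ℕ → X → Matrix ι ι ℂ
  | 0, _ => 0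
  | i + 1, x => p i x

theorem ev_psh (d : ℕ) (p : ℕ → X → Matrix ι ι ℂ) (y : X × Circle) :
    ev (d + 1) (psh p) y = (y.2 : ℂ) • ev d p y := by
  rw [ev, ← sum_shift]
  simp [psh, ev]

theorem Valid.psh {d : ℕ} {p : ℕ → X → Matrix ι ι ℂ} (hp : Valid d p) :
    Valid (d + 1) (psh p) :=
  ⟨fun i => by cases i <;> [exact continuous_const; exact hp.1 _], fun y => by
    rw [ev_psh]; exact isUnit_smul y.2.coe_ne_zero (hp.2 y)⟩

theorem ind_psh (d : ℕ) {p : ℕ → X → Matrix ι ι ℂ} (hp : Valid d p) :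
    ind φ (d + 1) (psh p) = ind φ d p + φ.val fun _ => (1 : Matrix ι ι ℂ) := by
  have key := ind_homotopy φ d (p := fun i (y : I × X) =>
    fromBlocks 0 (p i y.2) (if i = 1 then -1 else 0)
      (if i = 0 then (((y.1 : ℝ) : ℂ)) • 1 else 0)) ?_
  · rw [← ind_pz φ d, ← ind_fromBlocks φ d hp (valid_pz d),
      ← ind_sandwich φ d (hp.fromBlocks (valid_pz d)) (U := fun _ => 1) (U' := fun _ => 1)
      (V := fun _ => fromBlocks (0 : Matrix ι ι ℂ) (1 : Matrix ι ι ℂ) (-1 : Matrix ι ι ℂ) 0)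
      (V' := fun _ => fromBlocks (0 : Matrix ι ι ℂ) (-1 : Matrix ι ι ℂ) (1 : Matrix ι ι ℂ) 0)
      continuous_const continuous_const continuous_const continuous_const (by simp) (by simp)
      (by simp [fromBlocks_multiply]) (by simp [fromBlocks_multiply])]
    symm
    convert key using 1
    · refine ind_congr φ d fun i x => ?_
      simp only [pz, one_mul, fromBlocks_multiply]
      congr 1 <;> (try split_ifs) <;> simp
    · rw [ind]
      refine ind_congr φ d fun i x => ?_
      simp [SphereParallel.hig, SphereParallel.psh]
  · refine ⟨fun i => ?_, fun y => ?_⟩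
    · have h1 := hp.1 i
      have h4 : Continuous fun y : I × X =>
          if i = 0 then ((((y.1 : ℝ) : ℂ)) • (1 : Matrix ι ι ℂ)) else 0 := by
        split_ifs <;> fun_prop
      fun_prop
    · obtain ⟨⟨t, x⟩, z⟩ := y
      have u1 := hp.2 (x, z)
      obtain ⟨q, hq⟩ := u1.exists_right_inv
      have hq' := mul_eq_one_comm.1 hq
      have e : ev d (fun i (y : I × X) => fromBlocks 0 (p i y.2) (if i = 1 then -1 else 0)
          (if i = 0 then (((y.1 : ℝ) : ℂ)) • 1 else 0)) ((t, x), z) =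
          fromBlocks (0 : Matrix ι ι ℂ) (ev d p (x, z)) (-((z : ℂ) • 1)) (((t : ℝ) : ℂ) • 1) := by
        simp only [ev, fromBlocks_smul, sum_fromBlocks, sum_delta_zero, sum_delta_one, smul_neg]
        simp
      rw [e]
      have hz : (z : ℂ)⁻¹ * (z : ℂ) = 1 := inv_mul_cancel₀ z.coe_ne_zero
      have hz' : (z : ℂ) * (z : ℂ)⁻¹ = 1 := mul_inv_cancel₀ z.coe_ne_zero
      refine isUnit_of_mul_eq_one (b := fromBlocks (((z : ℂ)⁻¹ * ((t : ℝ) : ℂ)) • q)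
        (-((z : ℂ)⁻¹ • (1 : Matrix ι ι ℂ))) q 0) ?_
      rw [fromBlocks_multiply, ← fromBlocks_one]
      congr 1
      · simp [hq]
      · simp
      · simp only [neg_mul, smul_mul_assoc, one_mul, smul_smul, ← mul_assoc, hz']
        simp
      · simp [smul_smul]

end Index
end SphereParallel

namespace SphereParallel

open Matrix unitInterval Filter Topology

section Approx

variable {X Y : Type} [TopologicalSpace X] [TopologicalSpace Y]
variable {ι κ : Type} [Fintype ι] [DecidableEq ι] [Fintype κ] [DecidableEq κ]

theorem IsGL.exists_near [CompactSpace Y] {G : Y → Matrix ι ι ℂ} (hG : IsGL G) :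
    ∃ ε > 0, ∀ y (M : Matrix ι ι ℂ), (∀ i j, ‖M i j - G y i j‖ < ε) → IsUnit M := by
  have ho : IsOpen {M : ι → ι → ℂ | (Matrix.of M).det ≠ 0} := by
    have : Continuous fun M : ι → ι → ℂ => (Matrix.of M).det :=
      Continuous.matrix_det (A := fun M : ι → ι → ℂ => Matrix.of M) continuous_id
    exact isOpen_ne.preimage this
  have hc : Continuous fun y => (fun i j => G y i j : ι → ι → ℂ) := hG.1
  obtain ⟨ε, hε, h⟩ := (isCompact_range hc).exists_thickening_subset_open ho (by
    rintro _ ⟨y, rfl⟩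
    exact ((Matrix.isUnit_iff_isUnit_det _).1 (hG.2 y)).ne_zero)
  refine ⟨ε, hε, fun y M hM => ?_⟩
  rw [Matrix.isUnit_iff_isUnit_det, isUnit_iff_ne_zero]
  refine h (Metric.mem_thickening_iff.2 ⟨_, ⟨y, rfl⟩, ?_⟩) (a := fun i j => M i j)
  refine (dist_pi_lt_iff hε).2 fun i => (dist_pi_lt_iff hε).2 fun j => ?_
  rw [dist_eq_norm]
  exact hM i j

/-- The monomial `c(x) z ^ k`. -/
noncomputable def mono (k : ℤ) (c : C(X, ℂ)) : C(X × Circle, ℂ) :=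
  ⟨fun y => c y.1 * (y.2 : ℂ) ^ k, by
    have := continuous_circle_zpow k
    have h2 : Continuous fun y : X × Circle => (y.2 : ℂ) ^ k := this.comp continuous_snd
    have := c.continuous
    fun_prop⟩

theorem exists_laurent_approx [CompactSpace X] [T2Space X] {f : X × Circle → ℂ}
    (hf : Continuous f) {ε : ℝ} (hε : 0 < ε) :
    ∃ c : ℤ →₀ C(X, ℂ), ∀ y : X × Circle,
      ‖c.sum (fun k a => a y.1 * (y.2 : ℂ) ^ k) - f y‖ < ε := by
  let M : Submonoid C(X × Circle, ℂ) :=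
    { carrier := {f | ∃ k c, f = mono k c}
      mul_mem' := by
        rintro _ _ ⟨k, c, rfl⟩ ⟨l, d, rfl⟩
        refine ⟨k + l, c * d, ?_⟩
        ext y
        simp only [mono, ContinuousMap.mul_apply, ContinuousMap.coe_mk,
          zpow_add₀ y.2.coe_ne_zero]
        ring
      one_mem' := ⟨0, 1, by ext y; simp [mono]⟩ }
  have hspan : ∀ g ∈ Algebra.adjoin ℂ (M : Set C(X × Circle, ℂ)),
      ∃ c : ℤ →₀ C(X, ℂ), ∀ y : X × Circle, c.sum (fun k a => a y.1 * (y.2 : ℂ) ^ k) = g y := by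
    intro g hg
    rw [← Subalgebra.mem_toSubmodule, Algebra.adjoin_eq_span, Submonoid.closure_eq] at hg
    induction hg using Submodule.span_induction with
    | mem g hg =>
      obtain ⟨k, c, rfl⟩ := hg
      exact ⟨Finsupp.single k c, fun y => by simp [mono]⟩
    | zero => exact ⟨0, fun y => by simp⟩
    | add f g _ _ hf hg =>
      obtain ⟨c, hc⟩ := hf
      obtain ⟨d, hd⟩ := hg
      refine ⟨c + d, fun y => ?_⟩
      rw [Finsupp.sum_add_index' (by simp) (by intros; simp [add_mul]), hc, hd]
      rfl
    | smul a f _ hf =>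
      obtain ⟨c, hc⟩ := hf
      refine ⟨a • c, fun y => ?_⟩
      rw [Finsupp.sum_smul_index' (by simp), ContinuousMap.smul_apply, ← hc, Finsupp.smul_sum]
      simp [Finsupp.sum, mul_assoc]
  let S : StarSubalgebra ℂ C(X × Circle, ℂ) :=
    { Algebra.adjoin ℂ (M : Set C(X × Circle, ℂ)) with
      star_mem' := by
        intro g hg
        induction hg using Algebra.adjoin_induction with
        | mem g hg =>
          obtain ⟨k, c, rfl⟩ := hg
          refine Algebra.subset_adjoin ⟨-k, star c, ?_⟩
          ext y
          have : (starRingEnd ℂ) (y.2 : ℂ) = (y.2 : ℂ)⁻¹ := by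
            rw [← Circle.coe_inv_eq_conj, Circle.coe_inv]
          simp [mono, this]
        | algebraMap r =>
          rw [Algebra.algebraMap_eq_smul_one, star_smul, star_one]
          exact Subalgebra.smul_mem _ (Subalgebra.one_mem _) _
        | add f g _ _ hf hg => rw [star_add]; exact Subalgebra.add_mem _ hf hg
        | mul f g _ _ hf hg => rw [star_mul]; exact Subalgebra.mul_mem _ hg hf }
  have hS : S.SeparatesPoints := by
    rintro ⟨x, z⟩ ⟨x', z'⟩ hne
    by_cases hz : z = z'
    · subst hz
      have hx : x ≠ x' := fun h => hne (by rw [h])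
      obtain ⟨f, hf0, hf1, -⟩ := exists_continuous_zero_one_of_isClosed
        (isClosed_singleton (x := x)) (isClosed_singleton (x := x')) (by simpa using hx)
      refine ⟨_, ⟨mono 0 ⟨fun a => (f a : ℂ), by fun_prop⟩,
        Algebra.subset_adjoin ⟨_, _, rfl⟩, rfl⟩, ?_⟩
      have h0 : f x = 0 := hf0 rfl
      have h1 : f x' = 1 := hf1 rfl
      simp [mono, h0, h1]
    · refine ⟨_, ⟨mono 1 1, Algebra.subset_adjoin ⟨_, _, rfl⟩, rfl⟩, ?_⟩
      simpa [mono, Circle.ext_iff] using hz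
  have htop := ContinuousMap.starSubalgebra_topologicalClosure_eq_top_of_separatesPoints S hS
  have hmem : (⟨f, hf⟩ : C(X × Circle, ℂ)) ∈ S.topologicalClosure := by
    rw [htop]; trivial
  obtain ⟨g, hg, hgf⟩ := Metric.mem_closure_iff.1 hmem ε hε
  obtain ⟨c, hc⟩ := hspan g hg
  refine ⟨c, fun y => ?_⟩
  rw [hc, ← dist_eq_norm, dist_comm]
  exact (ContinuousMap.dist_lt_iff hε).1 hgf y

/-- The Laurent polynomial `z ^ (-j) p(z)`. -/
noncomputable def lv (j d : ℕ) (p : ℕ → X → Matrix ι ι ℂ) (y : X × Circle) : Matrix ι ι ℂ :=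
  ((y.2 : ℂ) ^ j)⁻¹ • ev d p y

theorem lv_isUnit_iff (j d : ℕ) (p : ℕ → X → Matrix ι ι ℂ) (y : X × Circle) :
    IsUnit (lv j d p y) ↔ IsUnit (ev d p y) := by
  have hz : (y.2 : ℂ) ^ j ≠ 0 := pow_ne_zero _ y.2.coe_ne_zero
  refine ⟨fun h => ?_, fun h => isUnit_smul (inv_ne_zero hz) h⟩
  have := isUnit_smul hz h
  rwa [lv, smul_smul, mul_inv_cancel₀ hz, one_smul] at this

theorem continuous_lv (j d : ℕ) {p : ℕ → X → Matrix ι ι ℂ} (hp : ∀ i, Continuous (p i)) :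
    Continuous (lv j d p) := by
  have h1 := continuous_ev d hp
  have h2 : Continuous fun y : X × Circle => ((y.2 : ℂ) ^ j)⁻¹ :=
    Continuous.inv₀ (by fun_prop) fun y => pow_ne_zero _ y.2.coe_ne_zero
  exact h2.smul h1

theorem exists_lv_approx [CompactSpace X] [T2Space X] {g : X × Circle → Matrix ι ι ℂ}
    (hg : Continuous g) {ε : ℝ} (hε : 0 < ε) :
    ∃ (j d : ℕ) (p : ℕ → X → Matrix ι ι ℂ), (∀ i, Continuous (p i)) ∧
      ∀ y a b, ‖lv j d p y a b - g y a b‖ < ε := by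
  choose c hc using fun a b => exists_laurent_approx (hg.matrix_elem a b) hε
  obtain ⟨N, hN⟩ : ∃ N : ℕ, ∀ a b, ∀ k ∈ (c a b).support, k.natAbs ≤ N :=
    ⟨∑ a, ∑ b, ∑ k ∈ (c a b).support, k.natAbs, fun a b k hk =>
      ((Finset.single_le_sum (f := Int.natAbs) (by simp) hk).trans
        (Finset.single_le_sum (f := fun b => ∑ k ∈ (c a b).support, k.natAbs) (by simp)
          (Finset.mem_univ b))).trans
        (Finset.single_le_sum (f := fun a => ∑ b, ∑ k ∈ (c a b).support, k.natAbs) (by simp)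
          (Finset.mem_univ a))⟩
  refine ⟨N, 2 * N, fun i x => Matrix.of fun a b => c a b ((i : ℤ) - N) x, fun i =>
    continuous_matrix fun a b => (c a b ((i : ℤ) - N)).continuous, fun y a b => ?_⟩
  have hz := y.2.coe_ne_zero
  convert hc a b y using 3
  rw [Finsupp.sum_of_support_subset (s := (Finset.range (2 * N + 2)).map
    ⟨fun i : ℕ => (i : ℤ) - N, fun i j h => by simpa using h⟩) _ _ _ (by simp)]
  · simp only [lv, ev, Matrix.smul_apply, Matrix.sum_apply, Finset.sum_map, smul_eq_mul,
      Finset.mul_sum, Matrix.of_apply]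
    refine Finset.sum_congr rfl fun i _ => ?_
    change _ = c a b ((i : ℤ) - N) y.1 * (y.2 : ℂ) ^ ((i : ℤ) - (N : ℤ))
    rw [zpow_sub₀ hz, zpow_natCast, zpow_natCast]
    field_simp
  · intro k hk
    have := hN a b k hk
    simp only [Finset.mem_map, Finset.mem_range]
    exact ⟨(k + N).toNat, by omega, show (((k + N).toNat : ℕ) : ℤ) - N = k by omega⟩

end Approx

section ToGL

variable {X : Type} [TopologicalSpace X] [CompactSpace X]
variable {ι κ : Type} [Fintype ι] [DecidableEq ι] [Fintype κ] [DecidableEq κ]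
variable (φ : IdemFun X)

/-- The index of a Laurent polynomial. -/
noncomputable def lval (j d : ℕ) (p : ℕ → X → Matrix ι ι ℂ) : ℤ :=
  ind φ d p - j * φ.val fun _ => (1 : Matrix ι ι ℂ)

theorem ind_congr_lt (d : ℕ) {ι : Type} [Fintype ι] [DecidableEq ι] {p q : ℕ → X → Matrix ι ι ℂ}
    (h : ∀ i < d + 2, ∀ x, p i x = q i x) : ind φ d p = ind φ d q := by
  induction d generalizing ι with
  | zero => exact φ.congr fun x => by rw [h 0 (by omega), h 1 (by omega)]
  | succ d ih =>
    refine ih fun i hi x => ?_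
    simp only [hig]
    rw [h 0 (by omega), h (i + 1) (by omega)]

theorem ev_congr_lt (d : ℕ) {p q : ℕ → X → Matrix ι ι ℂ}
    (h : ∀ i < d + 2, ∀ x, p i x = q i x) (y : X × Circle) : ev d p y = ev d q y :=
  Finset.sum_congr rfl fun i hi => by rw [h i (Finset.mem_range.1 hi)]

theorem normalise_shift (j d : ℕ) {p : ℕ → X → Matrix ι ι ℂ} (hp : Valid d p) :
    ∃ p' : ℕ → X → Matrix ι ι ℂ, Valid (d + 1) p' ∧ (∀ y, lv (j + 1) (d + 1) p' y = lv j d p y) ∧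
      lval φ (j + 1) (d + 1) p' = lval φ j d p := by
  refine ⟨psh p, hp.psh, fun y => ?_, ?_⟩
  · have hz := y.2.coe_ne_zero
    rw [lv, ev_psh, smul_smul, lv, pow_succ]
    congr 1
    field_simp
  · rw [lval, ind_psh φ d hp, lval]; push_cast; ring

theorem normalise_raise (j d : ℕ) {p : ℕ → X → Matrix ι ι ℂ} (hp : Valid d p) :
    ∃ p' : ℕ → X → Matrix ι ι ℂ, Valid (d + 1) p' ∧ (∀ y, lv j (d + 1) p' y = lv j d p y) ∧
      lval φ j (d + 1) p' = lval φ j d p := by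
  have h1 : ∀ i < d + 2, ∀ x, (fun i x => if i < d + 2 then p i x else 0 : ℕ → X → _) i x = p i x :=
    fun i hi x => if_pos hi
  have e1 : ∀ y, ev (d + 1) (fun i x => if i < d + 2 then p i x else 0) y = ev d p y := fun y => by
    rw [← ev_congr_lt d h1]
    exact (Finset.sum_range_succ _ (d + 2)).trans (by simp [ev])
  have c1 : ∀ i, Continuous fun x => if i < d + 2 then p i x else 0 := fun i => by
    have := hp.1 i
    split_ifs <;> fun_prop
  refine ⟨fun i x => if i < d + 2 then p i x else 0, ⟨c1, fun y => ?_⟩, fun y => ?_, ?_⟩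
  · rw [e1]; exact hp.2 y
  · rw [lv, e1]; rfl
  · rw [lval, ind_raise φ d ⟨c1, fun y => by rw [ev_congr_lt d h1]; exact hp.2 y⟩ (by simp),
      ind_congr_lt φ d h1]; rfl

theorem normalise (j d m e : ℕ) {p : ℕ → X → Matrix ι ι ℂ} (hp : Valid d p) :
    ∃ p' : ℕ → X → Matrix ι ι ℂ, Valid (d + m + e) p' ∧
      (∀ y, lv (j + m) (d + m + e) p' y = lv j d p y) ∧
      lval φ (j + m) (d + m + e) p' = lval φ j d p := by
  induction e with
  | zero =>
    induction m with
    | zero => exact ⟨p, hp, fun _ => rfl, rfl⟩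
    | succ m ih =>
      obtain ⟨p', h1, h2, h3⟩ := ih
      obtain ⟨p'', h1', h2', h3'⟩ := normalise_shift φ (j + m) (d + m) h1
      exact ⟨p'', h1', fun y => (h2' y).trans (h2 y), h3'.trans h3⟩
  | succ e ih =>
    obtain ⟨p', h1, h2, h3⟩ := ih
    obtain ⟨p'', h1', h2', h3'⟩ := normalise_raise φ (j + m) (d + m + e) h1
    exact ⟨p'', h1', fun y => (h2' y).trans (h2 y), h3'.trans h3⟩

theorem exists_common (j d j' d' : ℕ) {p : ℕ → X → Matrix ι ι ℂ} (hp : Valid d p)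
    {p' : ℕ → X → Matrix κ κ ℂ} (hp' : Valid d' p') :
    ∃ (J D : ℕ) (q : ℕ → X → Matrix ι ι ℂ) (q' : ℕ → X → Matrix κ κ ℂ), Valid D q ∧ Valid D q' ∧
      (∀ y, lv J D q y = lv j d p y) ∧ (∀ y, lv J D q' y = lv j' d' p' y) ∧
      lval φ J D q = lval φ j d p ∧ lval φ J D q' = lval φ j' d' p' := by
  obtain ⟨q, h1, h2, h3⟩ := normalise φ j d j' (d' + j) hp
  obtain ⟨q', h1', h2', hqq⟩ := normalise φ j' d' j (d + j') hp'
  have e1 : j' + j = j + j' := by omega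
  have e2 : d' + j + (d + j') = d + j' + (d' + j) := by omega
  rw [e2] at h1'
  simp only [e1, e2] at h2' hqq
  exact ⟨_, _, q, q', h1, h1', h2, h2', h3, hqq⟩

/-- The straight segment between two families consists of invertible matrices. -/
def Seg {Y : Type} (g h : Y → Matrix ι ι ℂ) : Prop :=
  ∀ y, ∀ t : ℝ, 0 ≤ t → t ≤ 1 → IsUnit ((1 - (t : ℂ)) • g y + (t : ℂ) • h y)

theorem lval_eq_of_seg {j d j' d' : ℕ} {p p' : ℕ → X → Matrix ι ι ℂ} (hp : Valid d p)
    (hp' : Valid d' p') (H : Seg (lv j d p) (lv j' d' p')) :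
    lval φ j d p = lval φ j' d' p' := by
  obtain ⟨J, D, q, q', h1, h1', h2, h2', h3, h3'⟩ := exists_common φ j d j' d' hp hp'
  rw [← h3, ← h3', lval, lval, ind_segment φ D h1.1 h1'.1]
  intro y t ht0 ht1
  have := H y t ht0 ht1
  rw [← h2, ← h2', lv, lv, smul_comm, smul_comm (t : ℂ), ← smul_add] at this
  have hz : (y.2 : ℂ) ^ J ≠ 0 := pow_ne_zero _ y.2.coe_ne_zero
  have := isUnit_smul hz this
  rwa [smul_smul, mul_inv_cancel₀ hz, one_smul] at this

theorem exists_lval_near [T2Space X] {g : X × Circle → Matrix ι ι ℂ} (hg : IsGL g) {ε : ℝ}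
    (hε : 0 < ε) : ∃ (j d : ℕ) (p : ℕ → X → Matrix ι ι ℂ), Valid d p ∧
      (∀ y a b, ‖lv j d p y a b - g y a b‖ < ε) ∧ Seg g (lv j d p) := by
  obtain ⟨δ, hδ, H⟩ := hg.exists_near
  obtain ⟨j, d, p, hp, h⟩ := exists_lv_approx hg.1 (lt_min hε hδ)
  have hs : Seg g (lv j d p) := fun y t h0 h1 => by
    refine H y _ fun a b => ?_
    have e : ((1 - (t : ℂ)) • g y + (t : ℂ) • lv j d p y) a b - g y a b =
        (t : ℂ) * (lv j d p y a b - g y a b) := by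
      simp only [Matrix.add_apply, Matrix.smul_apply, smul_eq_mul]; ring
    rw [e, norm_mul, Complex.norm_real, Real.norm_of_nonneg h0]
    exact (mul_le_of_le_one_left (norm_nonneg _) h1).trans_lt
      ((h y a b).trans_le (min_le_right _ _))
  refine ⟨j, d, p, ⟨hp, fun y => ?_⟩, fun y a b => (h y a b).trans_le (min_le_left _ _), hs⟩
  have := hs y 1 zero_le_one le_rfl
  rw [← lv_isUnit_iff j]
  simpa using this

theorem lval_unique [T2Space X] {g : X × Circle → Matrix ι ι ℂ} (hg : IsGL g)
    {j d j' d' : ℕ} {p p' : ℕ → X → Matrix ι ι ℂ} (hp : Valid d p)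
    (hp' : Valid d' p') (H : Seg g (lv j d p)) (H' : Seg g (lv j' d' p')) :
    lval φ j d p = lval φ j' d' p' := by
  have main : ∀ {j d : ℕ} {p : ℕ → X → Matrix ι ι ℂ}, Valid d p → Seg g (lv j d p) →
      ∃ ε > 0, ∀ (k e : ℕ) (q : ℕ → X → Matrix ι ι ℂ), Valid e q →
        (∀ y a b, ‖lv k e q y a b - g y a b‖ < ε) → lval φ j d p = lval φ k e q := by
    intro j d p hp H
    have c1 := continuous_lv j d hp.1
    have c2 := hg.1
    have hG : IsGL fun w : I × (X × Circle) => (1 - ((w.1 : ℝ) : ℂ)) • g w.2 +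
        ((w.1 : ℝ) : ℂ) • lv j d p w.2 := ⟨by fun_prop, fun w => H _ _ w.1.2.1 w.1.2.2⟩
    obtain ⟨ε, hε, near⟩ := hG.exists_near
    refine ⟨ε, hε, fun k e q hq hqg => (lval_eq_of_seg φ hq hp fun y t h0 h1 => ?_).symm⟩
    refine near (⟨t, h0, h1⟩, y) _ fun a b => ?_
    simp only [Matrix.add_apply, Matrix.smul_apply, smul_eq_mul]
    have e1 : (1 - (t : ℂ)) * lv k e q y a b + t * lv j d p y a b -
        ((1 - (t : ℂ)) * g y a b + t * lv j d p y a b) =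
        ((1 - t : ℝ) : ℂ) * (lv k e q y a b - g y a b) := by push_cast; ring
    rw [e1, norm_mul, Complex.norm_real, Real.norm_of_nonneg (by linarith)]
    exact (mul_le_of_le_one_left (norm_nonneg _) (by linarith)).trans_lt (hqg y a b)
  obtain ⟨ε, hε, h⟩ := main hp H
  obtain ⟨ε', hε', h'⟩ := main hp' H'
  obtain ⟨k, e, q, hq, hqg, -⟩ := exists_lval_near hg (lt_min hε hε')
  rw [h k e q hq fun y a b => (hqg y a b).trans_le (min_le_left _ _),
    h' k e q hq fun y a b => (hqg y a b).trans_le (min_le_right _ _)]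

open Classical in
/-- The value of the desuspension of an invariant of idempotents. -/
noncomputable def glVal (g : X × Circle → Matrix ι ι ℂ) : ℤ :=
  if h : ∃ L : ℕ × ℕ × (ℕ → X → Matrix ι ι ℂ), Valid L.2.1 L.2.2 ∧ Seg g (lv L.1 L.2.1 L.2.2) then
    lval φ h.choose.1 h.choose.2.1 h.choose.2.2 else 0

variable [T2Space X]

theorem glVal_eq {g : X × Circle → Matrix ι ι ℂ} (hg : IsGL g) {j d : ℕ}
    {p : ℕ → X → Matrix ι ι ℂ} (hp : Valid d p) (H : Seg g (lv j d p)) :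
    glVal φ g = lval φ j d p := by
  have h : ∃ L : ℕ × ℕ × (ℕ → X → Matrix ι ι ℂ), Valid L.2.1 L.2.2 ∧
      Seg g (lv L.1 L.2.1 L.2.2) := ⟨(j, d, p), hp, H⟩
  rw [glVal, dif_pos h]
  exact lval_unique φ hg h.choose_spec.1 hp h.choose_spec.2 H

theorem Seg.refl {Y : Type} {g : Y → Matrix ι ι ℂ} (hg : ∀ y, IsUnit (g y)) : Seg g g :=
  fun y t _ _ => by
    rw [← add_smul, sub_add_cancel, one_smul]; exact hg y

theorem glVal_ev {d : ℕ} {p : ℕ → X → Matrix ι ι ℂ} (hp : Valid d p) :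
    glVal φ (ev d p) = ind φ d p := by
  have e : lv 0 d p = ev d p := funext fun y => by simp [lv]
  rw [glVal_eq φ (j := 0) hp.isGL hp (by rw [e]; exact Seg.refl hp.2), lval]
  simp

theorem glVal_homotopy {G : I × (X × Circle) → Matrix ι ι ℂ} (hG : IsGL G) :
    glVal φ (fun y => G (0, y)) = glVal φ (fun y => G (1, y)) := by
  have hG' : IsGL fun w : (I × X) × Circle => G (w.1.1, (w.1.2, w.2)) := hG.comp (by fun_prop)
  obtain ⟨j, d, p, hp, -, hs⟩ := exists_lval_near hG' one_pos
  have hv : ∀ t : I, Valid d (fun i x => p i (t, x)) := fun t =>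
    ⟨fun i => (hp.1 i).comp (by fun_prop), fun y => hp.2 ((t, y.1), y.2)⟩
  have hst : ∀ t : I, glVal φ (fun y => G (t, y)) = lval φ j d (fun i x => p i (t, x)) := fun t =>
    glVal_eq φ (hG.comp (by fun_prop)) (hv t) fun y => hs ((t, y.1), y.2)
  rw [hst, hst, lval, lval, ind_homotopy φ d hp]

theorem glVal_fromBlocks {g : X × Circle → Matrix ι ι ℂ} {h : X × Circle → Matrix κ κ ℂ}
    (hg : IsGL g) (hh : IsGL h) :
    glVal φ (fun y => fromBlocks (g y) 0 0 (h y)) = glVal φ g + glVal φ h := by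
  obtain ⟨j, d, p, hp, -, hs⟩ := exists_lval_near hg one_pos
  obtain ⟨j', d', p', hp', -, hs'⟩ := exists_lval_near hh one_pos
  obtain ⟨J, D, q, q', h1, h1', h2, h2', h3, h3'⟩ := exists_common φ j d j' d' hp hp'
  have s1 : Seg g (lv J D q) := fun y => by rw [h2]; exact hs y
  have s1' : Seg h (lv J D q') := fun y => by rw [h2']; exact hs' y
  rw [glVal_eq φ hg h1 s1, glVal_eq φ hh h1' s1', glVal_eq φ (j := J) (hg.fromBlocks hh)
    (h1.fromBlocks h1')]
  · rw [lval, lval, lval, ind_fromBlocks φ D h1 h1']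
    have := φ.fromBlocks (P := fun _ => (1 : Matrix ι ι ℂ)) (Q := fun _ => (1 : Matrix κ κ ℂ))
      isIdem_one isIdem_one
    simp only [fromBlocks_one] at this
    rw [this]; ring
  · intro y t ht0 ht1
    rw [lv, ev_fromBlocks, fromBlocks_smul, fromBlocks_smul, fromBlocks_smul, fromBlocks_add]
    simp only [smul_zero, add_zero]
    exact isUnit_fromBlocks_diag (s1 y t ht0 ht1) (s1' y t ht0 ht1)

theorem glVal_one : glVal φ (fun _ => (1 : Matrix ι ι ℂ)) = 0 := by
  have := glVal_ev φ (valid_pone (ι := ι) 0)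
  rw [ind_pone] at this
  rw [← this]
  congr 1
  funext y
  rw [ev_pone]

theorem glVal_mul {g h : X × Circle → Matrix ι ι ℂ} (hg : IsGL g) (hh : IsGL h) :
    glVal φ (fun y => g y * h y) = glVal φ g + glVal φ h := by
  have c1 := hg.1
  have c2 := hh.1
  let R : ℝ → Matrix (ι ⊕ ι) (ι ⊕ ι) ℂ := fun θ =>
    fromBlocks ((Real.cos θ : ℂ) • 1) ((Real.sin θ : ℂ) • 1) (-((Real.sin θ : ℂ) • 1))
      ((Real.cos θ : ℂ) • 1)
  have hR : ∀ θ, R θ * R (-θ) = 1 := fun θ => by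
    have h1 : (Real.cos θ : ℂ) * Real.cos θ + Real.sin θ * Real.sin θ = 1 := by
      have := Real.cos_sq_add_sin_sq θ
      rw [sq, sq] at this
      exact_mod_cast this
    simp only [R, fromBlocks_multiply, ← fromBlocks_one, Real.cos_neg, Real.sin_neg,
      Complex.ofReal_neg, neg_neg, smul_mul_smul_comm, mul_one, mul_neg, neg_mul,
      ← add_smul, ← neg_smul]
    congr 1
    · rw [h1, one_smul]
    · rw [show -((Real.cos θ : ℂ) * Real.sin θ) + Real.sin θ * Real.cos θ = 0 by ring, zero_smul]
    · rw [show -((Real.sin θ : ℂ) * Real.cos θ) + Real.cos θ * Real.sin θ = 0 by ring, zero_smul]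
    · rw [show (Real.sin θ : ℂ) * Real.sin θ + (Real.cos θ : ℂ) * Real.cos θ = 1 by
        rw [← h1]; ring, one_smul]
  have cR : Continuous R := by
    simp only [R]; fun_prop
  have hRc : ∀ {f : I × (X × Circle) → ℝ}, Continuous f → IsGL fun w => R (f w) := fun hf =>
    IsGL.of_mul (cR.comp hf) fun w => hR _
  have k := glVal_homotopy φ (G := fun w => fromBlocks (g w.2) 0 0 1 *
    R ((w.1 : ℝ) * (Real.pi / 2)) * fromBlocks (h w.2) 0 0 1 * R (-((w.1 : ℝ) * (Real.pi / 2))))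
    (((((hg.comp continuous_snd).fromBlocks isGL_one).mul (hRc (by fun_prop))).mul
      ((hh.comp continuous_snd).fromBlocks isGL_one)).mul (hRc (by fun_prop)))
  rw [← glVal_fromBlocks φ hg hh]
  have e0 : (fun y => glVal φ (fun y => g y * h y)) = fun _ : Unit =>
      glVal φ (fun y => fromBlocks (g y * h y) 0 0 (1 : Matrix ι ι ℂ)) := by
    rw [glVal_fromBlocks φ (hg.mul hh) isGL_one, glVal_one, add_zero]
  rw [congrFun e0 ()]
  convert k using 2
  · funext y; simp [R, fromBlocks_multiply]
  · funext y; simp [R, fromBlocks_multiply]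

/-- The invariant of invertible matrices over `X × S¹` associated with an invariant of idempotents
over `X`. -/
noncomputable def IdemFun.toGL : GLFun (X × Circle) where
  val := glVal φ
  homotopy' := glVal_homotopy φ
  mul' := glVal_mul φ
  block1' := fun hg => by rw [glVal_fromBlocks φ hg isGL_one, glVal_one, add_zero]
  block2' := fun hg => by rw [glVal_fromBlocks φ isGL_one hg, glVal_one, zero_add]

theorem IdemFun.toGL_pencil {a b : X → Matrix ι ι ℂ} (ha : Continuous a) (hb : Continuous b)
    (h : ∀ x, Pencil (a x) (b x)) :
    φ.toGL.val (fun y => a y.1 + (y.2 : ℂ) • b y.1) = φ.val fun x => pq (a x) (b x) := by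
  have hv : Valid 0 (fun i x => if i = 0 then a x else b x) :=
    ⟨fun i => by
      change Continuous fun x => if i = 0 then a x else b x
      split_ifs <;> assumption, fun y => by
      simpa [ev, Finset.sum_range_succ] using h y.1 y.2⟩
  have := glVal_ev φ hv
  rw [ind] at this
  simp only [if_true, one_ne_zero, if_false] at this
  rw [← this]
  refine φ.toGL.congr fun y => ?_
  simp [ev, Finset.sum_range_succ]

theorem IdemFun.toGL_pullback {g : X → Matrix ι ι ℂ} (hg : IsGL g) :
    φ.toGL.val (fun y => g y.1) = 0 := by
  have := φ.toGL_pencil (b := fun _ => (0 : Matrix ι ι ℂ)) hg.1 continuous_const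
    (fun x z => by simpa using hg.2 x)
  simpa [pq_zero_right, φ.val_zero] using this

theorem IdemFun.toGL_idem {E : X → Matrix ι ι ℂ} (hE : IsIdem E) :
    φ.toGL.val (fun y => 1 - E y.1 + (y.2 : ℂ) • E y.1) = φ.val E := by
  have := φ.toGL_pencil (a := fun x => 1 - E x) hE.compl.1 hE.1
    fun x => (pq_idem_pencil (hE.2 x)).1
  rw [this]
  exact φ.congr fun x => (pq_idem_pencil (hE.2 x)).2

end ToGL
end SphereParallel

namespace SphereParallel

open Matrix unitInterval Filter Topology

section Unique

variable {X : Type} [TopologicalSpace X]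

theorem GLFun.upper {Y ι κ : Type} [TopologicalSpace Y] [Fintype ι] [DecidableEq ι] [Fintype κ]
    [DecidableEq κ] (μ : GLFun Y) {b : Y → Matrix ι κ ℂ} (hb : Continuous b) :
    μ.val (fun y => Matrix.fromBlocks 1 (b y) 0 1) = 0 := by
  rw [← μ.val_one (ι := ι ⊕ κ)]
  symm
  refine μ.homotopy (G := fun w => Matrix.fromBlocks 1 (((w.1 : ℝ) : ℂ) • b w.2) 0 1)
    ⟨by fun_prop, fun w => isUnit_upper _⟩ (by simp) (by simp)

theorem GLFun.lower {Y ι κ : Type} [TopologicalSpace Y] [Fintype ι] [DecidableEq ι] [Fintype κ]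
    [DecidableEq κ] (μ : GLFun Y) {b : Y → Matrix κ ι ℂ} (hb : Continuous b) :
    μ.val (fun y => Matrix.fromBlocks 1 0 (b y) 1) = 0 := by
  rw [← μ.val_one (ι := ι ⊕ κ)]
  symm
  refine μ.homotopy (G := fun w => Matrix.fromBlocks 1 0 (((w.1 : ℝ) : ℂ) • b w.2) 1)
    ⟨by fun_prop, fun w => isUnit_lower _⟩ (by simp) (by simp)

theorem isGL_idem {ι : Type} [Fintype ι] [DecidableEq ι]
    {E : X → Matrix ι ι ℂ} (hE : IsIdem E) :
    IsGL fun y : X × Circle => 1 - E y.1 + (y.2 : ℂ) • E y.1 := by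
  have := hE.1
  exact ⟨by fun_prop, fun y => (pq_idem_pencil (hE.2 y.1)).1 y.2⟩

/-- Two invariants agree on pullbacks and on the clutching functions of idempotents. -/
structure AgreeOnBasic (μ ν : GLFun (X × Circle)) : Prop where
  pullback : ∀ {ι : Type} [Fintype ι] [DecidableEq ι] {g : X → Matrix ι ι ℂ}, IsGL g →
    μ.val (fun y => g y.1) = ν.val (fun y => g y.1)
  idem : ∀ {ι : Type} [Fintype ι] [DecidableEq ι] {E : X → Matrix ι ι ℂ}, IsIdem E →
    μ.val (fun y => 1 - E y.1 + (y.2 : ℂ) • E y.1) = ν.val fun y => 1 - E y.1 + (y.2 : ℂ) • E y.1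

variable {μ ν : GLFun (X × Circle)} {ι : Type} [Fintype ι] [DecidableEq ι]

theorem GLFun.pencil_split (μ : GLFun (X × Circle)) {a b : X → Matrix ι ι ℂ} (ha : Continuous a)
    (hb : Continuous b) (h : ∀ x, Pencil (a x) (b x)) :
    IsGL (fun x => (1 - pq (a x) (b x)) * a x + pq (a x) (b x) * b x) ∧
    μ.val (fun y : X × Circle => a y.1 + (y.2 : ℂ) • b y.1) =
      μ.val (fun y => 1 - pq (a y.1) (b y.1) + (y.2 : ℂ) • pq (a y.1) (b y.1)) +
      μ.val (fun y => (1 - pq (a y.1) (b y.1)) * a y.1 + pq (a y.1) (b y.1) * b y.1) := by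
  have hQ := isIdem_pq ha hb h
  have hQc := hQ.1
  have g1 : IsGL (fun x => (1 - pq (a x) (b x)) * a x + pq (a x) (b x) * b x) := by
    refine ⟨by fun_prop, fun x => ?_⟩
    simpa using (h x).homotopy_isUnit le_rfl zero_le_one 1
  refine ⟨g1, ?_⟩
  rw [← μ.mul' (isGL_idem hQ) (g1.comp continuous_fst)]
  symm
  have e : ∀ y : X × Circle, (1 - pq (a y.1) (b y.1) + (y.2 : ℂ) • pq (a y.1) (b y.1)) *
      ((1 - pq (a y.1) (b y.1)) * a y.1 + pq (a y.1) (b y.1) * b y.1) =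
      (1 - pq (a y.1) (b y.1)) * a y.1 + (y.2 : ℂ) • (pq (a y.1) (b y.1) * b y.1) := by
    intro y
    have hq : pq (a y.1) (b y.1) * pq (a y.1) (b y.1) = pq (a y.1) (b y.1) := hQ.2 y.1
    generalize pq (a y.1) (b y.1) = Q at hq
    have q1 : (1 - Q) * (1 - Q) = 1 - Q := by rw [mul_sub, sub_mul, sub_mul, hq]; simp
    have q2 : (1 - Q) * Q = 0 := by rw [sub_mul, hq]; simp
    have q3 : Q * (1 - Q) = 0 := by rw [mul_sub, hq]; simp
    rw [add_mul, mul_add, mul_add, ← mul_assoc, ← mul_assoc, q1, q2, smul_mul_assoc,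
      smul_mul_assoc, ← mul_assoc, ← mul_assoc, q3, hq]
    simp
  rw [μ.congr e]
  have c3 : Continuous fun y : X × Circle => pq (a y.1) (b y.1) := hQc.comp continuous_fst
  refine μ.segment (by fun_prop) (by fun_prop) fun y t h0 h1 => ?_
  convert (h y.1).homotopy_isUnit h0 h1 y.2 using 1
  simp only [sub_mul, one_mul, mul_add, mul_smul_comm, smul_add, smul_sub, sub_smul, one_smul,
    smul_smul]
  abel

theorem AgreeOnBasic.eq_ev (H : AgreeOnBasic μ ν) (d : ℕ) {ι : Type} [Fintype ι] [DecidableEq ι]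
    {p : ℕ → X → Matrix ι ι ℂ} (hp : Valid d p) : μ.val (ev d p) = ν.val (ev d p) := by
  induction d generalizing ι with
  | zero =>
    have e : ∀ y, SphereParallel.ev 0 p y = p 0 y.1 + (y.2 : ℂ) • p 1 y.1 := fun y => by
      simp [SphereParallel.ev, Finset.sum_range_succ]
    rw [funext e]
    obtain ⟨h1, h2⟩ := μ.pencil_split (hp.1 0) (hp.1 1) hp.pencil
    obtain ⟨-, h3⟩ := ν.pencil_split (hp.1 0) (hp.1 1) hp.pencil
    rw [h2, h3, H.idem (isIdem_pq (hp.1 0) (hp.1 1) hp.pencil), H.pullback h1]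
  | succ d ih =>
    have key : ∀ μ : GLFun (X × Circle),
        μ.val (SphereParallel.ev d (SphereParallel.hig p)) =
          μ.val (SphereParallel.ev (d + 1) p) := by
      intro μ
      have c : Continuous fun y : X × Circle =>
          ∑ i ∈ Finset.range (d + 2), (y.2 : ℂ) ^ i • p (i + 1) y.1 := by
        have := hp.1
        fun_prop
      have c2 : Continuous fun y : X × Circle => -((y.2 : ℂ) • (1 : Matrix ι ι ℂ)) := by fun_prop
      rw [funext (ev_hig_factor d p),
        μ.mul' (IsGL.mul ⟨by fun_prop, fun y => isUnit_upper _⟩ (hp.isGL.fromBlocks isGL_one))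
          ⟨by fun_prop, fun y => isUnit_lower _⟩,
        μ.mul' ⟨by fun_prop, fun y => isUnit_upper _⟩ (hp.isGL.fromBlocks isGL_one),
        μ.upper c, μ.lower c2, μ.block1' hp.isGL]
      ring
    rw [← key μ, ← key ν]
    exact ih hp.hig

theorem AgreeOnBasic.eq [CompactSpace X] [T2Space X] (H : AgreeOnBasic μ ν)
    {g : X × Circle → Matrix ι ι ℂ} (hg : IsGL g) : μ.val g = ν.val g := by
  obtain ⟨j, d, p, hp, -, hs⟩ := exists_lval_near hg one_pos
  have hz : IsGL fun y : X × Circle => (y.2 : ℂ) • (1 : Matrix ι ι ℂ) := by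
    simpa using isGL_idem (isIdem_one (Y := X) (ι := ι))
  have hl : IsGL (lv j d p) := ⟨continuous_lv j d hp.1, fun y => (lv_isUnit_iff ..).2 (hp.2 y)⟩
  have hpow : ∀ k : ℕ, IsGL (fun y : X × Circle => ((y.2 : ℂ) ^ k) • (1 : Matrix ι ι ℂ)) :=
    fun k => ⟨by fun_prop, fun y => isUnit_smul (pow_ne_zero _ y.2.coe_ne_zero) isUnit_one⟩
  have key : ∀ μ : GLFun (X × Circle), μ.val (ev d p) =
      j * μ.val (fun y : X × Circle => (y.2 : ℂ) • (1 : Matrix ι ι ℂ)) + μ.val g := by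
    intro μ
    have k1 : ∀ k : ℕ, μ.val (fun y : X × Circle => ((y.2 : ℂ) ^ k) • (1 : Matrix ι ι ℂ)) =
        k * μ.val (fun y : X × Circle => (y.2 : ℂ) • (1 : Matrix ι ι ℂ)) := by
      intro k
      induction k with
      | zero => simpa using μ.val_one (ι := ι)
      | succ k ih =>
        push_cast
        rw [add_mul, ← ih, one_mul, ← μ.mul' (hpow k) hz]
        exact μ.congr fun y => by rw [smul_mul_smul_comm, mul_one, pow_succ]
    rw [← k1, μ.segment hg.1 hl.1 hs, ← μ.mul' (hpow j) hl]
    refine μ.congr fun y => ?_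
    rw [lv, smul_mul_smul_comm, mul_inv_cancel₀ (pow_ne_zero _ y.2.coe_ne_zero), one_mul, one_smul]
  have e1 := H.eq_ev d hp
  have e2 := H.idem (isIdem_one (Y := X) (ι := ι))
  simp only [sub_self, zero_add] at e2
  rw [key μ, key ν, e2] at e1
  omega

end Unique
end SphereParallel

namespace SphereParallel

open Matrix unitInterval Filter Topology
open scoped Kronecker

section Cyclic

variable {K : Type} [Fintype K] [DecidableEq K]

/-- The spectral projection of a matrix of order three. -/
noncomputable def spr (ζ : ℂ) (s : Matrix K K ℂ) : Matrix K K ℂ :=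
  (3 : ℂ)⁻¹ • (1 + ζ ^ 2 • s + ζ • (s * s))

variable {ζ : ℂ} {s : Matrix K K ℂ}

theorem spr_mul_self (hs : s * s * s = 1) (hζ : ζ ^ 3 = 1) : spr ζ s * s = ζ • spr ζ s := by
  simp only [spr, smul_mul_assoc, add_mul, one_mul, hs, smul_add, smul_smul]
  rw [show ζ * (3⁻¹ * ζ ^ 2) = 3⁻¹ * ζ ^ 3 by ring, hζ, mul_one,
    show ζ * (3⁻¹ * ζ) = 3⁻¹ * ζ ^ 2 by ring, mul_comm ζ]
  abel

theorem commute_spr {G : Matrix K K ℂ} (h : Commute s G) : Commute (spr ζ s) G :=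
  (((Commute.one_left G).add_left (h.smul_left _)).add_left
    ((h.mul_left h).smul_left _)).smul_left _

theorem self_mul_spr (hs : s * s * s = 1) (hζ : ζ ^ 3 = 1) : s * spr ζ s = ζ • spr ζ s := by
  rw [← spr_mul_self hs hζ]
  exact (commute_spr (Commute.refl s)).eq.symm

theorem spr_idem (hs : s * s * s = 1) (hζ : ζ ^ 3 = 1) : spr ζ s * spr ζ s = spr ζ s := by
  have h1 := spr_mul_self hs hζ
  conv_lhs => rw [spr, ← spr]
  nth_rewrite 2 [spr]
  rw [mul_smul_comm, mul_add, mul_add, mul_one, mul_smul_comm, mul_smul_comm, ← mul_assoc, h1,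
    smul_mul_assoc, h1, smul_smul, smul_smul, smul_smul, show ζ ^ 2 * ζ = ζ ^ 3 by ring,
    show ζ * ζ * ζ = ζ ^ 3 by ring, hζ, one_smul]
  module

variable {F : Matrix K K ℂ}

/-- The sum of the cyclic conjugates of a matrix. -/
def orb (s F : Matrix K K ℂ) : Matrix K K ℂ := F + s * F * (s * s) + s * s * F * s

theorem commute_orb (hs : s * s * s = 1) : Commute s (orb s F) := by
  have h1 : s * (s * s) = 1 := by rw [← mul_assoc, hs]
  have e1 : s * (s * s * F * s) = F * s := by
    rw [← mul_assoc, ← mul_assoc, h1, one_mul]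
  have e2 : s * F * (s * s) * s = s * F := by rw [mul_assoc, hs, mul_one]
  have e3 : s * (s * F * (s * s)) = s * s * F * s * s := by simp only [mul_assoc]
  rw [commute_iff_eq, orb, mul_add, mul_add, add_mul, add_mul, e1, e2, e3]
  abel

theorem spr_mul_orb (hs : s * s * s = 1) (hζ : ζ ^ 3 = 1) :
    spr ζ s * orb s F = (3 : ℂ) • (spr ζ s * F * spr ζ s) := by
  have h1 := spr_mul_self hs hζ
  have h2 := self_mul_spr hs hζ
  have hc : spr ζ s * orb s F = spr ζ s * orb s F * spr ζ s := by
    rw [mul_assoc, ← (commute_spr (commute_orb hs)).eq, ← mul_assoc, spr_idem hs hζ]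
  generalize spr ζ s = e at *
  have e1 : e * (s * F * (s * s)) * e = e * F * e := by
    rw [← mul_assoc, ← mul_assoc e, h1, mul_assoc _ _ e, mul_assoc s s e, h2, mul_smul_comm, h2]
    simp only [smul_mul_assoc, mul_smul_comm, smul_smul]
    rw [show ζ * ζ * ζ = ζ ^ 3 by ring, hζ, one_smul]
  have e2 : e * (s * s * F * s) * e = e * F * e := by
    rw [mul_assoc, mul_assoc _ s e, h2, ← mul_assoc, ← mul_assoc, ← mul_assoc, h1,
      smul_mul_assoc, h1]
    simp only [smul_mul_assoc, mul_smul_comm, smul_smul]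
    rw [show ζ * (ζ * ζ) = ζ ^ 3 by ring, hζ, one_smul]
  rw [hc, orb, mul_add, mul_add, add_mul, add_mul, e1, e2]
  module

theorem mul_spr_mul (hF : F * F = F) (h1 : F * s * F = 0) (h2 : F * (s * s) * F = 0) :
    F * spr ζ s * F = (3 : ℂ)⁻¹ • F := by
  simp only [spr, mul_smul_comm, smul_mul_assoc, mul_add, add_mul, mul_one, hF, h1, h2, smul_zero,
    add_zero]

end Cyclic

section Mixed

variable {Y : Type} [TopologicalSpace Y] {K : Type} [Fintype K] [DecidableEq K]
  {ζ : ℂ} {s : Matrix K K ℂ} {F G : Y → Matrix K K ℂ}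

theorem isIdem_spr_mul (hs : s * s * s = 1) (hζ : ζ ^ 3 = 1) (hF : IsIdem F)
    (hc : ∀ y, Commute s (F y)) : IsIdem fun y => spr ζ s * F y := by
  have := hF.1
  exact ⟨by fun_prop, fun y => by
    rw [mul_assoc, ← mul_assoc (F y), ← (commute_spr (hc y)).eq, mul_assoc (spr ζ s), hF.2,
      ← mul_assoc, spr_idem hs hζ]⟩

theorem GLFun.mixed (μ : GLFun Y) (hs : s * s * s = 1) (hζ : ζ ^ 3 = 1) (hF : IsIdem F)
    (hG : IsGL G) (hFG : ∀ y, F y * G y = G y * F y) (hsG : ∀ y, Commute s (G y))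
    (h1 : ∀ y, F y * s * F y = 0) (h2 : ∀ y, F y * (s * s) * F y = 0) :
    μ.val (fun y => 1 - spr ζ s * orb s (F y) + spr ζ s * orb s (F y) * G y) =
      μ.val (fun y => 1 - F y + F y * G y) := by
  have hFc := hF.1
  rw [← μ.corner hF hG hFG (u := fun y => (3 : ℂ) • (spr ζ s * F y)) (v := fun y => F y * spr ζ s)
    (by fun_prop) (by fun_prop)]
  · refine μ.congr fun y => ?_
    have e1 : (3 : ℂ) • (spr ζ s * F y) * (F y * spr ζ s) = spr ζ s * orb s (F y) := by
      rw [spr_mul_orb hs hζ, smul_mul_assoc, mul_assoc, ← mul_assoc (F y), hF.2, ← mul_assoc]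
    have e2 : (3 : ℂ) • (spr ζ s * F y) * G y * (F y * spr ζ s) = spr ζ s * orb s (F y) * G y := by
      rw [spr_mul_orb hs hζ, smul_mul_assoc, smul_mul_assoc, smul_mul_assoc,
        mul_assoc (spr ζ s * F y) (G y), ← mul_assoc (G y), ← hFG,
        mul_assoc (F y) (G y), ← (commute_spr (hsG y)).eq, mul_assoc (spr ζ s),
        ← mul_assoc (F y) (F y), hF.2, mul_assoc (spr ζ s * F y), mul_assoc (spr ζ s)]
    rw [e1, e2]
  · intro y
    rw [mul_smul_comm, mul_assoc, ← mul_assoc (spr ζ s), spr_idem hs hζ, ← mul_assoc,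
      mul_spr_mul (hF.2 y) (h1 y) (h2 y), smul_smul]
    norm_num
  · intro y
    rw [smul_mul_assoc, mul_assoc, hF.2]
  · intro y
    rw [← mul_assoc, hF.2]

theorem corner_add {E E' G : Matrix K K ℂ} (h : E * E' = 0) (hc : Commute E' G)
    (hc' : Commute E G) :
    (1 - E + E * G) * (1 - E' + E' * G) = 1 - (E + E') + (E + E') * G := by
  have h1 : E * G * E' = 0 := by rw [mul_assoc, ← hc.eq, ← mul_assoc, h, zero_mul]
  have h2 : (1 - E + E * G) * (1 - E' + E' * G) = 1 - (E + E') + (E + E') * G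
    + E * E' - E * E' * G - E * G * E' + E * G * E' * G := by noncomm_ring
  rw [h2, h1, h]; simp

end Mixed

section Cube

variable {Y : Type} [TopologicalSpace Y] {ι κ l : Type} [Fintype ι] [DecidableEq ι] [Fintype κ]
  [DecidableEq κ] [Fintype l] [DecidableEq l]

/-- The threefold tensor product. -/
def t3 (a b c : Matrix ι κ ℂ) : Matrix (ι × ι × ι) (κ × κ × κ) ℂ := a ⊗ₖ (b ⊗ₖ c)

theorem t3_mul (a b c : Matrix ι κ ℂ) (a' b' c' : Matrix κ l ℂ) :
    t3 a b c * t3 a' b' c' = t3 (a * a') (b * b') (c * c') := by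
  simp only [t3, Matrix.mul_kronecker_mul]

theorem t3_one : t3 (1 : Matrix ι ι ℂ) 1 1 = 1 := by simp [t3]

@[fun_prop]
theorem continuous_t3 {a b c : Y → Matrix ι κ ℂ} (ha : Continuous a) (hb : Continuous b)
    (hc : Continuous c) : Continuous fun y => t3 (a y) (b y) (c y) := by
  refine continuous_matrix fun i j => ?_
  simp only [t3, Matrix.kroneckerMap_apply]
  have := fun i j => ha.matrix_elem i j
  have := fun i j => hb.matrix_elem i j
  have := fun i j => hc.matrix_elem i j
  fun_prop

variable (ι) in
/-- The cyclic permutation of the factors of a threefold tensor product. -/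
def cyc : Matrix (ι × ι × ι) (ι × ι × ι) ℂ :=
  Matrix.of fun i j => if (i.2.2, i.1, i.2.1) = j then 1 else 0

theorem cyc_mul_apply (M : Matrix (ι × ι × ι) l ℂ) (i : ι × ι × ι) (j : l) :
    (cyc ι * M) i j = M (i.2.2, i.1, i.2.1) j := by
  simp [cyc, Matrix.mul_apply]

theorem mul_cyc_apply (M : Matrix l (ι × ι × ι) ℂ) (i : l) (j : ι × ι × ι) :
    (M * cyc ι) i j = M i (j.2.1, j.2.2, j.1) := by
  rw [Matrix.mul_apply, Finset.sum_eq_single (j.2.1, j.2.2, j.1)]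
  · simp [cyc]
  · rintro ⟨a, b, c⟩ - h
    simp only [cyc, Matrix.of_apply]
    rw [if_neg, mul_zero]
    rintro rfl
    exact h rfl
  · simp

theorem cyc_cube : cyc ι * cyc ι * cyc ι = 1 := by
  ext ⟨a, b, c⟩ ⟨a', b', c'⟩
  rw [mul_cyc_apply, mul_cyc_apply]
  simp only [cyc, Matrix.of_apply, Matrix.one_apply, Prod.mk.injEq]
  congr 1
  simp only [eq_iff_iff]
  tauto

theorem cyc_mul_t3 (a b c : Matrix ι κ ℂ) : cyc ι * t3 a b c = t3 b c a * cyc κ := by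
  ext i j
  rw [cyc_mul_apply, mul_cyc_apply]
  simp only [t3, Matrix.kroneckerMap_apply]
  ring

/-- The threefold tensor power. -/
def cube (a : Matrix ι κ ℂ) : Matrix (ι × ι × ι) (κ × κ × κ) ℂ := t3 a a a

theorem cube_mul (a : Matrix ι κ ℂ) (b : Matrix κ l ℂ) : cube a * cube b = cube (a * b) :=
  t3_mul ..

theorem cube_one : cube (1 : Matrix ι ι ℂ) = 1 := t3_one

@[fun_prop]
theorem continuous_cube {a : Y → Matrix ι κ ℂ} (ha : Continuous a) :
    Continuous fun y => cube (a y) := continuous_t3 ha ha ha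

theorem commute_cyc_cube (a : Matrix ι ι ℂ) : Commute (cyc ι) (cube a) := cyc_mul_t3 a a a

variable (ι) in
/-- The isotypic projections for the cyclic group of order three. -/
noncomputable def es (ζ : ℂ) : Matrix (ι × ι × ι) (ι × ι × ι) ℂ := spr ζ (cyc ι)

theorem es_mul_cube (ζ : ℂ) (a : Matrix ι κ ℂ) : es ι ζ * cube a = cube a * es κ ζ := by
  have h : cyc ι * cube a = cube a * cyc κ := cyc_mul_t3 a a a
  simp only [es, spr, Matrix.smul_mul, Matrix.mul_smul, Matrix.add_mul, Matrix.mul_add,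
    Matrix.one_mul, Matrix.mul_one, h]
  rw [Matrix.mul_assoc, h, ← Matrix.mul_assoc, h, Matrix.mul_assoc]

theorem es_idem {ζ : ℂ} (hζ : ζ ^ 3 = 1) : es ι ζ * es ι ζ = es ι ζ := spr_idem cyc_cube hζ

theorem IsGL.cube {g : Y → Matrix ι ι ℂ} (hg : IsGL g) : IsGL fun y => cube (g y) :=
  IsGL.of_mul (h := fun y => SphereParallel.cube (g y)⁻¹) (continuous_cube hg.1) fun y => by
    rw [cube_mul, hg.mul_inv, cube_one]

theorem IsIdem.cube {P : Y → Matrix ι ι ℂ} (hg : IsIdem P) : IsIdem fun y => cube (P y) :=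
  ⟨continuous_cube hg.1, fun y => by rw [cube_mul, hg.2]⟩

theorem IsIdem.es_cube {P : Y → Matrix ι ι ℂ} (hg : IsIdem P) {ζ : ℂ} (hζ : ζ ^ 3 = 1) :
    IsIdem fun y => es ι ζ * SphereParallel.cube (P y) :=
  isIdem_spr_mul cyc_cube hζ hg.cube fun y => commute_cyc_cube _

theorem isIdem_es {ζ : ℂ} (hζ : ζ ^ 3 = 1) : IsIdem fun _ : Y => es ι ζ :=
  ⟨continuous_const, fun _ => es_idem hζ⟩

/-- The isotypic part of the tensor cube. -/
noncomputable def psi (ζ : ℂ) (g : Y → Matrix ι ι ℂ) (y : Y) :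
    Matrix (ι × ι × ι) (ι × ι × ι) ℂ := 1 - es ι ζ + es ι ζ * cube (g y)

theorem isGL_psi {ζ : ℂ} (hζ : ζ ^ 3 = 1) {g : Y → Matrix ι ι ℂ} (hg : IsGL g) :
    IsGL (psi ζ g) :=
  IsGL.corner (isIdem_es hζ) hg.cube fun y => es_mul_cube _ _

theorem orb_t3 (a b c : Matrix ι ι ℂ) :
    orb (cyc ι) (t3 a b c) = t3 a b c + t3 b c a + t3 c a b := by
  rw [orb, cyc_mul_t3, mul_assoc, ← mul_assoc (cyc ι), cyc_cube, mul_one, mul_assoc (cyc ι),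
    cyc_mul_t3, ← mul_assoc, cyc_mul_t3, mul_assoc, mul_assoc, ← mul_assoc (cyc ι), cyc_cube,
    mul_one]

theorem cube_add (a b : Matrix ι ι ℂ) :
    cube (a + b) = cube a + orb (cyc ι) (t3 a a b) + orb (cyc ι) (t3 a b b) + cube b := by
  rw [orb_t3, orb_t3]
  simp only [cube, t3, Matrix.add_kronecker, Matrix.kronecker_add]
  abel

theorem t3_zero_left (b c : Matrix ι ι ℂ) : t3 0 b c = 0 := by simp [t3]
theorem t3_zero_mid (b c : Matrix ι ι ℂ) : t3 b 0 c = 0 := by simp [t3]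
theorem t3_zero_right (b c : Matrix ι ι ℂ) : t3 b c 0 = 0 := by simp [t3]

theorem t3_cyc_t3 (a b c a' b' c' : Matrix ι ι ℂ) :
    t3 a b c * cyc ι * t3 a' b' c' = t3 (a * b') (b * c') (c * a') * cyc ι := by
  rw [mul_assoc, cyc_mul_t3, ← mul_assoc, t3_mul]

theorem t3_cyc_cyc_t3 (a b c a' b' c' : Matrix ι ι ℂ) :
    t3 a b c * (cyc ι * cyc ι) * t3 a' b' c' =
      t3 (a * c') (b * a') (c * b') * (cyc ι * cyc ι) := by
  rw [← mul_assoc, mul_assoc, cyc_mul_t3, ← mul_assoc, t3_cyc_t3, mul_assoc]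

theorem GLFun.val_corner_add (μ : GLFun Y) {E E' G : Y → Matrix κ κ ℂ} (hE : IsIdem E)
    (hE' : IsIdem E') (h : ∀ y, E y * E' y = 0) (hG : IsGL G) (hc : ∀ y, Commute (E y) (G y))
    (hc' : ∀ y, Commute (E' y) (G y)) :
    μ.val (fun y => 1 - (E y + E' y) + (E y + E' y) * G y) =
      μ.val (fun y => 1 - E y + E y * G y) + μ.val (fun y => 1 - E' y + E' y * G y) := by
  rw [← μ.mul' (IsGL.corner hE hG hc) (IsGL.corner hE' hG hc')]
  exact μ.congr fun y => (corner_add (h y) (hc' y) (hc y)).symm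

theorem GLFun.psi_corner (μ : GLFun Y) {ζ : ℂ} (hζ : ζ ^ 3 = 1) {P g : Y → Matrix ι ι ℂ}
    (hP : IsIdem P) (hg : IsGL g) (hc : ∀ y, P y * g y = g y * P y) :
    μ.val (psi ζ fun y => 1 - P y + P y * g y) =
      μ.val (fun y => 1 - es ι ζ * cube (P y) + es ι ζ * cube (P y) * cube (g y)) +
      (μ.val (fun y => 1 - t3 (P y) (P y) (1 - P y) +
        t3 (P y) (P y) (1 - P y) * cube (1 - P y + P y * g y)) +
      μ.val (fun y => 1 - t3 (P y) (1 - P y) (1 - P y) +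
        t3 (P y) (1 - P y) (1 - P y) * cube (1 - P y + P y * g y))) := by
  have hh : IsGL fun y => 1 - P y + P y * g y := IsGL.corner hP hg hc
  obtain ⟨Q, hQ⟩ : ∃ Q : Y → Matrix ι ι ℂ, ∀ y, Q y = 1 - P y := ⟨_, fun _ => rfl⟩
  obtain ⟨h, hhd⟩ : ∃ h : Y → Matrix ι ι ℂ, ∀ y, h y = 1 - P y + P y * g y := ⟨_, fun _ => rfl⟩
  simp only [← hhd] at hh ⊢
  simp only [← hQ] at hhd ⊢
  have iQ : IsIdem Q := by
    have := hP.compl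
    simpa only [← hQ] using this
  have hPc := hP.1
  have hQc := iQ.1
  have p1 := hP.2
  have q1 := iQ.2
  have q2 : ∀ y, Q y * P y = 0 := fun y => by rw [hQ, sub_mul, p1]; simp
  have q3 : ∀ y, P y * Q y = 0 := fun y => by rw [hQ, mul_sub, p1]; simp
  have r1 : ∀ y, P y * h y = P y * g y := fun y => by
    rw [hhd, mul_add, q3, ← mul_assoc, p1, zero_add]
  have r2 : ∀ y, h y * P y = P y * g y := fun y => by
    rw [hhd, add_mul, q2, mul_assoc, ← hc, ← mul_assoc, p1, zero_add]
  have r3 : ∀ y, Q y * h y = Q y := fun y => by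
    rw [hhd, mul_add, q1, ← mul_assoc, q2]; simp
  have r4 : ∀ y, h y * Q y = Q y := fun y => by
    rw [hhd, add_mul, q1, hc, mul_assoc, q3]; simp
  have iF1 : IsIdem fun y => t3 (P y) (P y) (Q y) := ⟨by fun_prop, fun y => by
    rw [t3_mul, p1, q1]⟩
  have iF2 : IsIdem fun y => t3 (P y) (Q y) (Q y) := ⟨by fun_prop, fun y => by
    rw [t3_mul, p1, q1]⟩
  have iO1 : IsIdem fun y => orb (cyc ι) (t3 (P y) (P y) (Q y)) := by
    simp only [orb_t3]
    refine ⟨by fun_prop, fun y => ?_⟩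
    simp [mul_add, add_mul, t3_mul, p1, q1, q2, q3, t3_zero_mid, t3_zero_right]
  have iO2 : IsIdem fun y => orb (cyc ι) (t3 (P y) (Q y) (Q y)) := by
    simp only [orb_t3]
    refine ⟨by fun_prop, fun y => ?_⟩
    simp [mul_add, add_mul, t3_mul, p1, q1, q2, q3, t3_zero_mid, t3_zero_right]
  have i0 := hP.es_cube hζ
  have i1 : IsIdem fun y => es ι ζ * orb (cyc ι) (t3 (P y) (P y) (Q y)) :=
    isIdem_spr_mul cyc_cube hζ iO1 fun y => commute_orb cyc_cube
  have i2 : IsIdem fun y => es ι ζ * orb (cyc ι) (t3 (P y) (Q y) (Q y)) :=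
    isIdem_spr_mul cyc_cube hζ iO2 fun y => commute_orb cyc_cube
  have ce : ∀ y, Commute (es ι ζ) (cube (h y)) := fun y => es_mul_cube _ _
  have c0 : ∀ y, Commute (es ι ζ * cube (P y)) (cube (h y)) := fun y =>
    (ce y).mul_left (by rw [commute_iff_eq, cube_mul, cube_mul, r1, r2])
  have f1 : ∀ y, Commute (t3 (P y) (P y) (Q y)) (cube (h y)) := fun y => by
    rw [commute_iff_eq, cube, t3_mul, t3_mul, r1, r2, r3, r4]
  have f2 : ∀ y, Commute (t3 (P y) (Q y) (Q y)) (cube (h y)) := fun y => by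
    rw [commute_iff_eq, cube, t3_mul, t3_mul, r1, r2, r3, r4]
  have c1 : ∀ y, Commute (es ι ζ * orb (cyc ι) (t3 (P y) (P y) (Q y))) (cube (h y)) := fun y =>
    (ce y).mul_left (by
      rw [commute_iff_eq, cube, orb_t3]
      simp only [mul_add, add_mul, t3_mul, r1, r2, r3, r4])
  have c2 : ∀ y, Commute (es ι ζ * orb (cyc ι) (t3 (P y) (Q y) (Q y))) (cube (h y)) := fun y =>
    (ce y).mul_left (by
      rw [commute_iff_eq, cube, orb_t3]
      simp only [mul_add, add_mul, t3_mul, r1, r2, r3, r4])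
  have comm : ∀ (A B : Matrix (ι × ι × ι) (ι × ι × ι) ℂ), Commute (cyc ι) A → A * B = 0 →
      es ι ζ * A * (es ι ζ * B) = 0 := fun A B hA hAB => by
    have hA' : es ι ζ * A = A * es ι ζ := commute_spr hA
    rw [mul_assoc, ← mul_assoc A, ← hA', mul_assoc (es ι ζ) A, hAB]; simp
  have z01 : ∀ y, es ι ζ * cube (P y) * (es ι ζ * orb (cyc ι) (t3 (P y) (P y) (Q y))) = 0 :=
    fun y => comm _ _ (commute_cyc_cube _) (by
      rw [orb_t3, cube]
      simp [mul_add, t3_mul, q3, t3_zero_left, t3_zero_mid, t3_zero_right])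
  have z02 : ∀ y, es ι ζ * cube (P y) * (es ι ζ * orb (cyc ι) (t3 (P y) (Q y) (Q y))) = 0 :=
    fun y => comm _ _ (commute_cyc_cube _) (by
      rw [orb_t3, cube]
      simp [mul_add, t3_mul, q3, t3_zero_mid, t3_zero_right])
  have z12 : ∀ y, es ι ζ * orb (cyc ι) (t3 (P y) (P y) (Q y)) *
      (es ι ζ * orb (cyc ι) (t3 (P y) (Q y) (Q y))) = 0 :=
    fun y => comm _ _ (commute_orb cyc_cube) (by
      rw [orb_t3, orb_t3]
      simp [mul_add, add_mul, t3_mul, q2, q3, t3_zero_left, t3_zero_mid, t3_zero_right])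
  have z21 : ∀ y, es ι ζ * orb (cyc ι) (t3 (P y) (Q y) (Q y)) *
      (es ι ζ * orb (cyc ι) (t3 (P y) (P y) (Q y))) = 0 :=
    fun y => comm _ _ (commute_orb cyc_cube) (by
      rw [orb_t3, orb_t3]
      simp [mul_add, add_mul, t3_mul, q2, q3, t3_zero_left, t3_zero_mid, t3_zero_right])
  have i12 : IsIdem fun y => es ι ζ * orb (cyc ι) (t3 (P y) (P y) (Q y)) +
      es ι ζ * orb (cyc ι) (t3 (P y) (Q y) (Q y)) :=
    ⟨i1.1.add i2.1, fun y => by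
      rw [mul_add, add_mul, add_mul, i1.2, i2.2, z12, z21]; abel⟩
  rw [← μ.mixed cyc_cube hζ iF1 hh.cube f1 (fun y => commute_cyc_cube _)
      (fun y => by rw [t3_cyc_t3, q3, t3_zero_mid, zero_mul])
      (fun y => by rw [t3_cyc_cyc_t3, q3, t3_zero_left, zero_mul]),
    ← μ.mixed cyc_cube hζ iF2 hh.cube f2 (fun y => commute_cyc_cube _)
      (fun y => by rw [t3_cyc_t3, q3, t3_zero_left, zero_mul])
      (fun y => by rw [t3_cyc_cyc_t3, q3, t3_zero_left, zero_mul])]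
  have e0 : ∀ y, 1 - es ι ζ * cube (P y) + es ι ζ * cube (P y) * cube (g y) =
      1 - es ι ζ * cube (P y) + es ι ζ * cube (P y) * cube (h y) := fun y => by
    rw [mul_assoc, mul_assoc, cube_mul, cube_mul, r1]
  rw [μ.congr e0, ← es, ← μ.val_corner_add i1 i2 z12 hh.cube c1 c2,
    ← μ.val_corner_add i0 i12 (fun y => by rw [mul_add, z01, z02, add_zero]) hh.cube c0
      fun y => (c1 y).add_left (c2 y)]
  refine μ.congr fun y => ?_
  have s1 : es ι ζ = es ι ζ * cube (P y) + (es ι ζ * orb (cyc ι) (t3 (P y) (P y) (Q y)) +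
      es ι ζ * orb (cyc ι) (t3 (P y) (Q y) (Q y))) + es ι ζ * cube (Q y) := by
    have := cube_add (P y) (Q y)
    rw [hQ, add_sub_cancel, cube_one, ← hQ] at this
    rw [← mul_add, ← mul_add, ← mul_add, ← add_assoc, ← this, mul_one]
  have s2 : es ι ζ * cube (Q y) * cube (h y) = es ι ζ * cube (Q y) := by
    rw [mul_assoc, cube_mul, r3]
  rw [psi]
  conv_lhs => rw [s1, add_mul _ (es ι ζ * cube (Q y)), s2]
  abel

end Cube
end SphereParallel

namespace SphereParallel

open Matrix unitInterval Filter Topology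

/-- A primitive cube root of unity. -/
noncomputable def om : ℂ := Complex.exp (2 * Real.pi * Complex.I / (3 : ℕ))

theorem om_prim : IsPrimitiveRoot om 3 := Complex.isPrimitiveRoot_exp 3 (by norm_num)

theorem om_cube : om ^ 3 = 1 := om_prim.pow_eq_one

theorem om_sum : 1 + om + om ^ 2 = 0 := by
  have := om_prim.geom_sum_eq_zero (by norm_num)
  simpa [Finset.sum_range_succ] using this

section

variable {Y : Type} [TopologicalSpace Y] {ι κ : Type} [Fintype ι] [DecidableEq ι] [Fintype κ]
  [DecidableEq κ]

theorem GLFun.psi_mul (μ : GLFun Y) {ζ : ℂ} (hζ : ζ ^ 3 = 1) {g h : Y → Matrix ι ι ℂ}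
    (hg : IsGL g) (hh : IsGL h) :
    μ.val (psi ζ fun y => g y * h y) = μ.val (psi ζ g) + μ.val (psi ζ h) := by
  rw [← μ.mul' (isGL_psi hζ hg) (isGL_psi hζ hh)]
  refine μ.congr fun y => ?_
  rw [psi, psi, psi, corner_mul (es_idem hζ) (es_mul_cube _ _), cube_mul]

theorem GLFun.psi_homotopy (μ : GLFun Y) {ζ : ℂ} (hζ : ζ ^ 3 = 1) {G : I × Y → Matrix ι ι ℂ}
    (hG : IsGL G) :
    μ.val (psi ζ fun y => G (0, y)) = μ.val (psi ζ fun y => G (1, y)) :=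
  μ.homotopy (isGL_psi hζ hG) (fun _ => rfl) (fun _ => rfl)

/-- The difference of isotypic parts of the tensor cube, as a function. -/
noncomputable def GLFun.psiVal (μ : GLFun Y) (g : Y → Matrix ι ι ℂ) : ℤ :=
  μ.val (psi 1 g) - μ.val (psi om g)

theorem GLFun.psiVal_corner (μ : GLFun Y) {P g : Y → Matrix ι ι ℂ}
    (hP : IsIdem P) (hg : IsGL g) (hc : ∀ y, P y * g y = g y * P y) :
    μ.psiVal (fun y => 1 - P y + P y * g y) =
      μ.val (fun y => 1 - es ι 1 * cube (P y) + es ι 1 * cube (P y) * cube (g y)) -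
      μ.val (fun y => 1 - es ι om * cube (P y) + es ι om * cube (P y) * cube (g y)) := by
  rw [psiVal, μ.psi_corner (one_pow 3) hP hg hc, μ.psi_corner om_cube hP hg hc]
  ring

theorem isGL_rect {u : Y → Matrix κ ι ℂ} {v : Y → Matrix ι κ ℂ} (hu : Continuous u)
    (hv : Continuous v) (huv : ∀ y, v y * u y = 1) {g : Y → Matrix ι ι ℂ} (hg : IsGL g) :
    IsGL fun y => 1 - u y * v y + u y * g y * v y := by
  have h1 := hg.1
  refine IsGL.of_mul (h := fun y => 1 - u y * v y + u y * (g y)⁻¹ * v y) (by fun_prop) fun y => ?_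
  have e1 : u y * v y * (u y * v y) = u y * v y := by
    rw [Matrix.mul_assoc, ← Matrix.mul_assoc (v y), huv, Matrix.one_mul]
  have e2 : u y * v y * (u y * (g y)⁻¹ * v y) = u y * (g y)⁻¹ * v y := by
    rw [Matrix.mul_assoc, ← Matrix.mul_assoc (v y), ← Matrix.mul_assoc (v y), huv, Matrix.one_mul,
      Matrix.mul_assoc]
  have e3 : u y * g y * v y * (u y * v y) = u y * g y * v y := by
    rw [Matrix.mul_assoc, ← Matrix.mul_assoc (v y), huv, Matrix.one_mul]
  have e4 : u y * g y * v y * (u y * (g y)⁻¹ * v y) = u y * v y := by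
    rw [Matrix.mul_assoc, ← Matrix.mul_assoc (v y), ← Matrix.mul_assoc (v y), huv, Matrix.one_mul,
      ← Matrix.mul_assoc, Matrix.mul_assoc (u y), hg.mul_inv, Matrix.mul_one]
  rw [add_mul, mul_add, mul_add, sub_mul, one_mul, mul_sub, mul_one, e1, sub_mul, one_mul, e2,
    mul_sub, mul_one, e3, e4]
  abel

theorem GLFun.psiVal_rect (μ : GLFun Y) {u : Y → Matrix κ ι ℂ} {v : Y → Matrix ι κ ℂ}
    (hu : Continuous u) (hv : Continuous v) (huv : ∀ y, v y * u y = 1) {g : Y → Matrix ι ι ℂ}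
    (hg : IsGL g) : μ.psiVal (fun y => 1 - u y * v y + u y * g y * v y) = μ.psiVal g := by
  have h1 := hg.1
  have hP : IsIdem fun y => u y * v y := ⟨by fun_prop, fun y => by
    rw [Matrix.mul_assoc, ← Matrix.mul_assoc (v y), huv, Matrix.one_mul]⟩
  have hG := isGL_rect hu hv huv hg
  have e1 : ∀ y, u y * v y * (1 - u y * v y + u y * g y * v y) = u y * g y * v y := fun y => by
    rw [mul_add, mul_sub, hP.2, mul_one, sub_self, zero_add, Matrix.mul_assoc,
      ← Matrix.mul_assoc (v y), ← Matrix.mul_assoc (v y), huv, Matrix.one_mul, Matrix.mul_assoc]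
  have e2 : ∀ y, (1 - u y * v y + u y * g y * v y) * (u y * v y) = u y * g y * v y := fun y => by
    rw [add_mul, sub_mul, hP.2, one_mul, sub_self, zero_add, Matrix.mul_assoc,
      ← Matrix.mul_assoc (v y), huv, Matrix.one_mul]
  have key := μ.psiVal_corner hP hG fun y => by rw [e1, e2]
  simp only [e1] at key
  rw [key, psiVal]
  have main : ∀ ζ : ℂ, ζ ^ 3 = 1 → μ.val (fun y => 1 - es κ ζ * cube (u y * v y) +
      es κ ζ * cube (u y * v y) * cube (1 - u y * v y + u y * g y * v y)) = μ.val (psi ζ g) := by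
    intro ζ hζ
    rw [show psi ζ g = fun y => 1 - es ι ζ + es ι ζ * cube (g y) from rfl,
      ← μ.corner (isIdem_es hζ) hg.cube (fun y => es_mul_cube _ _)
        (u := fun y => cube (u y) * es ι ζ) (v := fun y => es ι ζ * cube (v y)) (by fun_prop)
        (by fun_prop)]
    · refine μ.congr fun y => ?_
      have c1 : cube (u y) * es ι ζ * (es ι ζ * cube (v y)) = es κ ζ * cube (u y * v y) := by
        rw [Matrix.mul_assoc, ← Matrix.mul_assoc (es ι ζ), es_idem hζ, ← Matrix.mul_assoc,
          ← es_mul_cube, Matrix.mul_assoc, cube_mul]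
      have c2 : cube (u y) * es ι ζ * cube (g y) * (es ι ζ * cube (v y)) =
          es κ ζ * cube (u y * g y * v y) := by
        rw [Matrix.mul_assoc (cube (u y)), es_mul_cube, ← Matrix.mul_assoc (cube (u y)),
          Matrix.mul_assoc, ← Matrix.mul_assoc (es ι ζ), es_idem hζ, ← Matrix.mul_assoc,
          cube_mul, ← es_mul_cube, Matrix.mul_assoc, cube_mul]
      rw [mul_assoc (es κ ζ), cube_mul, e1]
      rw [c1, c2]
    · intro y
      rw [Matrix.mul_assoc, ← Matrix.mul_assoc (cube (v y)), cube_mul, huv, cube_one,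
        Matrix.one_mul, es_idem hζ]
    · intro y
      rw [Matrix.mul_assoc, es_idem hζ]
    · intro y
      rw [← Matrix.mul_assoc, es_idem hζ]
  rw [main 1 (one_pow 3), main om om_cube]

/-- The third Adams operation on invariants. -/
noncomputable def GLFun.psi3 (μ : GLFun Y) : GLFun Y where
  val := μ.psiVal
  homotopy' := fun hG => by
    rw [psiVal, psiVal, μ.psi_homotopy (one_pow 3) hG, μ.psi_homotopy om_cube hG]
  mul' := fun hg hh => by
    rw [psiVal, psiVal, psiVal, μ.psi_mul (one_pow 3) hg hh, μ.psi_mul om_cube hg hh]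
    ring
  block1' := fun {ι κ _ _ _ _ g} hg => by
    rw [← μ.psiVal_rect (u := fun _ => (Matrix.fromRows 1 0 : Matrix (ι ⊕ κ) ι ℂ))
      (v := fun _ => (Matrix.fromCols 1 0 : Matrix ι (ι ⊕ κ) ℂ)) continuous_const continuous_const
      (fun y => by simp [Matrix.fromCols_mul_fromRows]) hg]
    congr 1
    funext y
    ext (i | i) (j | j) <;> simp [Matrix.fromRows_mul, Matrix.mul_fromCols, Matrix.one_apply]
  block2' := fun {ι κ _ _ _ _ g} hg => by
    rw [← μ.psiVal_rect (u := fun _ => (Matrix.fromRows 0 1 : Matrix (κ ⊕ ι) ι ℂ))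
      (v := fun _ => (Matrix.fromCols 0 1 : Matrix ι (κ ⊕ ι) ℂ)) continuous_const continuous_const
      (fun y => by simp [Matrix.fromCols_mul_fromRows]) hg]
    congr 1
    funext y
    ext (i | i) (j | j) <;> simp [Matrix.fromRows_mul, Matrix.mul_fromCols, Matrix.one_apply]

/-- Integer multiples of an invariant. -/
def GLFun.zmul (n : ℤ) (μ : GLFun Y) : GLFun Y where
  val := fun g => n * μ.val g
  homotopy' := fun hG => by rw [μ.homotopy' hG]
  mul' := fun hg hh => by rw [μ.mul' hg hh, mul_add]
  block1' := fun hg => by rw [μ.block1' hg]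
  block2' := fun hg => by rw [μ.block2' hg]

/-- The third Adams operation acts by `3 ^ k`. -/
def PsiEigen (φ : IdemFun Y) (k : ℕ) : Prop :=
  ∀ {ι : Type} [Fintype ι] [DecidableEq ι] {P : Y → Matrix ι ι ℂ}, IsIdem P →
    φ.val (fun y => es ι 1 * cube (P y)) - φ.val (fun y => es ι om * cube (P y)) = 3 ^ k * φ.val P

theorem cube_smul (z : ℂ) (a : Matrix ι ι ℂ) : cube (z • a) = z ^ 3 • cube a := by
  ext i j
  simp only [cube, t3, Matrix.kroneckerMap_apply, Matrix.smul_apply, smul_eq_mul]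
  ring

theorem PsiEigen.psi3_eq {X : Type} [TopologicalSpace X] [CompactSpace X] [T2Space X]
    {φ : IdemFun X} {k : ℕ} (h : PsiEigen φ k) {g : X × Circle → Matrix ι ι ℂ} (hg : IsGL g) :
    φ.toGL.psi3.val g = 3 ^ (k + 1) * φ.toGL.val g := by
  refine AgreeOnBasic.eq (ν := φ.toGL.zmul (3 ^ (k + 1))) ⟨?_, ?_⟩ hg
  · intro ι _ _ g hg
    have e : ∀ ζ : ℂ, ζ ^ 3 = 1 → φ.toGL.val (psi ζ fun y : X × Circle => g y.1) = 0 :=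
      fun ζ hζ => φ.toGL_pullback (isGL_psi hζ hg)
    change φ.toGL.val _ - φ.toGL.val _ = 3 ^ (k + 1) * φ.toGL.val _
    rw [e 1 (one_pow 3), e om om_cube, φ.toGL_pullback hg]
    simp
  · intro ι _ _ E hE
    change φ.toGL.psiVal _ = 3 ^ (k + 1) * φ.toGL.val _
    have hz : IsGL fun y : X × Circle => (y.2 : ℂ) • (1 : Matrix ι ι ℂ) :=
      ⟨by fun_prop, fun y => isUnit_smul y.2.coe_ne_zero isUnit_one⟩
    have hE' : IsIdem fun y : X × Circle => E y.1 := hE.comp continuous_fst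
    have key := φ.toGL.psiVal_corner hE' hz (by simp)
    have e0 : (fun y : X × Circle => 1 - E y.1 + (y.2 : ℂ) • E y.1) =
        fun y => 1 - E y.1 + E y.1 * ((y.2 : ℂ) • (1 : Matrix ι ι ℂ)) := by
      funext y
      rw [mul_smul_comm, mul_one]
    rw [φ.toGL_idem hE]
    have main : ∀ ζ : ℂ, ζ ^ 3 = 1 → φ.toGL.val (fun y : X × Circle =>
        1 - es ι ζ * cube (E y.1) + es ι ζ * cube (E y.1) * cube ((y.2 : ℂ) • (1 : Matrix ι ι ℂ))) =
        3 * φ.val (fun x => es ι ζ * cube (E x)) := by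
      intro ζ hζ
      have iF := hE.es_cube hζ
      have gF := isGL_idem iF
      rw [← φ.toGL_idem iF]
      have := φ.toGL.mul' (gF.mul gF) gF
      rw [φ.toGL.mul' gF gF] at this
      rw [show ∀ a : ℤ, 3 * a = a + a + a by intro a; ring, ← this]
      refine φ.toGL.congr fun y => ?_
      have hF := iF.2 y.1
      have c : ∀ a b : ℂ, (1 - es ι ζ * cube (E y.1) + a • (es ι ζ * cube (E y.1))) *
          (1 - es ι ζ * cube (E y.1) + b • (es ι ζ * cube (E y.1))) =
          1 - es ι ζ * cube (E y.1) + (a * b) • (es ι ζ * cube (E y.1)) := by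
        intro a b
        have := corner_mul (E := es ι ζ * cube (E y.1)) (G := a • 1) (H := b • 1) hF (by simp)
        simpa [smul_smul, mul_comm] using this
      rw [c, c, cube_smul, cube_one, mul_smul_comm, mul_one]
      congr 2
      ring
    rw [e0, key, main 1 (one_pow 3), main om om_cube]
    linear_combination 3 * h hE

end
end SphereParallel

namespace SphereParallel

open Matrix unitInterval Filter Topology

/-- The two-sphere in `ℝ × ℂ`. -/
abbrev S2 : Type := {p : ℝ × ℂ // p.1 ^ 2 + ‖p.2‖ ^ 2 = 1}

instance : CompactSpace S2 := by
  refine isCompact_iff_compactSpace.1 (Metric.isCompact_of_isClosed_isBounded ?_ ?_)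
  · exact isClosed_eq (f := fun p : ℝ × ℂ => p.1 ^ 2 + ‖p.2‖ ^ 2) (by fun_prop) continuous_const
  · refine (Metric.isBounded_closedBall (x := (0 : ℝ × ℂ)) (r := 1)).subset fun p hp => ?_
    have hp : p.1 ^ 2 + ‖p.2‖ ^ 2 = 1 := hp
    rw [mem_closedBall_zero_iff, Prod.norm_def, Real.norm_eq_abs]
    refine max_le (abs_le_one_iff_mul_self_le_one.2 ?_) ?_
    · nlinarith [sq_nonneg ‖p.2‖]
    · nlinarith [sq_nonneg p.1, norm_nonneg p.2]

/-- The north pole. -/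
def north : S2 := ⟨(1, 0), by simp⟩

/-- Polar coordinates on the two-sphere. -/
noncomputable def sig (p : I × Circle) : S2 :=
  ⟨(Real.cos (Real.pi * p.1), Real.sin (Real.pi * p.1) * (p.2 : ℂ)), by
    have h : ‖(p.2 : ℂ)‖ = 1 := Circle.norm_coe p.2
    rw [norm_mul, h, Complex.norm_real, mul_one, Real.norm_eq_abs, sq_abs, Real.cos_sq_add_sin_sq]⟩

theorem continuous_sig : Continuous sig :=
  Continuous.subtype_mk (by fun_prop) _

theorem sig_zero (z : Circle) : sig (0, z) = north := by
  simp [sig, north]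

theorem sig_one (z z' : Circle) : sig (1, z) = sig (1, z') := by
  simp [sig]

section

variable {X : Type} [TopologicalSpace X] {ι κ : Type} [Fintype ι] [DecidableEq ι] [Fintype κ]
  [DecidableEq κ]

/-- A trivialization of a family of idempotents in polar coordinates. -/
structure Triv (P : X × S2 → Matrix ι ι ℂ) (u : I × (X × Circle) → Matrix ι ι ℂ) : Prop where
  gl : IsGL u
  zero : ∀ y, u (0, y) = 1
  comm : ∀ t y, u (t, y) * P (y.1, north) = P (y.1, sig (t, y.2)) * u (t, y)

theorem Triv.exists_pair [CompactSpace X] {P Q : X × S2 → Matrix ι ι ℂ} (hP : IsIdem P)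
    (hQ : IsIdem Q) (hPQ : ∀ y, P y * Q y = Q y * P y) : ∃ u, Triv P u ∧ Triv Q u := by
  have hc := continuous_sig
  have hs : Continuous fun p : I × (X × Circle) => (p.2.1, sig (p.1, p.2.2)) := by fun_prop
  obtain ⟨A, h1, h2, h3⟩ := idem_transport
    (fun (b : Bool) (p : I × (X × Circle)) => (if b then P else Q) (p.2.1, sig (p.1, p.2.2)))
    (fun b => by cases b; exacts [hQ.comp hs, hP.comp hs])
    (fun i j p => by cases i <;> cases j <;> simp [hPQ])
  refine ⟨A, ⟨h1, h2, fun t y => ?_⟩, ⟨h1, h2, fun t y => ?_⟩⟩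
  · simpa [sig_zero] using h3 true t y
  · simpa [sig_zero] using h3 false t y

theorem Triv.exists [CompactSpace X] {P : X × S2 → Matrix ι ι ℂ} (hP : IsIdem P) :
    ∃ u, Triv P u := by
  obtain ⟨u, hu, -⟩ := Triv.exists_pair hP hP fun _ => rfl
  exact ⟨u, hu⟩

/-- The clutching function of a trivialization. -/
noncomputable def clutch (u : I × (X × Circle) → Matrix ι ι ℂ) (y : X × Circle) : Matrix ι ι ℂ :=
  (u (1, (y.1, 1)))⁻¹ * u (1, y)

theorem Triv.isGL_clutch {P : X × S2 → Matrix ι ι ℂ} {u : I × (X × Circle) → Matrix ι ι ℂ}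
    (h : Triv P u) : IsGL (clutch u) :=
  ((h.gl.comp (f := fun y : X × Circle => (1, (y.1, 1))) (by fun_prop)).inv).mul
    (h.gl.comp (f := fun y : X × Circle => (1, y)) (by fun_prop))

theorem Triv.comm_clutch {P : X × S2 → Matrix ι ι ℂ} {u : I × (X × Circle) → Matrix ι ι ℂ}
    (h : Triv P u) (y : X × Circle) :
    P (y.1, north) * clutch u y = clutch u y * P (y.1, north) := by
  have h1 := h.comm 1 y
  have h2 := h.comm 1 (y.1, 1)
  have h3 := h.gl.inv_mul (1, (y.1, 1))
  have h4 := h.gl.mul_inv (1, (y.1, 1))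
  simp only at h2
  rw [sig_one 1 y.2] at h2
  rw [clutch, mul_assoc, h1, ← mul_assoc, ← mul_assoc]
  congr 1
  calc _ = (u (1, (y.1, 1)))⁻¹ * (u (1, (y.1, 1)) * P (y.1, north)) * (u (1, (y.1, 1)))⁻¹ := by
        rw [← mul_assoc, h3, one_mul]
    _ = _ := by rw [h2, mul_assoc, mul_assoc, h4, mul_one]

theorem Triv.clutch_eq {P : X × S2 → Matrix ι ι ℂ} {u : I × (X × Circle) → Matrix ι ι ℂ}
    (h : Triv P u) {y : X × Circle} {a : Matrix ι ι ℂ} (ha : u (1, (y.1, 1)) * a = u (1, y)) :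
    clutch u y = a := by
  rw [clutch, ← ha, ← mul_assoc, h.gl.inv_mul, one_mul]

/-- The corner of the clutching function. -/
noncomputable def clutchGL (P : X × S2 → Matrix ι ι ℂ) (u : I × (X × Circle) → Matrix ι ι ℂ)
    (y : X × Circle) : Matrix ι ι ℂ :=
  1 - P (y.1, north) + P (y.1, north) * clutch u y

theorem isIdem_north {P : X × S2 → Matrix ι ι ℂ} (hP : IsIdem P) :
    IsIdem fun y : X × Circle => P (y.1, north) :=
  hP.comp (f := fun y : X × Circle => (y.1, north)) (by fun_prop)

theorem Triv.isGL_clutchGL {P : X × S2 → Matrix ι ι ℂ} {u : I × (X × Circle) → Matrix ι ι ℂ}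
    (h : Triv P u) (hP : IsIdem P) : IsGL (clutchGL P u) :=
  IsGL.corner (isIdem_north hP) h.isGL_clutch h.comm_clutch

theorem Triv.val_eq {P : X × S2 → Matrix ι ι ℂ} {u u' : I × (X × Circle) → Matrix ι ι ℂ}
    (h : Triv P u) (h' : Triv P u') (hP : IsIdem P) (μ : GLFun (X × Circle)) :
    μ.val (clutchGL P u) = μ.val (clutchGL P u') := by
  have hk : IsGL fun p : I × (X × Circle) => (u p)⁻¹ * u' p := h.gl.inv.mul h'.gl
  have kc : ∀ t y, P (y.1, north) * ((u (t, y))⁻¹ * u' (t, y)) =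
      (u (t, y))⁻¹ * u' (t, y) * P (y.1, north) := by
    intro t y
    have h1 := h.comm t y
    have h2 := h'.comm t y
    have h3 := h.gl.inv_mul (t, y)
    have h4 := h.gl.mul_inv (t, y)
    rw [mul_assoc, h2, ← mul_assoc, ← mul_assoc]
    congr 1
    calc _ = (u (t, y))⁻¹ * (u (t, y) * P (y.1, north)) * (u (t, y))⁻¹ := by
          rw [← mul_assoc, h3, one_mul]
      _ = _ := by rw [h1, mul_assoc, mul_assoc, h4, mul_one]
  have hk1 := hk.comp (f := fun p : I × (X × Circle) => (p.1, (p.2.1, (1 : Circle)))) (by fun_prop)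
  have kc1 : ∀ t (y : X × Circle), P (y.1, north) *
      ((u (t, (y.1, 1)))⁻¹ * u' (t, (y.1, 1)))⁻¹ =
      ((u (t, (y.1, 1)))⁻¹ * u' (t, (y.1, 1)))⁻¹ * P (y.1, north) := by
    intro t y
    have h1 := kc t (y.1, 1)
    have h3 := hk.inv_mul (t, (y.1, 1))
    have h4 := hk.mul_inv (t, (y.1, 1))
    simp only at h1 h3 h4
    generalize (u (t, (y.1, 1)))⁻¹ * u' (t, (y.1, 1)) = k at h1 h3 h4 ⊢
    calc _ = k⁻¹ * k * P (y.1, north) * k⁻¹ := by rw [h3, one_mul]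
      _ = _ := by rw [mul_assoc k⁻¹ k, ← h1, mul_assoc, mul_assoc, h4, mul_one]
  have hG := IsGL.corner (E := fun p : I × (X × Circle) => P (p.2.1, north))
    (G := fun p => ((u (p.1, (p.2.1, 1)))⁻¹ * u' (p.1, (p.2.1, 1)))⁻¹ * clutch u p.2 *
      ((u p)⁻¹ * u' p)) ((isIdem_north hP).comp continuous_snd)
    ((hk1.inv.mul (h.isGL_clutch.comp continuous_snd)).mul hk) fun p =>
      Commute.mul_right (Commute.mul_right (kc1 p.1 p.2) (h.comm_clutch p.2)) (kc p.1 p.2)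
  refine μ.homotopy hG (fun y => ?_) fun y => ?_
  · simp [clutchGL, h.zero, h'.zero]
  · have h4 := h.gl.mul_inv (1, y)
    have h3 := hk.inv_mul (1, (y.1, 1))
    have e := h'.clutch_eq (y := y) (a := ((u (1, (y.1, 1)))⁻¹ * u' (1, (y.1, 1)))⁻¹ * clutch u y *
      ((u (1, y))⁻¹ * u' (1, y))) (by
      have e1 : u (1, (y.1, 1)) * ((u (1, (y.1, 1)))⁻¹ * u' (1, (y.1, 1))) = u' (1, (y.1, 1)) := by
        rw [← mul_assoc, h.gl.mul_inv, one_mul]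
      have e2 := hk.mul_inv (1, (y.1, 1))
      generalize (u (1, (y.1, 1)))⁻¹ * u' (1, (y.1, 1)) = k at e1 e2 ⊢
      rw [← e1]
      have c1 : ∀ M, k * (k⁻¹ * M) = M := fun M => by rw [← mul_assoc, e2, one_mul]
      have c2 : ∀ p M, u p * ((u p)⁻¹ * M) = M := fun p M => by
        rw [← mul_assoc, h.gl.mul_inv, one_mul]
      simp only [clutch, mul_assoc, c1, c2])
    simp only [clutchGL]
    rw [e]

variable [CompactSpace X]

open Classical in
/-- The invariant of idempotents over `X × S2` obtained by clutching. -/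
noncomputable def s2val (φ : GLFun (X × Circle)) (P : X × S2 → Matrix ι ι ℂ) : ℤ :=
  if h : ∃ u, Triv P u then φ.val (clutchGL P h.choose) else 0

theorem s2val_eq (φ : GLFun (X × Circle)) {P : X × S2 → Matrix ι ι ℂ} (hP : IsIdem P)
    {u : I × (X × Circle) → Matrix ι ι ℂ} (hu : Triv P u) :
    s2val φ P = φ.val (clutchGL P u) := by
  have h : ∃ u, Triv P u := ⟨u, hu⟩
  rw [s2val, dif_pos h]
  exact h.choose_spec.val_eq hu hP φ

theorem s2val_add (φ : GLFun (X × Circle)) {P Q : X × S2 → Matrix ι ι ℂ} (hP : IsIdem P)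
    (hQ : IsIdem Q) (h1 : ∀ x, P x * Q x = 0) (h2 : ∀ x, Q x * P x = 0) :
    s2val φ (fun x => P x + Q x) = s2val φ P + s2val φ Q := by
  obtain ⟨u, hu, hu'⟩ := Triv.exists_pair hP hQ fun y => by rw [h1, h2]
  have hPQ : IsIdem fun x => P x + Q x := ⟨hP.1.add hQ.1, fun x => by
    simp only [add_mul, mul_add, hP.2, hQ.2, h1, h2]; abel⟩
  have hs : Triv (fun x => P x + Q x) u := ⟨hu.gl, hu.zero, fun t y => by
    rw [mul_add, add_mul, hu.comm, hu'.comm]⟩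
  rw [s2val_eq φ hP hu, s2val_eq φ hQ hu', s2val_eq φ hPQ hs]
  have e := φ.mul' (hu.isGL_clutchGL hP) (hu'.isGL_clutchGL hQ)
  rw [← e]
  refine φ.congr fun y => ?_
  have c := hu'.comm_clutch y
  have a1 := h1 (y.1, north)
  simp only [clutchGL]
  generalize P (y.1, north) = p at *
  generalize Q (y.1, north) = q at *
  generalize clutch u y = g at *
  have t2 : p * g * q = 0 := by rw [mul_assoc, ← c, ← mul_assoc, a1, zero_mul]
  have t : p * g * (q * g) = 0 := by rw [← mul_assoc, t2, zero_mul]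
  have t3 : p * (q * g) = 0 := by rw [← mul_assoc, a1, zero_mul]
  simp only [add_mul, mul_add, sub_mul, mul_sub, one_mul, mul_one, t, t2, t3, a1]
  abel

theorem s2val_conj (φ : GLFun (X × Circle)) {P Q W : X × S2 → Matrix ι ι ℂ} (hP : IsIdem P)
    (hQ : IsIdem Q) (hW : IsGL W) (h : ∀ x, W x * P x = Q x * W x) : s2val φ P = s2val φ Q := by
  obtain ⟨u, hu⟩ := Triv.exists hP
  have hc := continuous_sig
  have hs : Continuous fun p : I × (X × Circle) => (p.2.1, sig (p.1, p.2.2)) := by fun_prop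
  have hWn : IsGL fun y : X × Circle => W (y.1, north) :=
    hW.comp (f := fun y : X × Circle => (y.1, north)) (by fun_prop)
  have hu' : Triv Q fun p => W (p.2.1, sig (p.1, p.2.2)) * u p * (W (p.2.1, north))⁻¹ := by
    refine ⟨((hW.comp hs).mul hu.gl).mul (hWn.inv.comp continuous_snd), fun y => ?_, fun t y => ?_⟩
    · simp only [sig_zero, hu.zero, mul_one]
      exact hWn.mul_inv y
    · have h1 := h (y.1, north)
      have h2 := hWn.mul_inv y
      have h3 := hWn.inv_mul y
      have h4 := h (y.1, sig (t, y.2))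
      simp only at h2 h3 ⊢
      calc _ = W (y.1, sig (t, y.2)) * u (t, y) * ((W (y.1, north))⁻¹ *
            (Q (y.1, north) * W (y.1, north)) * (W (y.1, north))⁻¹) := by
            rw [mul_assoc (W (y.1, north))⁻¹, mul_assoc (Q (y.1, north)), h2, mul_one]
            simp only [mul_assoc]
        _ = W (y.1, sig (t, y.2)) * (u (t, y) * P (y.1, north)) * (W (y.1, north))⁻¹ := by
            rw [← h1, ← mul_assoc (W (y.1, north))⁻¹, h3, one_mul]
            simp only [mul_assoc]
        _ = _ := by
            rw [hu.comm, ← mul_assoc, h4]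
            simp only [mul_assoc]
  rw [s2val_eq φ hP hu, s2val_eq φ hQ hu']
  refine φ.conj (hu.isGL_clutchGL hP) (hu'.isGL_clutchGL hQ) hWn fun y => ?_
  have h1 := h (y.1, north)
  have h3 := hWn.inv_mul y
  have e := hu'.clutch_eq (y := y) (a := W (y.1, north) * clutch u y * (W (y.1, north))⁻¹) (by
    have c1 : ∀ M, (W (y.1, north))⁻¹ * (W (y.1, north) * M) = M := fun M => by
      rw [← mul_assoc, h3, one_mul]
    have c2 : ∀ M, u (1, (y.1, 1)) * ((u (1, (y.1, 1)))⁻¹ * M) = M := fun M => by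
      rw [← mul_assoc, hu.gl.mul_inv, one_mul]
    simp only [sig_one 1 y.2, clutch, mul_assoc, c1, c2])
  simp only [clutchGL]
  rw [e]
  rw [mul_add, mul_sub, add_mul, sub_mul, mul_one, one_mul, ← h1, ← mul_assoc, ← mul_assoc,
    ← mul_assoc, ← h1, mul_assoc _ _ (W _), h3, mul_one]

theorem s2val_block1 (φ : GLFun (X × Circle)) {P : X × S2 → Matrix ι ι ℂ} (hP : IsIdem P) :
    s2val φ (fun x => fromBlocks (P x) 0 0 (0 : Matrix κ κ ℂ)) = s2val φ P := by
  obtain ⟨u, hu⟩ := Triv.exists hP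
  have hPc := hP.1
  have hQ : IsIdem fun x => fromBlocks (P x) 0 0 (0 : Matrix κ κ ℂ) :=
    ⟨by fun_prop, fun x => by simp [fromBlocks_multiply, hP.2]⟩
  have hu' : Triv (fun x => fromBlocks (P x) 0 0 (0 : Matrix κ κ ℂ)) fun p =>
      fromBlocks (u p) 0 0 (1 : Matrix κ κ ℂ) :=
    ⟨hu.gl.fromBlocks isGL_one, fun y => by simp [hu.zero], fun t y => by
      simp [fromBlocks_multiply, hu.comm]⟩
  rw [s2val_eq φ hQ hu', s2val_eq φ hP hu, ← φ.block1' (κ := κ) (hu.isGL_clutchGL hP)]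
  refine φ.congr fun y => ?_
  have e := hu'.clutch_eq (y := y) (a := fromBlocks (clutch u y) 0 0 1) (by
    simp [fromBlocks_multiply, clutch, ← mul_assoc, hu.gl.mul_inv])
  rw [clutchGL, e, clutchGL, ← fromBlocks_one, fromBlocks_multiply]
  ext (i | i) (j | j) <;> simp [Matrix.one_apply]

theorem s2val_block2 (φ : GLFun (X × Circle)) {P : X × S2 → Matrix ι ι ℂ} (hP : IsIdem P) :
    s2val φ (fun x => fromBlocks (0 : Matrix κ κ ℂ) 0 0 (P x)) = s2val φ P := by
  obtain ⟨u, hu⟩ := Triv.exists hP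
  have hPc := hP.1
  have hQ : IsIdem fun x => fromBlocks (0 : Matrix κ κ ℂ) 0 0 (P x) :=
    ⟨by fun_prop, fun x => by simp [fromBlocks_multiply, hP.2]⟩
  have hu' : Triv (fun x => fromBlocks (0 : Matrix κ κ ℂ) 0 0 (P x)) fun p =>
      fromBlocks (1 : Matrix κ κ ℂ) 0 0 (u p) :=
    ⟨isGL_one.fromBlocks hu.gl, fun y => by simp [hu.zero], fun t y => by
      simp [fromBlocks_multiply, hu.comm]⟩
  rw [s2val_eq φ hQ hu', s2val_eq φ hP hu, ← φ.block2' (κ := κ) (hu.isGL_clutchGL hP)]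
  refine φ.congr fun y => ?_
  have e := hu'.clutch_eq (y := y) (a := fromBlocks 1 0 0 (clutch u y)) (by
    simp [fromBlocks_multiply, clutch, ← mul_assoc, hu.gl.mul_inv])
  rw [clutchGL, e, clutchGL, ← fromBlocks_one, fromBlocks_multiply]
  ext (i | i) (j | j) <;> simp [Matrix.one_apply]

theorem s2val_equiv (φ : GLFun (X × Circle)) {u : X × S2 → Matrix ι κ ℂ}
    {v : X × S2 → Matrix κ ι ℂ} (hu : Continuous u) (hv : Continuous v)
    (hP : IsIdem fun x => u x * v x) (hQ : IsIdem fun x => v x * u x) :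
    s2val φ (fun x => u x * v x) = s2val φ fun x => v x * u x := by
  rw [← s2val_block1 (κ := κ) φ hP, ← s2val_block2 (κ := ι) φ hQ]
  have hp : ∀ x, u x * v x * (u x * v x) = u x * v x := hP.2
  have hq : ∀ x, v x * u x * (v x * u x) = v x * u x := hQ.2
  have hp' := hp
  have hq' := hq
  simp only [Matrix.mul_assoc] at hp' hq'
  refine s2val_conj φ (W := fun x => fromBlocks (1 - u x * v x) (u x * (v x * u x))
    (v x * (u x * v x)) (1 - v x * u x)) ⟨by fun_prop, fun x => ?_⟩ ⟨by fun_prop, fun x => ?_⟩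
    (IsGL.of_mul (h := fun x => fromBlocks (1 - u x * v x) (u x * (v x * u x))
    (v x * (u x * v x)) (1 - v x * u x)) (by fun_prop) fun x => ?_) fun x => ?_
  · simp [fromBlocks_multiply, hp]
  · simp [fromBlocks_multiply, hq]
  · rw [fromBlocks_multiply, ← fromBlocks_one]
    congr 1 <;> simp only [Matrix.mul_assoc, Matrix.sub_mul, Matrix.mul_sub, hp', hq',
      Matrix.one_mul, Matrix.mul_one] <;> abel
  · simp only [fromBlocks_multiply, Matrix.mul_zero, Matrix.zero_mul, add_zero, zero_add]
    congr 1 <;> simp only [Matrix.mul_assoc, Matrix.sub_mul, Matrix.mul_sub, hp', hq',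
      Matrix.one_mul, Matrix.mul_one, sub_self]

/-- The clutching construction as an invariant of idempotents. -/
noncomputable def IdemFun.s2 (φ : IdemFun X) [T2Space X] : IdemFun (X × S2) where
  val := s2val φ.toGL
  add' := s2val_add φ.toGL
  equiv' := s2val_equiv φ.toGL

variable [T2Space X] (φ : IdemFun X)

theorem IdemFun.s2_eq {P : X × S2 → Matrix ι ι ℂ} (hP : IsIdem P)
    {u : I × (X × Circle) → Matrix ι ι ℂ} (hu : Triv P u) :
    φ.s2.val P = φ.toGL.val (clutchGL P u) := s2val_eq _ hP hu

theorem IdemFun.s2_pullback {E : X → Matrix ι ι ℂ} (hE : IsIdem E) :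
    φ.s2.val (fun y => E y.1) = 0 := by
  have hu : Triv (fun y : X × S2 => E y.1) fun _ => 1 := ⟨isGL_one, by simp, by simp⟩
  rw [φ.s2_eq (hE.comp continuous_fst) hu, ← φ.toGL.val_one (ι := ι)]
  exact φ.toGL.congr fun y => by simp [clutchGL, clutch]

theorem PsiEigen.s2 {k : ℕ} (h : PsiEigen φ k) : PsiEigen φ.s2 (k + 1) := by
  intro ι _ _ P hP
  obtain ⟨u, hu⟩ := Triv.exists hP
  have main : ∀ ζ : ℂ, ζ ^ 3 = 1 → φ.s2.val (fun y => es ι ζ * cube (P y)) =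
      φ.toGL.val (fun y => 1 - es ι ζ * cube (P (y.1, north)) +
        es ι ζ * cube (P (y.1, north)) * cube (clutch u y)) := by
    intro ζ hζ
    have hu' : Triv (fun y => es ι ζ * cube (P y)) fun p => cube (u p) :=
      ⟨hu.gl.cube, fun y => by rw [hu.zero, cube_one], fun t y => by
        rw [← mul_assoc, ← es_mul_cube, mul_assoc, cube_mul, hu.comm, ← cube_mul, mul_assoc]⟩
    rw [φ.s2_eq (hP.es_cube hζ) hu']
    refine φ.toGL.congr fun y => ?_
    rw [clutchGL, hu'.clutch_eq (a := cube (clutch u y))]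
    rw [cube_mul, clutch, ← mul_assoc, hu.gl.mul_inv, one_mul]
  rw [main 1 (one_pow 3), main om om_cube,
    ← φ.toGL.psiVal_corner (isIdem_north hP) hu.isGL_clutch hu.comm_clutch, φ.s2_eq hP hu]
  exact h.psi3_eq (hu.isGL_clutchGL hP)

/-- The tensor product of the Bott projection with a matrix. -/
noncomputable def bott (p : S2) (M : Matrix ι κ ℂ) : Matrix (ι ⊕ ι) (κ ⊕ κ) ℂ :=
  fromBlocks (((1 + p.1.1) / 2 : ℂ) • M) ((star p.1.2 / 2 : ℂ) • M) ((p.1.2 / 2 : ℂ) • M)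
    (((1 - p.1.1) / 2 : ℂ) • M)

@[fun_prop]
theorem continuous_bott {Z : Type} [TopologicalSpace Z] {f : Z → S2} {g : Z → Matrix ι κ ℂ}
    (hf : Continuous f) (hg : Continuous g) : Continuous fun z => bott (f z) (g z) := by
  unfold bott
  fun_prop

theorem S2.eq (p : S2) : (p.1.1 : ℂ) ^ 2 + p.1.2 * star p.1.2 = 1 := by
  have h := p.2
  rw [show star p.1.2 = (starRingEnd ℂ) p.1.2 from rfl, Complex.mul_conj, Complex.normSq_eq_norm_sq]
  exact_mod_cast h

theorem bott_mul {l : Type} (p : S2) (M : Matrix ι κ ℂ) (N : Matrix κ l ℂ) :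
    bott p M * bott p N = bott p (M * N) := by
  have h := S2.eq p
  simp only [bott, fromBlocks_multiply, Matrix.smul_mul, Matrix.mul_smul, smul_smul, ← add_smul]
  congr 2
  · linear_combination h / 4
  · ring
  · ring
  · linear_combination h / 4

theorem bott_add (p : S2) (M N : Matrix ι κ ℂ) : bott p (M + N) = bott p M + bott p N := by
  simp [bott, fromBlocks_add, smul_add]

theorem bott_sub (p : S2) (M N : Matrix ι κ ℂ) : bott p (M - N) = bott p M - bott p N := by
  ext (i | i) (j | j) <;> simp [bott, mul_sub]

theorem bott_smul (p : S2) (z : ℂ) (M : Matrix ι κ ℂ) : bott p (z • M) = z • bott p M := by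
  ext (i | i) (j | j) <;> simp [bott, mul_left_comm]

theorem IsIdem.bott {E : X → Matrix ι ι ℂ} (hE : IsIdem E) :
    IsIdem fun y : X × S2 => bott y.2 (E y.1) := by
  have := hE.1
  exact ⟨by fun_prop, fun y => by rw [bott_mul, hE.2]⟩

theorem IdemFun.s2_bott {E : X → Matrix ι ι ℂ} (hE : IsIdem E) :
    φ.s2.val (fun y => SphereParallel.bott y.2 (E y.1)) = φ.val E := by
  have hz : ∀ z : Circle, (z : ℂ) * star (z : ℂ) = 1 := fun z => by
    rw [show star (z : ℂ) = (starRingEnd ℂ) z from rfl, Complex.mul_conj]; simp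
  have hcs : ∀ t : I, (Real.cos (Real.pi * t / 2) : ℂ) ^ 2 + (Real.sin (Real.pi * t / 2) : ℂ) ^ 2 =
      1 := fun t => by exact_mod_cast Real.cos_sq_add_sin_sq _
  have hcos : ∀ t : I, (Real.cos (Real.pi * t) : ℂ) =
      2 * (Real.cos (Real.pi * t / 2) : ℂ) ^ 2 - 1 := fun t => by
    rw [← Complex.ofReal_pow]; norm_cast
    rw [← Real.cos_two_mul]; ring_nf
  have hsin : ∀ t : I, (Real.sin (Real.pi * t) : ℂ) =
      2 * (Real.sin (Real.pi * t / 2) : ℂ) * (Real.cos (Real.pi * t / 2) : ℂ) := fun t => by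
    norm_cast
    rw [← Real.sin_two_mul]; ring_nf
  have hu : Triv (fun y : X × S2 => SphereParallel.bott y.2 (E y.1)) fun p : I × (X × Circle) =>
      Matrix.fromBlocks ((Real.cos (Real.pi * p.1 / 2) : ℂ) • (1 : Matrix ι ι ℂ))
        ((-(Real.sin (Real.pi * p.1 / 2) : ℂ) * star (p.2.2 : ℂ)) • (1 : Matrix ι ι ℂ))
        (((Real.sin (Real.pi * p.1 / 2) : ℂ) * (p.2.2 : ℂ)) • (1 : Matrix ι ι ℂ))
        ((Real.cos (Real.pi * p.1 / 2) : ℂ) • (1 : Matrix ι ι ℂ)) := by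
    refine ⟨IsGL.of_mul (h := fun p : I × (X × Circle) =>
      Matrix.fromBlocks ((Real.cos (Real.pi * p.1 / 2) : ℂ) • (1 : Matrix ι ι ℂ))
        (((Real.sin (Real.pi * p.1 / 2) : ℂ) * star (p.2.2 : ℂ)) • (1 : Matrix ι ι ℂ))
        ((-(Real.sin (Real.pi * p.1 / 2) : ℂ) * (p.2.2 : ℂ)) • (1 : Matrix ι ι ℂ))
        ((Real.cos (Real.pi * p.1 / 2) : ℂ) • (1 : Matrix ι ι ℂ))) ?_ fun p => ?_, fun y => ?_,
        fun t y => ?_⟩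
    · fun_prop
    · simp only [Matrix.fromBlocks_multiply, Matrix.smul_mul, Matrix.mul_smul, smul_smul,
        ← add_smul,
        Matrix.one_mul, ← Matrix.fromBlocks_one]
      have h1 := hz p.2.2
      have h2 := hcs p.1
      generalize (Real.cos (Real.pi * p.1 / 2) : ℂ) = c at *
      generalize (Real.sin (Real.pi * p.1 / 2) : ℂ) = s at *
      congr 1
      · convert one_smul ℂ (1 : Matrix ι ι ℂ) using 2
        linear_combination h2 + s ^ 2 * h1
      · convert zero_smul ℂ (1 : Matrix ι ι ℂ) using 2
        ring
      · convert zero_smul ℂ (1 : Matrix ι ι ℂ) using 2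
        ring
      · convert one_smul ℂ (1 : Matrix ι ι ℂ) using 2
        linear_combination h2 + s ^ 2 * h1
    · simp [← Matrix.fromBlocks_one]
    · simp only [SphereParallel.bott, sig, north, Matrix.fromBlocks_multiply, Matrix.smul_mul,
        Matrix.mul_smul, smul_smul, ← add_smul, Matrix.one_mul, Matrix.mul_one, hcos]
      simp only [hsin]
      have h1 := hz y.2
      have h2 := hcs t
      generalize hc : (Real.cos (Real.pi * t / 2) : ℂ) = c at *
      generalize hs : (Real.sin (Real.pi * t / 2) : ℂ) = s at *
      have hc' : star c = c := by rw [← hc]; exact Complex.conj_ofReal _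
      have hs' : star s = s := by rw [← hs]; exact Complex.conj_ofReal _
      simp only [star_mul, hc', hs', star_ofNat, star_zero, Complex.ofReal_one]
      congr 2
      · linear_combination (-s ^ 2 * c) * h1 - c * h2
      · ring
      · ring
      · linear_combination (s ^ 2 * c) * h1 + c * h2
  rw [φ.s2_eq hE.bott hu, ← φ.toGL_idem hE, ← φ.toGL.block1' (κ := ι) (isGL_idem hE)]
  refine φ.toGL.congr fun y => ?_
  rw [clutchGL, hu.clutch_eq (a := Matrix.fromBlocks ((y.2 : ℂ) • 1) 0 0 (star (y.2 : ℂ) • 1))]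
  · rw [← Matrix.fromBlocks_one, SphereParallel.bott, Matrix.fromBlocks_multiply]
    ext (i | i) (j | j) <;> simp [north, Matrix.one_apply]
  · simp [Matrix.fromBlocks_multiply]

end
end SphereParallel

namespace SphereParallel

open Matrix unitInterval Filter Topology
open scoped InnerProductSpace

/-- A linear family of matrices `β` with `β v * (β v)ᴴ = ‖v‖ ^ 2` and `β v + (β v)ᴴ = 2 ⟪e, v⟫`,
giving an irreducible Clifford module. -/
structure Cl (E : Type) [NormedAddCommGroup E] [InnerProductSpace ℝ E] (ι : Type) [Fintype ι]
    [DecidableEq ι] where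
  e : E
  β : E →ₗ[ℝ] Matrix ι ι ℂ
  norm_e : ‖e‖ = 1
  map_e : β e = 1
  mul_star : ∀ v, β v * (β v)ᴴ = ((‖v‖ ^ 2 : ℝ) : ℂ) • (1 : Matrix ι ι ℂ)
  add_star : ∀ v, β v + (β v)ᴴ = ((2 * ⟪e, v⟫_ℝ : ℝ) : ℂ) • (1 : Matrix ι ι ℂ)
  schur : ∀ M : Matrix ι ι ℂ, (∀ v, M * β v = β v * M) → ∃ c : ℂ, M = c • (1 : Matrix ι ι ℂ)
  skew : ∀ M : Matrix ι ι ℂ, (∀ v, M * β v = (β v)ᴴ * M) → M = 0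
  nonempty : Nonempty ι

section

variable {E : Type} [NormedAddCommGroup E] [InnerProductSpace ℝ E] {ι : Type} [Fintype ι]
    [DecidableEq ι] (C : Cl E ι)

namespace Cl

theorem star_eq (v : E) : (C.β v)ᴴ = ((2 * ⟪C.e, v⟫_ℝ : ℝ) : ℂ) • (1 : Matrix ι ι ℂ) - C.β v := by
  rw [← C.add_star v]; abel

theorem star_mul (v : E) : (C.β v)ᴴ * C.β v = ((‖v‖ ^ 2 : ℝ) : ℂ) • (1 : Matrix ι ι ℂ) := by
  rw [← C.mul_star v, C.star_eq]
  simp [sub_mul, mul_sub]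

theorem skew_of_star {M : Matrix ι ι ℂ} {v : E} (h : M * (C.β v)ᴴ = C.β v * M) :
    M * C.β v = (C.β v)ᴴ * M := by
  rw [C.star_eq] at h ⊢
  rw [sub_mul, ← h, mul_sub]; simp

/-- Reflection in the line spanned by `e`. -/
noncomputable def flip (v : E) : E := (2 * ⟪C.e, v⟫_ℝ) • C.e - v

theorem map_flip (v : E) : C.β (C.flip v) = (C.β v)ᴴ := by
  rw [flip, map_sub, map_smul, C.map_e, C.star_eq, ← Complex.coe_smul]

theorem continuous [FiniteDimensional ℝ E] : Continuous C.β :=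
  LinearMap.continuous_of_finiteDimensional _

theorem isUnit {v : E} (hv : ‖v‖ = 1) : IsUnit (C.β v) :=
  isUnit_of_mul_eq_one (b := (C.β v)ᴴ) (by rw [C.mul_star, hv]; simp)

end Cl

/-- The Clifford module of `ℂ`. -/
noncomputable def clBase : Cl ℂ Unit where
  e := 1
  β := { toFun := fun v => v • (1 : Matrix Unit Unit ℂ)
         map_add' := fun v w => add_smul v w _
         map_smul' := fun r v => by ext; simp }
  norm_e := by simp
  map_e := by simp
  mul_star := fun v => by
    ext i j
    simp [mul_comm _ v, Complex.mul_conj, Complex.normSq_eq_norm_sq]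
  add_star := fun v => by
    ext i j
    simp [Complex.inner, Complex.add_conj]
  schur := fun M _ => ⟨M () (), by ext; simp⟩
  skew := fun M h => by
    have := congrFun (congrFun (h Complex.I) ()) ()
    simp at this
    ext i j
    have h2 : M () () * (2 * Complex.I) = 0 := by linear_combination this
    simpa using h2
  nonempty := inferInstance

/-- Passing from `E` to `E × ℂ`. -/
noncomputable def Cl.succ : Cl (WithLp 2 (E × ℂ)) (ι ⊕ ι) where
  e := WithLp.toLp 2 (C.e, 0)
  β := { toFun := fun v => fromBlocks (C.β v.fst) (-((starRingEnd ℂ) v.snd) • (1 : Matrix ι ι ℂ))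
            (v.snd • (1 : Matrix ι ι ℂ)) (C.β v.fst)ᴴ
         map_add' := fun v w => by
          rw [fromBlocks_add]
          simp only [WithLp.add_fst, WithLp.add_snd, map_add, add_smul, conjTranspose_add, neg_add]
         map_smul' := fun r v => by
          rw [RingHom.id_apply, fromBlocks_smul]
          simp only [WithLp.smul_fst, WithLp.smul_snd, map_smul, conjTranspose_smul]
          congr 1
          · ext i j; simp; ring
          · ext i j; simp; ring }
  norm_e := by simp [C.norm_e]
  map_e := by simp [C.map_e]
  mul_star := fun v => by
    have h : v.snd * (starRingEnd ℂ) v.snd = ((‖v.snd‖ ^ 2 : ℝ) : ℂ) := by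
      rw [Complex.mul_conj, Complex.normSq_eq_norm_sq]
    simp only [LinearMap.coe_mk, AddHom.coe_mk, fromBlocks_conjTranspose, fromBlocks_multiply,
      conjTranspose_smul, conjTranspose_one, conjTranspose_conjTranspose, C.mul_star, C.star_mul,
      WithLp.prod_norm_sq_eq_of_L2, Complex.ofReal_add, ← h, ← fromBlocks_one, fromBlocks_smul,
      smul_mul_smul_comm, one_mul, Matrix.mul_smul, Matrix.smul_mul, mul_one, smul_zero]
    congr 1
    · simp; module
    · simp
    · simp
    · simp; module
  add_star := fun v => by
    simp only [LinearMap.coe_mk, AddHom.coe_mk, fromBlocks_conjTranspose, fromBlocks_add,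
      conjTranspose_conjTranspose, C.add_star, ← fromBlocks_one, fromBlocks_smul]
    congr 1
    · simp
    · simp
    · simp
    · rw [add_comm, C.add_star]; simp
  schur := fun M h => by
    obtain ⟨a, b, c, d, rfl⟩ : ∃ a b c d, M = fromBlocks a b c d :=
      ⟨_, _, _, _, (fromBlocks_toBlocks M).symm⟩
    have h1 : ∀ v, a * C.β v = C.β v * a ∧ b * (C.β v)ᴴ = C.β v * b ∧
        c * C.β v = (C.β v)ᴴ * c := fun v => by
      have := h (WithLp.toLp 2 (v, 0))
      simp only [LinearMap.coe_mk, AddHom.coe_mk, fromBlocks_multiply] at this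
      have := fromBlocks_inj.1 this
      simp at this
      exact ⟨this.1, this.2.1, this.2.2.1⟩
    have h2 := h (WithLp.toLp 2 (0, 1))
    simp only [LinearMap.coe_mk, AddHom.coe_mk, fromBlocks_multiply] at h2
    have h2 := fromBlocks_inj.1 h2
    simp at h2
    have hb := C.skew b fun v => C.skew_of_star (h1 v).2.1
    have hc := C.skew c fun v => (h1 v).2.2
    obtain ⟨z, hz⟩ := C.schur a fun v => (h1 v).1
    refine ⟨z, ?_⟩
    rw [← fromBlocks_one, fromBlocks_smul, hb, hc, ← hz, h2.2.1]
    simp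
  skew := fun M h => by
    obtain ⟨a, b, c, d, rfl⟩ : ∃ a b c d, M = fromBlocks a b c d :=
      ⟨_, _, _, _, (fromBlocks_toBlocks M).symm⟩
    have h1 : ∀ v, a * C.β v = (C.β v)ᴴ * a ∧ b * (C.β v)ᴴ = (C.β v)ᴴ * b ∧
        c * C.β v = C.β v * c ∧ d * (C.β v)ᴴ = C.β v * d := fun v => by
      have := h (WithLp.toLp 2 (v, 0))
      simp only [LinearMap.coe_mk, AddHom.coe_mk, fromBlocks_multiply,
        fromBlocks_conjTranspose] at this
      have := fromBlocks_inj.1 this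
      simp at this
      exact this
    have h2 := h (WithLp.toLp 2 (0, 1))
    have h3 := h (WithLp.toLp 2 (0, Complex.I))
    simp only [LinearMap.coe_mk, AddHom.coe_mk, fromBlocks_multiply,
      fromBlocks_conjTranspose] at h2 h3
    have h2 := (fromBlocks_inj.1 h2).1
    have h3 := (fromBlocks_inj.1 h3).1
    simp at h2 h3
    have ha := C.skew a fun v => (h1 v).1
    have hd := C.skew d fun v => C.skew_of_star (h1 v).2.2.2
    have hb : b = 0 := by
      rw [h2] at h3
      ext i j
      have := congrFun (congrFun h3 i) j
      simp at this
      have h4 : c i j * (2 * Complex.I) = 0 := by linear_combination this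
      rw [h2]
      simpa using h4
    rw [ha, hd, ← h2, hb]
    simp
  nonempty := ⟨Sum.inl C.nonempty.some⟩

end
end SphereParallel

namespace SphereParallel

open Matrix unitInterval Filter Topology
open scoped InnerProductSpace

section

variable {X Y Y' Z ι κ : Type} [TopologicalSpace X] [TopologicalSpace Y] [TopologicalSpace Y']
  [TopologicalSpace Z] [Fintype ι] [DecidableEq ι] [Fintype κ] [DecidableEq κ]

/-- Precomposition of an invariant with the pullback along `f`. -/
def GLFun.pull (μ : GLFun Y') (f : Y' → Y) (hf : Continuous f) : GLFun Y where
  val := fun g => μ.val (fun y => g (f y))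
  homotopy' := fun {ι} _ _ {G} hG =>
    μ.homotopy' (G := fun p => G (p.1, f p.2)) (hG.comp (by fun_prop))
  mul' := fun hg hh => μ.mul' (hg.comp hf) (hh.comp hf)
  block1' := fun hg => μ.block1' (hg.comp hf)
  block2' := fun hg => μ.block2' (hg.comp hf)

theorem bott_corner_mul (p : S2) (M N : Matrix ι ι ℂ) :
    (1 - bott p 1 + bott p M) * (1 - bott p 1 + bott p N) = 1 - bott p 1 + bott p (M * N) := by
  simp only [add_mul, sub_mul, mul_add, mul_sub, bott_mul, one_mul, mul_one]
  abel

theorem isGL_bott {f : Z → S2} (hf : Continuous f) {g : Z → Matrix ι ι ℂ} (hg : IsGL g) :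
    IsGL fun z => 1 - bott (f z) 1 + bott (f z) (g z) := by
  have := hg.1
  refine IsGL.of_mul (h := fun z => 1 - bott (f z) 1 + bott (f z) (g z)⁻¹) (by fun_prop) fun z => ?_
  rw [bott_corner_mul, hg.mul_inv]
  simp

theorem GLFun.val_bott_rect (μ : GLFun Z) {f : Z → S2} (hf : Continuous f) {g : Z → Matrix ι ι ℂ}
    (hg : IsGL g) {u : Matrix κ ι ℂ} {v : Matrix ι κ ℂ} (huv : v * u = 1) :
    μ.val (fun z => 1 - bott (f z) 1 + bott (f z) (1 - u * v + u * g z * v)) =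
      μ.val fun z => 1 - bott (f z) 1 + bott (f z) (g z) := by
  have := μ.corner (E := fun _ => (1 : Matrix (ι ⊕ ι) (ι ⊕ ι) ℂ)) isIdem_one (isGL_bott hf hg)
    (by simp) (u := fun _ => fromBlocks u 0 0 u) (v := fun _ => fromBlocks v 0 0 v)
    continuous_const continuous_const (fun _ => by simp [fromBlocks_multiply, huv])
    (by simp) (by simp)
  simp only [sub_self, zero_add, one_mul] at this
  rw [← this]
  refine μ.congr fun z => ?_
  have e : ∀ M : Matrix ι ι ℂ, fromBlocks u 0 0 u * bott (f z) M * fromBlocks v 0 0 v =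
      bott (f z) (u * M * v) := fun M => by
    simp [bott, fromBlocks_multiply]
  rw [Matrix.mul_add, Matrix.add_mul, Matrix.mul_sub, Matrix.sub_mul, e, e, bott_add, bott_sub,
    Matrix.mul_one, Matrix.mul_one]
  abel

/-- The invariant of `g` computed by cutting down to the Bott projection. -/
noncomputable def GLFun.pushBott (μ : GLFun ((X × S2) × Circle)) : GLFun (X × Circle) where
  val := fun g => μ.val fun y => 1 - bott y.1.2 (1 : Matrix _ _ ℂ) + bott y.1.2 (g (y.1.1, y.2))
  homotopy' := fun {ι} _ _ {G} hG => μ.homotopy'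
    (G := fun p => 1 - bott p.2.1.2 1 + bott p.2.1.2 (G (p.1, (p.2.1.1, p.2.2))))
    (isGL_bott (by fun_prop) (hG.comp (f := fun p : I × ((X × S2) × Circle) =>
      (p.1, (p.2.1.1, p.2.2))) (by fun_prop)))
  mul' := fun {ι} _ _ {g h} hg hh => by
    rw [← μ.mul' (isGL_bott (by fun_prop) (hg.comp (f := fun y : (X × S2) × Circle =>
      (y.1.1, y.2)) (by fun_prop))) (isGL_bott (by fun_prop) (hh.comp (f := fun y :
      (X × S2) × Circle => (y.1.1, y.2)) (by fun_prop)))]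
    exact μ.congr fun y => (bott_corner_mul _ _ _).symm
  block1' := fun {ι κ} _ _ _ _ {g} hg => by
    rw [← μ.val_bott_rect (by fun_prop) (hg.comp (f := fun y : (X × S2) × Circle =>
      (y.1.1, y.2)) (by fun_prop)) (u := fromRows (1 : Matrix ι ι ℂ) (0 : Matrix κ ι ℂ))
      (v := fromCols (1 : Matrix ι ι ℂ) (0 : Matrix ι κ ℂ)) (by rw [fromCols_mul_fromRows]; simp)]
    refine μ.congr fun y => ?_
    congr 2
    rw [fromRows_mul_fromCols, fromRows_mul, fromRows_mul_fromCols, ← fromBlocks_one]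
    ext (i | i) (j | j) <;> simp [Matrix.one_apply]
  block2' := fun {ι κ} _ _ _ _ {g} hg => by
    rw [← μ.val_bott_rect (by fun_prop) (hg.comp (f := fun y : (X × S2) × Circle =>
      (y.1.1, y.2)) (by fun_prop)) (u := fromRows (0 : Matrix κ ι ℂ) (1 : Matrix ι ι ℂ))
      (v := fromCols (0 : Matrix ι κ ℂ) (1 : Matrix ι ι ℂ)) (by rw [fromCols_mul_fromRows]; simp)]
    refine μ.congr fun y => ?_
    congr 2
    rw [fromRows_mul_fromCols, fromRows_mul, fromRows_mul_fromCols, ← fromBlocks_one]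
    ext (i | i) (j | j) <;> simp [Matrix.one_apply]

theorem IdemFun.s2_toGL_bott [CompactSpace X] [T2Space X] (φ : IdemFun X)
    {g : X × Circle → Matrix ι ι ℂ} (hg : IsGL g) :
    φ.s2.toGL.val (fun y => 1 - SphereParallel.bott y.1.2 (1 : Matrix ι ι ℂ) +
      SphereParallel.bott y.1.2 (g (y.1.1, y.2))) = φ.toGL.val g := by
  refine AgreeOnBasic.eq (μ := φ.s2.toGL.pushBott) (ν := φ.toGL) ⟨?_, ?_⟩ hg
  · intro ι _ _ g hg
    rw [φ.toGL_pullback hg]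
    exact φ.s2.toGL_pullback (isGL_bott (f := fun x : X × S2 => x.2) (g := fun x => g x.1)
      (by fun_prop) (hg.comp continuous_fst))
  · intro ι _ _ E hE
    rw [φ.toGL_idem hE, ← φ.s2_bott hE, ← φ.s2.toGL_idem hE.bott]
    refine φ.s2.toGL.congr fun y => ?_
    simp only [bott_add, bott_sub, bott_smul]
    abel

theorem IdemFun.s2_toGL_pull [CompactSpace X] [T2Space X] (φ : IdemFun X)
    {g : X × Circle → Matrix ι ι ℂ} (hg : IsGL g) :
    φ.s2.toGL.val (fun y => g (y.1.1, y.2)) = 0 := by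
  have := AgreeOnBasic.eq (μ := φ.s2.toGL.pull (fun y => (y.1.1, y.2)) (by fun_prop))
    (ν := φ.toGL.zmul 0) ⟨?_, ?_⟩ hg
  · exact this.trans (zero_mul _)
  · intro ι _ _ g hg
    refine Eq.trans ?_ (zero_mul _).symm
    exact φ.s2.toGL_pullback (g := fun x => g x.1) (hg.comp continuous_fst)
  · intro ι _ _ E hE
    refine Eq.trans ?_ (zero_mul _).symm
    exact (φ.s2.toGL_idem (E := fun x : X × S2 => E x.1) (hE.comp continuous_fst)).trans
      (φ.s2_pullback hE)

end

end SphereParallel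

namespace SphereParallel

open Matrix unitInterval Filter Topology
open scoped InnerProductSpace

section

variable {ι : Type} [Fintype ι] [DecidableEq ι]

/-- Elements of the algebra generated by `g`. -/
noncomputable def affineIn (g : Matrix ι ι ℂ) (a b : ℂ) : Matrix ι ι ℂ := a • 1 + b • g

theorem affineIn_mul {g : Matrix ι ι ℂ} {y : ℝ} (hg : g * g = (2 * y : ℂ) • g - 1) (a b c d : ℂ) :
    affineIn g a b * affineIn g c d =
      affineIn g (a * c - b * d) (a * d + b * c + 2 * y * b * d) := by
  simp only [affineIn, add_mul, mul_add, smul_mul_smul_comm, hg, one_mul, mul_one]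
  module

theorem affineIn_add (g : Matrix ι ι ℂ) (a b c d : ℂ) :
    affineIn g a b + affineIn g c d = affineIn g (a + c) (b + d) := by
  simp only [affineIn]
  module

theorem affineIn_neg (g : Matrix ι ι ℂ) (a b : ℂ) : -affineIn g a b = affineIn g (-a) (-b) := by
  simp only [affineIn]
  module

/-- The path of matrices joining the two descriptions of the Bott generator. -/
noncomputable def bottPath (g : Matrix ι ι ℂ) (y : ℝ) (p : S2) (τ : ℝ) :
    Matrix (ι ⊕ ι) (ι ⊕ ι) ℂ :=
  fromBlocks (affineIn g (((1 + p.1.1) + (1 - p.1.1) * (2 * y)) / 2) (-(1 - p.1.1) / 2))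
    (-affineIn g (star p.1.2 * (y - 1 + τ * y) / 2) (-star p.1.2 * τ / 2))
    (affineIn g (p.1.2 * (y - 1 - τ * y) / 2) (p.1.2 * τ / 2))
    (affineIn g ((1 + p.1.1) / 2) ((1 - p.1.1) / 2))

theorem bottPath_isUnit {g : Matrix ι ι ℂ} {y : ℝ} (hg : g * g = (2 * y : ℂ) • g - 1)
    (hy : |y| ≤ 1) (p : S2) (τ : ℝ) : IsUnit (bottPath g y p τ) := by
  obtain ⟨δ, hδ⟩ : ∃ δ : ℝ, δ = (1 + p.1.1 ^ 2 + (1 - p.1.1 ^ 2) * y) / 2 +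
    (1 - p.1.1 ^ 2) * ((1 - y) ^ 2 + τ ^ 2 * (1 - y ^ 2)) / 4 := ⟨_, rfl⟩
  have hs : 0 ≤ 1 - p.1.1 ^ 2 := by nlinarith [p.2, sq_nonneg ‖p.1.2‖]
  have hy2 : 0 ≤ 1 - y ^ 2 := by nlinarith [abs_le.1 hy, (abs_le.1 hy).1, (abs_le.1 hy).2]
  have hpos : δ ≠ 0 := by
    have : 0 < δ := by
      rw [hδ]
      nlinarith [mul_nonneg hs (mul_nonneg (sq_nonneg τ) hy2), mul_nonneg hs (sq_nonneg y),
        sq_nonneg p.1.1]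
    exact this.ne'
  have key : bottPath g y p τ *
      fromBlocks (affineIn g ((1 + p.1.1) / 2) ((1 - p.1.1) / 2))
        (affineIn g (star p.1.2 * (y - 1 + τ * y) / 2) (-star p.1.2 * τ / 2))
        (-affineIn g (p.1.2 * (y - 1 - τ * y) / 2) (p.1.2 * τ / 2))
        (affineIn g (((1 + p.1.1) + (1 - p.1.1) * (2 * y)) / 2) (-(1 - p.1.1) / 2)) =
      (δ : ℂ) • 1 := by
    have h := S2.eq p
    rw [bottPath, fromBlocks_multiply, ← fromBlocks_one, fromBlocks_smul]
    simp only [affineIn_neg, affineIn_mul hg, affineIn_add]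
    have e : ∀ a : ℂ, a • (1 : Matrix ι ι ℂ) = affineIn g a 0 := fun a => by simp [affineIn]
    rw [smul_zero, e, ← zero_smul ℂ (1 : Matrix ι ι ℂ), e, hδ]
    push_cast
    generalize p.1.2 = w at *
    generalize star w = w' at *
    generalize (p.1.1 : ℂ) = s at *
    congr 2
    · linear_combination ((1 - y) ^ 2 + τ ^ 2 * (1 - y ^ 2)) / 4 * h
    · ring
    · ring
    · ring
    · ring
    · ring
    · linear_combination ((1 - y) ^ 2 + τ ^ 2 * (1 - y ^ 2)) / 4 * h
    · ring
  have h2 : IsUnit ((δ : ℂ)⁻¹ • bottPath g y p τ) := isUnit_of_mul_eq_one (by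
    rw [smul_mul_assoc, key, smul_smul, inv_mul_cancel₀ (by exact_mod_cast hpos), one_smul])
  have := isUnit_smul (c := (δ : ℂ)) (by exact_mod_cast hpos) h2
  rwa [smul_smul, mul_inv_cancel₀ (by exact_mod_cast hpos), one_smul] at this

theorem fromBlocks_sub' {l m n o : Type} (A A' : Matrix n l ℂ) (B B' : Matrix n m ℂ)
    (C C' : Matrix o l ℂ) (D D' : Matrix o m ℂ) :
    fromBlocks A B C D - fromBlocks A' B' C' D' =
      fromBlocks (A - A') (B - B') (C - C') (D - D') := by
  ext (i | i) (j | j) <;> simp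

theorem bottPath_one (g : Matrix ι ι ℂ) {y : ℝ} {g' : Matrix ι ι ℂ} (h : g' = (2 * y : ℂ) • 1 - g)
    (hg : g' * g = 1) (p : S2) :
    bottPath g y p 1 = fromBlocks g' 0 0 1 * (1 - bott p 1 + bott p g) := by
  rw [mul_add, mul_sub, mul_one, bott, bott, fromBlocks_multiply, fromBlocks_multiply, bottPath,
    fromBlocks_sub', fromBlocks_add]
  simp only [Matrix.mul_smul, hg, mul_one, one_mul, zero_mul, add_zero, zero_add]
  rw [h]
  simp only [affineIn]
  congr 1 <;> push_cast <;> module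

section

variable {E : Type} [NormedAddCommGroup E] [InnerProductSpace ℝ E] (C : Cl E ι)

/-- The unnormalised Clifford vector over the suspension. -/
noncomputable def bottVec (y : E) (p : S2) : WithLp 2 (E × ℂ) :=
  WithLp.toLp 2 (((1 + p.1.1) / 2) • C.e + ((1 - p.1.1) / 2) • C.flip y,
    ((⟪C.e, y⟫_ℝ - 1) / 2 : ℝ) • p.1.2)

theorem bottPath_zero (y : E) (p : S2) :
    bottPath (C.β y) ⟪C.e, y⟫_ℝ p 0 = C.succ.β (bottVec C y p) := by
  have h : C.succ.β (bottVec C y p) = fromBlocks (C.β (bottVec C y p).fst)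
    (-((starRingEnd ℂ) (bottVec C y p).snd) • (1 : Matrix ι ι ℂ))
    ((bottVec C y p).snd • (1 : Matrix ι ι ℂ)) (C.β (bottVec C y p).fst)ᴴ := rfl
  have h1 : (bottVec C y p).fst =
    ((1 + p.1.1) / 2) • C.e + ((1 - p.1.1) / 2) • C.flip y := rfl
  have h2 : (bottVec C y p).snd = (((⟪C.e, y⟫_ℝ : ℝ) - 1) / 2 : ℂ) * p.1.2 := by
    simp [bottVec]
  have h3 : C.β (bottVec C y p).fst = ((1 + p.1.1) / 2 : ℂ) • (1 : Matrix ι ι ℂ) +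
      ((1 - p.1.1) / 2 : ℂ) • (C.β y)ᴴ := by
    rw [h1, map_add, map_smul, map_smul, C.map_e, C.map_flip, ← Complex.coe_smul,
      ← Complex.coe_smul]
    push_cast
    rfl
  have h4 : (C.β (bottVec C y p).fst)ᴴ = ((1 + p.1.1) / 2 : ℂ) • (1 : Matrix ι ι ℂ) +
      ((1 - p.1.1) / 2 : ℂ) • C.β y := by
    rw [h3]
    simp [Complex.conj_ofReal]
  rw [h, bottPath, h4, h3, h2, C.star_eq]
  simp only [affineIn, Complex.star_def, map_mul, map_div₀, map_sub, Complex.conj_ofReal, map_one,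
    map_ofNat]
  congr 1 <;> push_cast <;> module

theorem continuous_flip : Continuous C.flip := by
  unfold Cl.flip
  fun_prop

end

theorem bottVec_val {X : Type} [TopologicalSpace X] [CompactSpace X] [T2Space X] (φ : IdemFun X)
    {E : Type} [NormedAddCommGroup E] [InnerProductSpace ℝ E] [FiniteDimensional ℝ E] (C : Cl E ι)
    {q : X × Circle → E} (hq : Continuous q) (hn : ∀ y, ‖q y‖ = 1) :
    IsGL (fun y : (X × S2) × Circle => C.succ.β (bottVec C (q (y.1.1, y.2)) y.1.2)) ∧
    φ.s2.toGL.val (fun y => C.succ.β (bottVec C (q (y.1.1, y.2)) y.1.2)) =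
      φ.toGL.val fun y => C.β (q y) := by
  have hβ := C.continuous
  have e1 : ∀ y, C.β (q y) * C.β (q y) = (2 * (⟪C.e, q y⟫_ℝ : ℝ) : ℂ) • C.β (q y) - 1 := fun y => by
    have h := C.mul_star (q y)
    rw [C.star_eq, hn, mul_sub, Matrix.mul_smul, mul_one, sub_eq_iff_eq_add] at h
    push_cast at h
    rw [h]
    simp
  have e2 : ∀ y, |⟪C.e, q y⟫_ℝ| ≤ 1 := fun y => by
    have := abs_real_inner_le_norm C.e (q y)
    rwa [C.norm_e, hn, one_mul] at this
  have hg : IsGL fun y => C.β (q y) := ⟨hβ.comp hq, fun y => C.isUnit (hn y)⟩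
  have hg' : IsGL fun y => (C.β (q y))ᴴ := by
    refine IsGL.of_mul (h := fun y => C.β (q y)) (by fun_prop) fun y => ?_
    rw [C.star_mul, hn]; simp
  have hG : IsGL fun p : I × ((X × S2) × Circle) =>
      bottPath (C.β (q (p.2.1.1, p.2.2))) ⟪C.e, q (p.2.1.1, p.2.2)⟫_ℝ p.2.1.2 (p.1 : ℝ) := by
    refine ⟨?_, fun p => bottPath_isUnit (e1 _) (e2 _) _ _⟩
    unfold bottPath affineIn
    fun_prop
  refine ⟨?_, ?_⟩
  · have := hG.comp (f := fun y : (X × S2) × Circle => ((0 : I), y)) (by fun_prop)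
    simpa [bottPath_zero] using this
  · rw [φ.s2.toGL.homotopy hG (g := fun y => C.succ.β (bottVec C (q (y.1.1, y.2)) y.1.2))
      (h := fun y => fromBlocks (C.β (q (y.1.1, y.2)))ᴴ 0 0 1 *
        (1 - bott y.1.2 (1 : Matrix ι ι ℂ) + bott y.1.2 (C.β (q (y.1.1, y.2)))))
      (fun y => by simp [bottPath_zero]) fun y => by
        refine (bottPath_one _ ?_ ?_ _)
        · rw [C.star_eq]; push_cast; rfl
        · rw [C.star_mul, hn]; simp]
    have hf : Continuous fun y : (X × S2) × Circle => (y.1.1, y.2) := by fun_prop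
    rw [φ.s2.toGL.mul' ((hg'.comp hf).fromBlocks isGL_one)
      (isGL_bott (f := fun y : (X × S2) × Circle => y.1.2) (by fun_prop) (hg.comp hf)),
      φ.s2_toGL_bott hg, φ.s2.toGL.block1' (hg'.comp hf), φ.s2_toGL_pull hg', zero_add]

end

end SphereParallel

namespace SphereParallel

open Matrix unitInterval Filter Topology
open scoped InnerProductSpace

section

variable {ι : Type} [Fintype ι] [DecidableEq ι]

theorem rank_eq_trace {P : Matrix ι ι ℂ} (h : P * P = P) : (P.rank : ℂ) = P.trace := by
  have h1 : IsIdempotentElem (Matrix.toLin' P) := by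
    rw [IsIdempotentElem, Module.End.mul_eq_comp, ← Matrix.toLin'_mul, h]
  have h2 := LinearMap.IsProj.trace (LinearMap.IsIdempotentElem.isProj_range _ h1)
  rw [Matrix.trace_toLin'_eq] at h2
  rw [h2]
  rfl

/-- The invariant of a single idempotent matrix given by its rank. -/
noncomputable def rankFun : IdemFun Unit where
  val := fun P => ((P ()).rank : ℤ)
  add' := fun {ι} _ _ {P Q} hP hQ h1 h2 => by
    have h3 : (P () + Q ()) * (P () + Q ()) = P () + Q () := by
      rw [add_mul, mul_add, mul_add, hP.2, hQ.2, h1, h2]; simp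
    have h := rank_eq_trace h3
    rw [Matrix.trace_add, ← rank_eq_trace (hP.2 ()), ← rank_eq_trace (hQ.2 ())] at h
    exact_mod_cast h
  equiv' := fun {ι κ} _ _ _ _ {u v} hu hv h1 h2 => by
    have h := rank_eq_trace (h1.2 ())
    rw [Matrix.trace_mul_comm, ← rank_eq_trace (h2.2 ())] at h
    exact_mod_cast h

theorem trace_cube_mul_cyc (P : Matrix ι ι ℂ) : (cyc ι * cube P).trace = (P * P * P).trace := by
  simp only [Matrix.trace, Matrix.diag_apply, cyc_mul_apply]
  simp only [cube, t3, Matrix.kroneckerMap_apply, Matrix.mul_apply, Fintype.sum_prod_type,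
    Finset.sum_mul]
  refine Finset.sum_congr rfl fun i _ => ?_
  rw [Finset.sum_comm]
  refine Finset.sum_congr rfl fun j _ => Finset.sum_congr rfl fun k _ => ?_
  ring

theorem trace_cube_mul_cyc_sq (P : Matrix ι ι ℂ) :
    (cyc ι * cyc ι * cube P).trace = (P * P * P).trace := by
  simp only [Matrix.trace, Matrix.diag_apply, Matrix.mul_assoc (cyc ι) (cyc ι), cyc_mul_apply]
  simp only [cube, t3, Matrix.kroneckerMap_apply, Matrix.mul_apply, Fintype.sum_prod_type,
    Finset.sum_mul]
  refine Finset.sum_congr rfl fun i _ => ?_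
  refine Finset.sum_congr rfl fun j _ => Finset.sum_congr rfl fun k _ => ?_
  ring

theorem trace_es_sub {P : Matrix ι ι ℂ} (h : P * P = P) :
    (es ι 1 * cube P).trace - (es ι om * cube P).trace = P.trace := by
  have h1 := trace_cube_mul_cyc P
  have h2 := trace_cube_mul_cyc_sq P
  rw [h, h] at h1 h2
  simp only [es, spr, Matrix.smul_mul, Matrix.add_mul, Matrix.trace_smul, Matrix.trace_add, h1, h2,
    smul_eq_mul]
  linear_combination (-(3 : ℂ)⁻¹ * P.trace) * om_sum

theorem psiEigen_rankFun : PsiEigen rankFun 0 := by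
  intro ι _ _ P hP
  have h := trace_es_sub (hP.2 ())
  have i1 := (hP.es_cube (one_pow 3)).2 ()
  have i2 := (hP.es_cube om_cube).2 ()
  rw [← rank_eq_trace i1, ← rank_eq_trace i2, ← rank_eq_trace (hP.2 ())] at h
  rw [pow_zero, one_mul]
  have hcast : ((((es ι 1 * cube (P ())).rank : ℤ) - ((es ι om * cube (P ())).rank : ℤ) : ℤ) : ℂ) =
    (((P ()).rank : ℤ) : ℂ) := by
    push_cast
    exact h
  exact Int.cast_injective hcast

/-- The data witnessing that a Clifford module generates the invariants of a sphere. -/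
structure BottData (m : ℕ) where
  X : Type
  [top : TopologicalSpace X]
  [compact : CompactSpace X]
  [t2 : T2Space X]
  φ : IdemFun X
  E : Type
  [group : NormedAddCommGroup E]
  [inner : InnerProductSpace ℝ E]
  [fin : FiniteDimensional ℝ E]
  ι : Type
  [fintype : Fintype ι]
  [dec : DecidableEq ι]
  finrank : Module.finrank ℝ E = 2 * (m + 1)
  card : Fintype.card ι = 2 ^ m
  C : Cl E ι
  q : X × Circle → E
  continuous_q : Continuous q
  norm_q : ∀ y, ‖q y‖ = 1
  eigen : PsiEigen φ m
  val_eq : φ.toGL.val (fun y => C.β (q y)) = 1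

attribute [instance] BottData.top BottData.compact BottData.t2 BottData.group BottData.inner
  BottData.fin BottData.fintype BottData.dec

/-- The initial case, a point times the circle. -/
noncomputable def BottData.zero : BottData 0 where
  X := Unit
  φ := rankFun
  E := ℂ
  ι := Unit
  finrank := by simp
  card := by simp
  C := clBase
  q := fun y => y.2
  continuous_q := by fun_prop
  norm_q := fun y => y.2.norm_coe
  eigen := psiEigen_rankFun
  val_eq := by
    have := rankFun.toGL_idem (E := fun _ => (1 : Matrix Unit Unit ℂ)) isIdem_one
    have h2 : rankFun.val (fun _ => (1 : Matrix Unit Unit ℂ)) = 1 := by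
      simp [rankFun]
    rw [h2] at this
    rw [← this]
    refine rankFun.toGL.congr fun y => ?_
    rw [sub_self, zero_add]
    rfl

theorem BottData.bottVec_norm_ne_zero {m : ℕ} (B : BottData m) (y : (B.X × S2) × Circle) :
    ‖bottVec B.C (B.q (y.1.1, y.2)) y.1.2‖ ≠ 0 := fun hy => by
  have h : IsUnit (B.C.succ.β (bottVec B.C (B.q (y.1.1, y.2)) y.1.2)) :=
    (bottVec_val B.φ B.C B.continuous_q B.norm_q).1.2 y
  rw [norm_eq_zero.1 hy, map_zero] at h
  have := B.C.nonempty
  exact not_isUnit_zero h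

/-- The inductive step, given by taking the product with `S2`. -/
noncomputable def BottData.succ {m : ℕ} (B : BottData m) : BottData (m + 1) where
  X := B.X × S2
  φ := B.φ.s2
  E := WithLp 2 (B.E × ℂ)
  ι := B.ι ⊕ B.ι
  finrank := by
    rw [(WithLp.linearEquiv 2 ℝ (B.E × ℂ)).finrank_eq, Module.finrank_prod, B.finrank]
    simp
    ring
  card := by simp [B.card]; ring
  C := B.C.succ
  q := fun y => (‖bottVec B.C (B.q (y.1.1, y.2)) y.1.2‖⁻¹ : ℝ) •
    bottVec B.C (B.q (y.1.1, y.2)) y.1.2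
  continuous_q := by
    have h1 := B.continuous_q
    have h2 := continuous_flip B.C
    have h3 : Continuous fun y : (B.X × S2) × Circle => bottVec B.C (B.q (y.1.1, y.2)) y.1.2 := by
      unfold bottVec
      fun_prop
    exact (h3.norm.inv₀ B.bottVec_norm_ne_zero).smul h3
  norm_q := fun y => by
    rw [norm_smul, norm_inv, norm_norm, inv_mul_cancel₀ (B.bottVec_norm_ne_zero y)]
  eigen := PsiEigen.s2 B.φ B.eigen
  val_eq := by
    have h := bottVec_val B.φ B.C B.continuous_q B.norm_q
    have h2 := continuous_flip B.C
    have h4 := B.continuous_q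
    have h3 : Continuous fun y : (B.X × S2) × Circle => bottVec B.C (B.q (y.1.1, y.2)) y.1.2 := by
      unfold bottVec
      fun_prop
    have hne := B.bottVec_norm_ne_zero
    rw [← B.val_eq, ← h.2, ← B.φ.s2.toGL.pos_smul h.1 (δ := fun y =>
      ‖bottVec B.C (B.q (y.1.1, y.2)) y.1.2‖⁻¹) (h3.norm.inv₀ hne)
      fun y => inv_pos.2 ((norm_nonneg _).lt_of_ne (hne y).symm)]
    refine B.φ.s2.toGL.congr fun y => ?_
    rw [map_smul, Complex.coe_smul]

theorem nonempty_bottData (m : ℕ) : Nonempty (BottData m) := by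
  induction m with
  | zero => exact ⟨BottData.zero⟩
  | succ m ih => exact ⟨ih.some.succ⟩

end

end SphereParallel

namespace SphereParallel

open Matrix unitInterval Filter Topology
open scoped InnerProductSpace

section

/-- The generator of the sphere in `E`. -/
noncomputable def BottData.sphereFun {m : ℕ} (B : BottData m) :
    GLFun (Metric.sphere (0 : B.E) 1) :=
  B.φ.toGL.pull (fun y => (⟨B.q y, by simp [B.norm_q y]⟩ : Metric.sphere (0 : B.E) 1))
    (B.continuous_q.subtype_mk _)

theorem BottData.sphereFun_val {m : ℕ} (B : BottData m) :
    B.sphereFun.val (fun x => B.C.β x) = 1 :=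
  B.val_eq

theorem BottData.sphereFun_psi3 {m : ℕ} (B : BottData m) {κ : Type} [Fintype κ] [DecidableEq κ]
    {g : Metric.sphere (0 : B.E) 1 → Matrix κ κ ℂ} (hg : IsGL g) :
    B.sphereFun.psi3.val g = 3 ^ (m + 1) * B.sphereFun.val g :=
  PsiEigen.psi3_eq B.eigen (hg.comp (B.continuous_q.subtype_mk _))

theorem exists_radial {V : Type} [NormedAddCommGroup V] [InnerProductSpace ℝ V]
    (u : Metric.sphere (0 : V) 1 → V) (hu : Continuous u)
    (hxu : ∀ x : Metric.sphere (0 : V) 1, ⟪(x : V), u x⟫_ℝ = 0)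
    (h0 : ∀ x, u x ≠ 0) :
    ∃ w : V → V, Continuous w ∧ (∀ x, ⟪x, w x⟫_ℝ = 0) ∧ ∀ x, ‖w x‖ = ‖x‖ := by
  classical
  have hs : ∀ x : {x : V // x ≠ 0}, ‖(x : V)‖⁻¹ • (x : V) ∈ Metric.sphere (0 : V) 1 := fun x => by
    have : ‖(x : V)‖ ≠ 0 := norm_ne_zero_iff.2 x.2
    simp [norm_smul, this]
  obtain ⟨w0, hw0⟩ : ∃ w0 : {x : V // x ≠ 0} → V, w0 = fun x : {x : V // x ≠ 0} =>
      (‖(x : V)‖ / ‖u ⟨_, hs x⟩‖) • u ⟨_, hs x⟩ := ⟨_, rfl⟩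
  have hw0c : Continuous w0 := by
    have h1 : Continuous fun x : {x : V // x ≠ 0} => u ⟨_, hs x⟩ := by
      refine hu.comp (Continuous.subtype_mk ?_ _)
      exact (continuous_subtype_val.norm.inv₀ fun x => norm_ne_zero_iff.2 x.2).smul
        continuous_subtype_val
    rw [hw0]
    exact (continuous_subtype_val.norm.div h1.norm fun x => norm_ne_zero_iff.2 (h0 _)).smul h1
  have hw0n : ∀ x : {x : V // x ≠ 0}, ‖w0 x‖ = ‖(x : V)‖ := fun x => by
    have : ‖u ⟨_, hs x⟩‖ ≠ 0 := norm_ne_zero_iff.2 (h0 _)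
    rw [hw0, norm_smul, norm_div, norm_norm, norm_norm, div_mul_cancel₀ _ this]
  have hw0i : ∀ x : {x : V // x ≠ 0}, ⟪(x : V), w0 x⟫_ℝ = 0 := fun x => by
    have h1 := hxu ⟨_, hs x⟩
    rw [inner_smul_left] at h1
    have h2 : ‖(x : V)‖ ≠ 0 := norm_ne_zero_iff.2 x.2
    have h3 : ⟪(x : V), u ⟨_, hs x⟩⟫_ℝ = 0 := by simpa [h2] using h1
    rw [hw0, inner_smul_right, h3, mul_zero]
  have hn : ∀ x : V, ‖if h : x = 0 then (0 : V) else w0 ⟨x, h⟩‖ = ‖x‖ := fun x => by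
    by_cases h : x = 0
    · simp [h]
    · simp [h, hw0n]
  refine ⟨fun x => if h : x = 0 then 0 else w0 ⟨x, h⟩, ?_, fun x => ?_, hn⟩
  · rw [continuous_iff_continuousAt]
    intro x
    by_cases h : x = 0
    · subst h
      rw [ContinuousAt, dif_pos rfl, tendsto_zero_iff_norm_tendsto_zero]
      simp_rw [hn]
      exact tendsto_norm_zero
    · have ho : IsOpen {x : V | x ≠ 0} := isOpen_ne
      refine ContinuousOn.continuousAt (s := {x : V | x ≠ 0}) ?_ (ho.mem_nhds h)
      rw [continuousOn_iff_continuous_domRestrict]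
      refine hw0c.congr fun y => ?_
      have := y.2
      simp only [Set.domRestrict_apply]
      rw [dif_neg y.2]
  · by_cases h : x = 0
    · simp [h]
    · simpa [h] using hw0i ⟨x, h⟩

theorem exists_field_orthogonal {n : ℕ} {E : Type} [NormedAddCommGroup E] [InnerProductSpace ℝ E]
    [FiniteDimensional ℝ E] (hE : Module.finrank ℝ E = n + 2) {e : E} (he : ‖e‖ = 1)
    (w : EuclideanSpace ℝ (Fin (n + 1)) → EuclideanSpace ℝ (Fin (n + 1))) (hw : Continuous w)
    (hwi : ∀ x, ⟪x, w x⟫_ℝ = 0) (hwn : ∀ x, ‖w x‖ = ‖x‖) :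
    ∃ T : E → E, Continuous T ∧ (∀ x, ⟪e, T x⟫_ℝ = 0) ∧ (∀ x, ⟪x, T x⟫_ℝ = 0) ∧
      ∀ x, ‖T x‖ = ‖x - ⟪e, x⟫_ℝ • e‖ := by
  have he0 : e ≠ 0 := fun h => by simp [h] at he
  have : Fact (Module.finrank ℝ E = (n + 1) + 1) := ⟨hE⟩
  obtain ⟨J⟩ : Nonempty ((ℝ ∙ e)ᗮ ≃ₗᵢ[ℝ] EuclideanSpace ℝ (Fin (n + 1))) :=
    ⟨(OrthonormalBasis.fromOrthogonalSpanSingleton (𝕜 := ℝ) (n + 1) he0).repr⟩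
  refine ⟨fun x => (J.symm (w (J ((ℝ ∙ e)ᗮ.orthogonalProjectionOnto x))) : E), ?_, fun x => ?_,
    fun x => ?_, fun x => ?_⟩
  · fun_prop
  · exact Submodule.mem_orthogonal_singleton_iff_inner_right.1 (Subtype.mem _)
  · rw [← Submodule.inner_orthogonalProjectionOnto_eq_of_mem_right, ← J.inner_map_map,
      J.apply_symm_apply, hwi]
  · dsimp only
    rw [← Submodule.coe_norm, J.symm.norm_map, hwn, J.norm_map, Submodule.coe_norm]
    congr 1
    change (ℝ ∙ e)ᗮ.starProjection x = _
    rw [Submodule.starProjection_orthogonal_val, Submodule.starProjection_singleton, he]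
    simp

theorem no_unit_field {k n : ℕ} (hn : n = 2 * k)
    (u : Metric.sphere (0 : EuclideanSpace ℝ (Fin (n + 1))) 1 → EuclideanSpace ℝ (Fin (n + 1)))
    (hu : Continuous u) (hxu : ∀ x : Metric.sphere (0 : EuclideanSpace ℝ (Fin (n + 1))) 1,
      ⟪(x : EuclideanSpace ℝ (Fin (n + 1))), u x⟫_ℝ = 0)
    (h0 : ∀ x, u x ≠ 0) : False := by
  obtain ⟨B⟩ := nonempty_bottData k
  obtain ⟨w, hw, hwi, hwn⟩ := exists_radial u hu hxu h0
  obtain ⟨T, hT, hTe, hTx, hTn⟩ := exists_field_orthogonal (n := n) (E := B.E)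
    (by rw [B.finrank, hn]; ring) B.C.norm_e w hw hwi hwn
  obtain ⟨H, hH⟩ : ∃ H : I × Metric.sphere (0 : B.E) 1 → B.E, H = fun p =>
      ⟪B.C.e, (p.2 : B.E)⟫_ℝ • B.C.e +
        Real.cos (Real.pi * p.1) • ((p.2 : B.E) - ⟪B.C.e, (p.2 : B.E)⟫_ℝ • B.C.e) +
        Real.sin (Real.pi * p.1) • T p.2 := ⟨_, rfl⟩
  have hHc : Continuous H := by
    rw [hH]; fun_prop
  have hHn : ∀ p, ‖H p‖ = 1 := fun p => by
    obtain ⟨s, x, hx⟩ := p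
    have hx : ‖x‖ = 1 := by simpa using hx
    have h1 : ‖H (s, ⟨x, hx ▸ by simpa using hx⟩)‖ ^ 2 = 1 := by
      have h3 := congrArg (· ^ 2) (hTn x)
      have he := B.C.norm_e
      have hTe := hTe x
      have hTx := hTx x
      simp only [hH]
      generalize T x = y at *
      generalize B.C.e = e at *
      generalize ht : ⟪e, x⟫_ℝ = t at *
      have he1 : ⟪e, e⟫_ℝ = 1 := by rw [real_inner_self_eq_norm_sq, he]; norm_num
      have hx1 : ⟪x, x⟫_ℝ = 1 := by rw [real_inner_self_eq_norm_sq, hx]; norm_num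
      have ht2 : ⟪x, e⟫_ℝ = t := by rw [real_inner_comm, ht]
      have hTe2 : ⟪y, e⟫_ℝ = 0 := by rw [real_inner_comm, hTe]
      have hTx2 : ⟪y, x⟫_ℝ = 0 := by rw [real_inner_comm, hTx]
      simp only [← real_inner_self_eq_norm_sq, inner_add_left, inner_add_right, inner_sub_left,
        inner_sub_right, real_inner_smul_left, real_inner_smul_right, he1, hx1, ht, ht2, hTe, hTe2,
        hTx, hTx2] at h3 ⊢
      rw [h3]
      have := Real.sin_sq_add_cos_sq (Real.pi * s)
      linear_combination (1 - t ^ 2) * this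
    exact (pow_eq_one_iff_of_nonneg (norm_nonneg _) two_ne_zero).1 h1
  have hC := B.C.continuous
  have h1 : B.sphereFun.val (fun x => B.C.β x) = B.sphereFun.val (fun x => (B.C.β x)ᴴ) := by
    refine B.sphereFun.homotopy (G := fun p => B.C.β (H p))
      ⟨hC.comp hHc, fun p => B.C.isUnit (hHn p)⟩ (fun x => ?_) fun x => ?_
    · rw [hH]
      simp
    · rw [hH, ← B.C.map_flip, Cl.flip]
      simp only [Set.Icc.coe_one, mul_one, Real.cos_pi, Real.sin_pi, zero_smul, add_zero]
      congr 1
      module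
  have hx : ∀ x : Metric.sphere (0 : B.E) 1, ‖(x : B.E)‖ = 1 := fun x => by simp
  have h2 : IsGL fun x : Metric.sphere (0 : B.E) 1 => B.C.β x :=
    ⟨hC.comp continuous_subtype_val, fun x => B.C.isUnit (hx x)⟩
  have h3 : ∀ x : Metric.sphere (0 : B.E) 1, B.C.β x * (B.C.β x)ᴴ = 1 := fun x => by
    rw [B.C.mul_star, hx]; simp
  have h4 : IsGL fun x : Metric.sphere (0 : B.E) 1 => (B.C.β x)ᴴ :=
    ⟨h2.1.matrix_conjTranspose, fun x => (h2.2 x).star⟩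
  have h5 := B.sphereFun.of_mul_eq_one h2 h4 h3
  rw [← h1, B.sphereFun_val] at h5
  omega

end
end SphereParallel

namespace SphereParallel

open Matrix unitInterval Filter Topology
open scoped InnerProductSpace

section

theorem linearIndependent_cons_of_orthogonal {V : Type} [NormedAddCommGroup V]
    [InnerProductSpace ℝ V] {n : ℕ} {x : V} (hx : x ≠ 0) {b : Fin n → V}
    (h : ∀ i, ⟪x, b i⟫_ℝ = 0) (hb : LinearIndependent ℝ b) :
    LinearIndependent ℝ (Fin.cons x b : Fin (n + 1) → V) := by
  refine linearIndependent_finCons.2 ⟨hb, fun hm => hx ?_⟩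
  have h1 : Submodule.span ℝ (Set.range b) ≤ (ℝ ∙ x)ᗮ := by
    rw [Submodule.span_le]
    rintro _ ⟨i, rfl⟩
    exact Submodule.mem_orthogonal_singleton_iff_inner_right.2 (h i)
  exact inner_self_eq_zero.1 (Submodule.mem_orthogonal_singleton_iff_inner_right.1 (h1 hm))

theorem continuous_gramSchmidt {Z V : Type} [TopologicalSpace Z] [NormedAddCommGroup V]
    [InnerProductSpace ℝ V] {n : ℕ} {F : Z → Fin n → V} (hF : ∀ i, Continuous fun z => F z i)
    (hli : ∀ z, LinearIndependent ℝ (F z)) (j : Fin n) :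
    Continuous fun z => InnerProductSpace.gramSchmidt ℝ (F z) j := by
  induction j using WellFoundedLT.induction with
  | ind j ih =>
    have h : (fun z => InnerProductSpace.gramSchmidt ℝ (F z) j) = fun z =>
        F z j - ∑ i ∈ Finset.Iio j, (⟪InnerProductSpace.gramSchmidt ℝ (F z) i, F z j⟫_ℝ /
          ‖InnerProductSpace.gramSchmidt ℝ (F z) i‖ ^ 2) •
          InnerProductSpace.gramSchmidt ℝ (F z) i := by
      funext z
      rw [InnerProductSpace.gramSchmidt_def]
      congr 1
      refine Finset.sum_congr rfl fun i _ => ?_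
      rw [Submodule.starProjection_singleton]
      simp
    rw [h]
    refine (hF j).sub (continuous_finsetSum _ fun i hi => ?_)
    have hi := ih i (Finset.mem_Iio.1 hi)
    refine ((hi.inner (hF j)).div (hi.norm.pow 2) fun z => ?_).smul hi
    exact pow_ne_zero _ (norm_ne_zero_iff.2 (InnerProductSpace.gramSchmidt_ne_zero i (hli z)))

theorem exists_frame {V : Type} [NormedAddCommGroup V] [InnerProductSpace ℝ V] {n : ℕ}
    (b : Metric.sphere (0 : V) 1 → Fin n → V) (hb : ∀ i, Continuous fun x => b x i)
    (ho : ∀ (x : Metric.sphere (0 : V) 1) i, ⟪(x : V), b x i⟫_ℝ = 0)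
    (hli : ∀ x, LinearIndependent ℝ (b x)) :
    ∃ f : Fin (n + 1) → Metric.sphere (0 : V) 1 → V, (∀ j, Continuous (f j)) ∧
      (∀ x, f 0 x = x) ∧ ∀ x, Orthonormal ℝ fun j => f j x := by
  have hx : ∀ x : Metric.sphere (0 : V) 1, ‖(x : V)‖ = 1 := fun x => by simp
  have hli' : ∀ x : Metric.sphere (0 : V) 1,
      LinearIndependent ℝ (Fin.cons (x : V) (b x) : Fin (n + 1) → V) := fun x =>
    linearIndependent_cons_of_orthogonal (fun h => by simpa [h] using hx x) (ho x) (hli x)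
  have hc : ∀ j, Continuous fun x : Metric.sphere (0 : V) 1 =>
      (Fin.cons (x : V) (b x) : Fin (n + 1) → V) j := fun j => by
    refine Fin.cases ?_ (fun i => ?_) j
    · exact continuous_subtype_val
    · exact hb i
  refine ⟨fun j x => InnerProductSpace.gramSchmidtNormed ℝ
    (Fin.cons (x : V) (b x) : Fin (n + 1) → V) j, fun j => ?_, fun x => ?_, fun x =>
      InnerProductSpace.gramSchmidtNormed_orthonormal (hli' x)⟩
  · have h1 := continuous_gramSchmidt hc hli' j
    exact (h1.norm.inv₀ fun x => norm_ne_zero_iff.2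
      (InnerProductSpace.gramSchmidt_ne_zero j (hli' x))).smul h1
  · have h0 : InnerProductSpace.gramSchmidt ℝ (Fin.cons (x : V) (b x) : Fin (n + 1) → V) 0 = x := by
      rw [InnerProductSpace.gramSchmidt_def]
      have : Finset.Iio (0 : Fin (n + 1)) = ∅ := by ext j; simp
      simp [this]
    simp [InnerProductSpace.gramSchmidtNormed, h0, hx]

variable {E : Type} [NormedAddCommGroup E] [InnerProductSpace ℝ E] {e : E}

theorem norm_suspend (he : ‖e‖ = 1) (t : ℝ) (y : Metric.sphere (0 : (ℝ ∙ e)ᗮ) 1) :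
    ‖Real.cos t • e + Real.sin t • ((y : (ℝ ∙ e)ᗮ) : E)‖ = 1 := by
  obtain ⟨⟨y, hy⟩, hy1⟩ := y
  have hy1 : ‖y‖ = 1 := by simpa using hy1
  have h0 : ⟪e, y⟫_ℝ = 0 := Submodule.mem_orthogonal_singleton_iff_inner_right.1 hy
  have h0' : ⟪y, e⟫_ℝ = 0 := by rw [real_inner_comm, h0]
  have h1 : ⟪e, e⟫_ℝ = 1 := by rw [real_inner_self_eq_norm_sq, he]; norm_num
  have h2 : ⟪y, y⟫_ℝ = 1 := by rw [real_inner_self_eq_norm_sq, hy1]; norm_num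
  refine (pow_eq_one_iff_of_nonneg (norm_nonneg _) two_ne_zero).1 ?_
  simp only [← real_inner_self_eq_norm_sq, inner_add_left, inner_add_right,
    real_inner_smul_left, real_inner_smul_right, h0, h0', h1, h2]
  linear_combination Real.sin_sq_add_cos_sq t

/-- The suspension coordinates on the unit sphere with poles `e` and `-e`. -/
noncomputable def suspend (he : ‖e‖ = 1) (p : I × Metric.sphere (0 : (ℝ ∙ e)ᗮ) 1) :
    Metric.sphere (0 : E) 1 :=
  ⟨Real.cos (Real.pi * p.1) • e + Real.sin (Real.pi * p.1) • ((p.2 : (ℝ ∙ e)ᗮ) : E), by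
    simpa using norm_suspend he _ p.2⟩

theorem continuous_suspend (he : ‖e‖ = 1) : Continuous (suspend he) := by
  refine Continuous.subtype_mk ?_ _
  fun_prop

theorem suspend_zero (he : ‖e‖ = 1) (y : Metric.sphere (0 : (ℝ ∙ e)ᗮ) 1) :
    (suspend he (0, y) : E) = e := by simp [suspend]

theorem suspend_one (he : ‖e‖ = 1) (y : Metric.sphere (0 : (ℝ ∙ e)ᗮ) 1) :
    (suspend he (1, y) : E) = -e := by simp [suspend]

theorem suspend_surjective (he : ‖e‖ = 1) [Nonempty (Metric.sphere (0 : (ℝ ∙ e)ᗮ) 1)] :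
    Function.Surjective (suspend he) := by
  rintro ⟨x, hx⟩
  have hx : ‖x‖ = 1 := by simpa using hx
  have h1 : ⟪e, e⟫_ℝ = 1 := by rw [real_inner_self_eq_norm_sq, he]; norm_num
  have h2 : ⟪x, x⟫_ℝ = 1 := by rw [real_inner_self_eq_norm_sq, hx]; norm_num
  obtain ⟨t, ht⟩ : ∃ t, ⟪e, x⟫_ℝ = t := ⟨_, rfl⟩
  have ht' : ⟪x, e⟫_ℝ = t := by rw [real_inner_comm, ht]
  obtain ⟨p, hp⟩ : ∃ p : (ℝ ∙ e)ᗮ, (p : E) = x - t • e :=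
    ⟨⟨x - t • e, Submodule.mem_orthogonal_singleton_iff_inner_right.2 (by
      rw [inner_sub_right, real_inner_smul_right, ht, h1]; ring)⟩, rfl⟩
  have hn : ‖p‖ ^ 2 = 1 - t ^ 2 := by
    rw [Submodule.coe_norm, hp, ← real_inner_self_eq_norm_sq, inner_sub_left, inner_sub_right,
      inner_sub_right, real_inner_smul_left, real_inner_smul_right, real_inner_smul_right,
      real_inner_smul_left, ht, ht', h1, h2]
    ring
  have hab := abs_real_inner_le_norm e x
  rw [he, hx, ht, mul_one, abs_le] at hab
  have hs : Real.sin (Real.arccos t) = ‖p‖ := by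
    rw [Real.sin_arccos, ← hn, Real.sqrt_sq (norm_nonneg _)]
  have hc := Real.cos_arccos hab.1 hab.2
  have hpi : Real.pi * (Real.arccos t / Real.pi) = Real.arccos t :=
    mul_div_cancel₀ _ Real.pi_ne_zero
  obtain ⟨y, hy⟩ : ∃ y : Metric.sphere (0 : (ℝ ∙ e)ᗮ) 1, ‖p‖ • (y : (ℝ ∙ e)ᗮ) = p := by
    by_cases h : p = 0
    · exact ⟨Classical.arbitrary _, by simp [h]⟩
    · have : ‖p‖ ≠ 0 := norm_ne_zero_iff.2 h
      exact ⟨⟨‖p‖⁻¹ • p, by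
        rw [mem_sphere_zero_iff_norm, norm_smul, norm_inv, norm_norm, inv_mul_cancel₀ this]⟩, by
        rw [smul_smul, mul_inv_cancel₀ this, one_smul]⟩
  refine ⟨(⟨Real.arccos t / Real.pi, div_nonneg (Real.arccos_nonneg _) Real.pi_pos.le,
    (div_le_one Real.pi_pos).2 (Real.arccos_le_pi _)⟩, y), Subtype.ext ?_⟩
  simp only [suspend, hpi, hc, hs]
  rw [← Submodule.coe_smul, hy, hp]
  abel

theorem suspend_eq_iff (he : ‖e‖ = 1) {p q : I × Metric.sphere (0 : (ℝ ∙ e)ᗮ) 1}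
    (h : suspend he p = suspend he q) :
    p = q ∨ (p.1 = 0 ∧ q.1 = 0) ∨ (p.1 = 1 ∧ q.1 = 1) := by
  obtain ⟨s, y⟩ := p
  obtain ⟨t, z⟩ := q
  have h1 : ⟪e, e⟫_ℝ = 1 := by rw [real_inner_self_eq_norm_sq, he]; norm_num
  have hy : ⟪e, ((y : (ℝ ∙ e)ᗮ) : E)⟫_ℝ = 0 :=
    Submodule.mem_orthogonal_singleton_iff_inner_right.1 (Subtype.mem _)
  have hz : ⟪e, ((z : (ℝ ∙ e)ᗮ) : E)⟫_ℝ = 0 :=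
    Submodule.mem_orthogonal_singleton_iff_inner_right.1 (Subtype.mem _)
  have h := congrArg Subtype.val h
  simp only [suspend] at h
  have h2 := congrArg (fun v => ⟪e, v⟫_ℝ) h
  simp only [inner_add_right, real_inner_smul_right, h1, hy, hz, mul_one, mul_zero, add_zero] at h2
  have hI : ∀ r : I, Real.pi * r ∈ Set.Icc 0 Real.pi := fun r =>
    ⟨mul_nonneg Real.pi_pos.le r.2.1, mul_le_of_le_one_right Real.pi_pos.le r.2.2⟩
  have h3 := mul_left_cancel₀ Real.pi_ne_zero (Real.injOn_cos (hI s) (hI t) h2)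
  obtain rfl : s = t := Subtype.ext h3
  by_cases hs : Real.sin (Real.pi * s) = 0
  · right
    by_cases h0 : s = 0
    · exact Or.inl ⟨h0, h0⟩
    · by_cases h1 : s = 1
      · exact Or.inr ⟨h1, h1⟩
      · have h0 : 0 < (s : ℝ) := lt_of_le_of_ne s.2.1 fun h => h0 (Subtype.ext h.symm)
        have h1 : (s : ℝ) < 1 := lt_of_le_of_ne s.2.2 fun h => h1 (Subtype.ext h)
        have := Real.sin_pos_of_pos_of_lt_pi (mul_pos Real.pi_pos h0)
          (mul_lt_of_lt_one_right Real.pi_pos h1)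
        exact absurd hs this.ne'
  · left
    have h4 := smul_right_injective E hs (add_left_cancel h)
    rw [Subtype.ext (Subtype.ext h4)]

theorem isQuotientMap_suspend (he : ‖e‖ = 1) [FiniteDimensional ℝ E]
    [Nonempty (Metric.sphere (0 : (ℝ ∙ e)ᗮ) 1)] : IsQuotientMap (suspend he) :=
  (continuous_suspend he).isClosedMap.isQuotientMap (continuous_suspend he) (suspend_surjective he)

end
end SphereParallel

namespace SphereParallel

open Matrix unitInterval Filter Topology
open scoped InnerProductSpace

section

/-- The grading operator. -/
def eps (ι : Type) [DecidableEq ι] : Matrix (ι ⊕ ι) (ι ⊕ ι) ℂ := fromBlocks 1 0 0 (-1)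

theorem eps_mul_eps (ι : Type) [Fintype ι] [DecidableEq ι] : eps ι * eps ι = 1 := by
  simp [eps, fromBlocks_multiply]

theorem eq_of_eps_comm {ι : Type} [Fintype ι] [DecidableEq ι] {M : Matrix (ι ⊕ ι) (ι ⊕ ι) ℂ}
    (h : eps ι * M = M * eps ι) : M = fromBlocks M.toBlocks₁₁ 0 0 M.toBlocks₂₂ := by
  obtain ⟨a, b, c, d, rfl⟩ : ∃ a b c d, M = fromBlocks a b c d :=
    ⟨_, _, _, _, (fromBlocks_toBlocks M).symm⟩
  simp only [eps, fromBlocks_multiply] at h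
  obtain ⟨-, h1, h2, -⟩ := fromBlocks_inj.1 h
  simp only [one_mul, zero_mul, add_zero, mul_zero, mul_neg, mul_one, zero_add, neg_mul] at h1 h2
  have hb : b = 0 := by
    ext i j
    simpa [self_eq_neg] using congrFun (congrFun h1 i) j
  have hc : c = 0 := by
    ext i j
    simpa [neg_eq_self] using congrFun (congrFun h2 i) j
  simp [hb, hc]

variable {E : Type} [NormedAddCommGroup E] [InnerProductSpace ℝ E] {ι : Type} [Fintype ι]
    [DecidableEq ι] (C : Cl E ι)

namespace Cl

/-- The Clifford multiplication with square `‖v‖ ^ 2` built from `β`. -/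
noncomputable def gam : E →ₗ[ℝ] Matrix (ι ⊕ ι) (ι ⊕ ι) ℂ where
  toFun v := fromBlocks 0 (C.β v)ᴴ (C.β v) 0
  map_add' v w := by simp [fromBlocks_add]
  map_smul' r v := by
    rw [RingHom.id_apply, fromBlocks_smul, map_smul, conjTranspose_smul]
    simp

theorem gam_apply (v : E) : C.gam v = fromBlocks 0 (C.β v)ᴴ (C.β v) 0 := rfl

theorem continuous_gam [FiniteDimensional ℝ E] : Continuous C.gam :=
  LinearMap.continuous_of_finiteDimensional _

theorem gam_sq (v : E) : C.gam v * C.gam v = ((‖v‖ ^ 2 : ℝ) : ℂ) • 1 := by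
  rw [gam_apply, fromBlocks_multiply, ← fromBlocks_one, fromBlocks_smul]
  simp only [C.star_mul, C.mul_star, zero_mul, mul_zero, add_zero, zero_add, smul_zero]

theorem gam_sq_of_norm {v : E} (hv : ‖v‖ = 1) : C.gam v * C.gam v = 1 := by
  rw [gam_sq, hv]; simp

theorem gam_add (v w : E) :
    C.gam v * C.gam w + C.gam w * C.gam v = ((2 * ⟪v, w⟫_ℝ : ℝ) : ℂ) • 1 := by
  have h := C.gam_sq (v + w)
  rw [norm_add_sq_real, map_add] at h
  have h2 : C.gam v * C.gam w + C.gam w * C.gam v = (C.gam v + C.gam w) * (C.gam v + C.gam w)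
      - C.gam v * C.gam v - C.gam w * C.gam w := by noncomm_ring
  rw [h2, h, gam_sq, gam_sq]
  push_cast
  module

theorem gam_anticomm {v w : E} (h : ⟪v, w⟫_ℝ = 0) :
    C.gam v * C.gam w = -(C.gam w * C.gam v) := by
  have h2 := C.gam_add v w
  rw [h] at h2
  exact eq_neg_of_add_eq_zero_left (by simpa using h2)

theorem eps_gam (v : E) : eps ι * C.gam v = -(C.gam v * eps ι) := by
  simp [eps, gam_apply, fromBlocks_multiply, fromBlocks_neg]

theorem gam_schur {M : Matrix (ι ⊕ ι) (ι ⊕ ι) ℂ} (h : ∀ v, M * C.gam v = C.gam v * M) :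
    ∃ c : ℂ, M = c • (1 : Matrix (ι ⊕ ι) (ι ⊕ ι) ℂ) := by
  obtain ⟨a, b, c, d, rfl⟩ : ∃ a b c d, M = fromBlocks a b c d :=
    ⟨_, _, _, _, (fromBlocks_toBlocks M).symm⟩
  have h1 : ∀ v, b * C.β v = (C.β v)ᴴ * c ∧ a * (C.β v)ᴴ = (C.β v)ᴴ * d ∧
      d * C.β v = C.β v * a ∧ c * (C.β v)ᴴ = C.β v * b := fun v => by
    have := h v
    simp only [gam_apply, fromBlocks_multiply] at this
    have := fromBlocks_inj.1 this
    simpa using this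
  have h2 := h1 C.e
  simp only [C.map_e, conjTranspose_one, mul_one, one_mul] at h2
  obtain ⟨hbc, had, -, -⟩ := h2
  subst hbc had
  have hb := C.skew b fun v => (h1 v).1
  obtain ⟨z, hz⟩ := C.schur a fun v => (h1 v).2.2.1
  refine ⟨z, ?_⟩
  rw [← fromBlocks_one, fromBlocks_smul, hb, hz]
  simp

end Cl

theorem ext_of_orthonormal {W : Type} [AddCommGroup W] [Module ℝ W] {d : ℕ} [NeZero d]
    (hd : d = Module.finrank ℝ E) {v : Fin d → E} (hv : Orthonormal ℝ v) {L₁ L₂ : E →ₗ[ℝ] W}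
    (h : ∀ j, L₁ (v j) = L₂ (v j)) : L₁ = L₂ := by
  have hcard : Fintype.card (Fin d) = Module.finrank ℝ E := by simpa using hd
  refine (basisOfOrthonormalOfCardEqFinrank hv hcard).ext fun j => ?_
  rw [coe_basisOfOrthonormalOfCardEqFinrank, h]

theorem Cl.gam_comm_of_frame {d : ℕ} [NeZero d] (hd : d = Module.finrank ℝ E) {v : Fin d → E}
    (hv : Orthonormal ℝ v) {M : Matrix (ι ⊕ ι) (ι ⊕ ι) ℂ}
    (h : ∀ j, M * C.gam (v j) = C.gam (v j) * M) (w : E) : M * C.gam w = C.gam w * M :=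
  LinearMap.congr_fun (ext_of_orthonormal hd hv (L₁ := LinearMap.mulLeft ℝ M ∘ₗ C.gam)
    (L₂ := LinearMap.mulRight ℝ M ∘ₗ C.gam) h) w

theorem one_lt_rank_orthogonal [FiniteDimensional ℝ E] {e : E} (he : ‖e‖ = 1)
    (h3 : 3 ≤ Module.finrank ℝ E) : 1 < Module.rank ℝ (ℝ ∙ e)ᗮ := by
  have he0 : e ≠ 0 := fun h => by simp [h] at he
  obtain ⟨n, hn⟩ : ∃ n, Module.finrank ℝ E = n + 1 := ⟨Module.finrank ℝ E - 1, by omega⟩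
  have : Fact (Module.finrank ℝ E = n + 1) := ⟨hn⟩
  rw [← Module.finrank_eq_rank, Submodule.finrank_orthogonal_span_singleton (n := n) he0]
  have : 1 < n := by omega
  exact_mod_cast this

theorem eq_one_of_pow_eq_one {Z : Type} [TopologicalSpace Z] [PreconnectedSpace Z] {c : Z → ℂ}
    (hc : Continuous c) {k : ℕ} (hk : 0 < k) (h : ∀ z, c z ^ k = 1) {z₀ : Z} (h0 : c z₀ = 1)
    (z : Z) : c z = 1 := by
  have hfin : Set.Finite {w : ℂ | w ^ k = 1} := by
    refine Set.Finite.subset (Polynomial.nthRoots k (1 : ℂ)).toFinset.finite_toSet fun w hw => ?_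
    simpa [Polynomial.mem_nthRoots hk] using hw
  rw [← h0]
  exact isPreconnected_univ.constant_of_mapsTo hfin.isDiscrete hc.continuousOn
    (fun z _ => h z) (Set.mem_univ _) (Set.mem_univ _)

/-- The clutching construction: a frame of the sphere lifts to a map to the Clifford group. -/
theorem Cl.exists_clutching [FiniteDimensional ℝ E] {d : ℕ} [NeZero d]
    (hd : d = Module.finrank ℝ E) (h3 : 3 ≤ d) {f : Fin d → Metric.sphere (0 : E) 1 → E}
    (hf : ∀ j, Continuous (f j)) (ho : ∀ x, Orthonormal ℝ fun j => f j x)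
    (e₀ : Metric.sphere (0 : E) 1) (he₀ : (e₀ : E) = C.e) :
    ∃ A : Metric.sphere (0 : E) 1 → Matrix (ι ⊕ ι) (ι ⊕ ι) ℂ, Continuous A ∧
      (∀ x, (A x).det = 1) ∧ (∀ x j, A x * C.gam (f j e₀) = C.gam (f j x) * A x) ∧
      ∀ x, eps ι * A x = A x * eps ι := by
  have he := C.norm_e
  have hrank := one_lt_rank_orthogonal he (hd ▸ h3)
  have : Nontrivial (ℝ ∙ C.e)ᗮ := rank_pos_iff_nontrivial.1 (zero_lt_one.trans hrank)
  have : Nonempty (Metric.sphere (0 : (ℝ ∙ C.e)ᗮ) 1) :=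
    (NormedSpace.sphere_nonempty.2 zero_le_one).to_subtype
  have : PreconnectedSpace (Metric.sphere (0 : (ℝ ∙ C.e)ᗮ) 1) :=
    isPreconnected_iff_preconnectedSpace.1 (isPreconnected_sphere hrank 0 1)
  have := C.nonempty
  have hσ := continuous_suspend he
  have hγ := C.continuous_gam
  obtain ⟨A, hA, hA0, hAdet, hAc, hAM⟩ := transport
    (fun j p => C.gam (f j (suspend he p))) (fun j => hγ.comp ((hf j).comp hσ))
    (fun j p => C.gam_sq_of_norm ((ho _).1 j)) (fun i j => if i = j then 1 else -1)
    (fun i j => by split_ifs <;> norm_num) (fun i j p => by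
      split_ifs with h
      · rw [h, one_smul]
      · rw [neg_one_smul, C.gam_anticomm ((ho _).2 h)])
  have hs0 : ∀ y, suspend he (0, y) = e₀ := fun y => Subtype.ext (by rw [suspend_zero, he₀])
  have hs1 : ∀ y z, suspend he (1, y) = suspend he (1, z) := fun y z =>
    Subtype.ext (by rw [suspend_one, suspend_one])
  have hu : ∀ p, IsUnit (A p).det := fun p => by rw [hAdet]; exact isUnit_one
  have hconst : ∀ y z, A (1, y) = A (1, z) := by
    intro y₀ y
    have hcomm : ∀ z v, ((A (1, y₀))⁻¹ * A (1, z)) * C.gam v =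
        C.gam v * ((A (1, y₀))⁻¹ * A (1, z)) := fun z =>
      C.gam_comm_of_frame hd (ho e₀) fun j => by
        have h1 := hAc j 1 z
        have h2 := hAc j 1 y₀
        simp only [hs0, hs1 z y₀] at h1 h2
        have h3 : C.gam (f j (suspend he (1, y₀))) =
            A (1, y₀) * C.gam (f j e₀) * (A (1, y₀))⁻¹ := by
          rw [h2, Matrix.mul_nonsing_inv_cancel_right _ _ (hu _)]
        rw [mul_assoc, h1, h3, ← mul_assoc, ← mul_assoc, ← mul_assoc,
          Matrix.nonsing_inv_mul _ (hu _), one_mul, mul_assoc]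
    choose c hc using fun z => C.gam_schur (hcomm z)
    have hcc : Continuous c := by
      have h1 : Continuous fun z : Metric.sphere (0 : (ℝ ∙ C.e)ᗮ) 1 =>
          ((A (1, y₀))⁻¹ * A (1, z)) (Sum.inl (Classical.arbitrary ι))
            (Sum.inl (Classical.arbitrary ι)) := by
        refine Continuous.matrix_elem ?_ _ _
        exact continuous_const.matrix_mul (hA.comp (by fun_prop))
      refine h1.congr fun z => ?_
      rw [hc]
      simp
    have hcp : ∀ z, c z ^ Fintype.card (ι ⊕ ι) = 1 := fun z => by
      have h1 := congrArg Matrix.det (hc z)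
      rw [det_mul, det_nonsing_inv, hAdet, hAdet, det_smul, det_one] at h1
      simpa using h1.symm
    have hc0 : c y₀ = 1 := by
      have h1 := hc y₀
      rw [Matrix.nonsing_inv_mul _ (hu _)] at h1
      have h2 := congrFun (congrFun h1 (Sum.inl (Classical.arbitrary ι)))
        (Sum.inl (Classical.arbitrary ι))
      simpa using h2.symm
    have h4 := hc y
    rw [eq_one_of_pow_eq_one hcc Fintype.card_pos hcp hc0 y, one_smul] at h4
    have h5 := congrArg (A (1, y₀) * ·) h4
    simp only [mul_one] at h5
    rw [← h5, ← mul_assoc, Matrix.mul_nonsing_inv _ (hu _), one_mul]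
  have hfac : Function.FactorsThrough A (suspend he) := by
    rintro ⟨s, y⟩ ⟨t, z⟩ h
    obtain h | ⟨h1, h2⟩ | ⟨h1, h2⟩ := suspend_eq_iff he h
    · rw [h]
    · simp only at h1 h2
      rw [h1, h2, hA0, hA0]
    · simp only at h1 h2
      rw [h1, h2, hconst]
  have hQ := isQuotientMap_suspend he
  obtain ⟨A', hA', hAA⟩ : ∃ A' : Metric.sphere (0 : E) 1 → Matrix (ι ⊕ ι) (ι ⊕ ι) ℂ,
      Continuous A' ∧ ∀ p, A' (suspend he p) = A p :=
    ⟨Topology.IsQuotientMap.lift (f := ⟨suspend he, hσ⟩) hQ ⟨A, hA⟩ hfac,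
      ContinuousMap.continuous _,
      fun p => DFunLike.congr_fun
        (Topology.IsQuotientMap.lift_comp (f := ⟨suspend he, hσ⟩) hQ ⟨A, hA⟩ hfac) p⟩
  refine ⟨A', hA', fun x => ?_, fun x j => ?_, fun x => ?_⟩ <;>
    obtain ⟨⟨t, y⟩, rfl⟩ := suspend_surjective he x
  · rw [hAA, hAdet]
  · have := hAc j t y
    rw [hs0] at this
    rw [hAA, this]
  · rw [hAA]
    exact hAM _ (fun j => Or.inr fun p => C.eps_gam _) _

end
end SphereParallel

namespace SphereParallel

open Matrix unitInterval Filter Topology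
open scoped InnerProductSpace Kronecker

section

variable {κ : Type} [Fintype κ] [DecidableEq κ]

theorem neg_t3 (a b c : Matrix κ κ ℂ) : t3 (-a) b c = -t3 a b c := by
  ext i j; simp [t3]

theorem t3_neg_mid (a b c : Matrix κ κ ℂ) : t3 a (-b) c = -t3 a b c := by
  ext i j; simp [t3]

theorem t3_neg_right (a b c : Matrix κ κ ℂ) : t3 a b (-c) = -t3 a b c := by
  ext i j; simp [t3]

theorem add_t3 (a a' b c : Matrix κ κ ℂ) : t3 (a + a') b c = t3 a b c + t3 a' b c := by
  ext i j; simp [t3]; ring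

theorem t3_add_mid (a b b' c : Matrix κ κ ℂ) : t3 a (b + b') c = t3 a b c + t3 a b' c := by
  ext i j; simp [t3]; ring

theorem t3_add_right (a b c c' : Matrix κ κ ℂ) : t3 a b (c + c') = t3 a b c + t3 a b c' := by
  ext i j; simp [t3]; ring

theorem smul_t3 {R : Type} [SMul R ℂ] [IsScalarTower R ℂ ℂ] (r : R) (a b c : Matrix κ κ ℂ) :
    t3 (r • a) b c = r • t3 a b c := by
  ext i j; simp [t3, smul_mul_assoc]

theorem t3_smul_mid {R : Type} [SMul R ℂ] [IsScalarTower R ℂ ℂ] [SMulCommClass R ℂ ℂ] (r : R)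
    (a b c : Matrix κ κ ℂ) : t3 a (r • b) c = r • t3 a b c := by
  ext i j; simp [t3, mul_smul_comm, smul_mul_assoc]

theorem t3_smul_right {R : Type} [SMul R ℂ] [IsScalarTower R ℂ ℂ] [SMulCommClass R ℂ ℂ] (r : R)
    (a b c : Matrix κ κ ℂ) : t3 a b (r • c) = r • t3 a b c := by
  ext i j; simp [t3, mul_smul_comm]

variable {E : Type} [NormedAddCommGroup E] [InnerProductSpace ℝ E]

theorem anticommutator_sum {J : Type} [Fintype J] [DecidableEq J] {a : J → E →ₗ[ℝ] Matrix κ κ ℂ}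
    (h1 : ∀ i k v w, i ≠ k → a i v * a k w + a k w * a i v = 0)
    (h2 : ∀ i v w, a i v * a i w + a i w * a i v = ((2 * ⟪v, w⟫_ℝ : ℝ) : ℂ) • 1) (r : J → ℝ)
    (v w : E) : (∑ i, r i • a i) v * (∑ i, r i • a i) w + (∑ i, r i • a i) w * (∑ i, r i • a i) v =
      (((∑ i, r i ^ 2) * (2 * ⟪v, w⟫_ℝ) : ℝ) : ℂ) • 1 := by
  have h3 : (∑ i, r i • a i) v * (∑ i, r i • a i) w + (∑ i, r i • a i) w * (∑ i, r i • a i) v =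
      ∑ i, ∑ k, (r i * r k) • (a i v * a k w + a k w * a i v) := by
    simp only [LinearMap.sum_apply, LinearMap.smul_apply, Finset.sum_mul_sum, smul_mul_smul_comm]
    rw [Finset.sum_comm (f := fun i k => (r i * r k) • (a i w * a k v)), ← Finset.sum_add_distrib]
    refine Finset.sum_congr rfl fun i _ => ?_
    rw [← Finset.sum_add_distrib]
    refine Finset.sum_congr rfl fun k _ => ?_
    rw [mul_comm (r k), smul_add]
  have h4 : ∀ i, ∑ k, (r i * r k) • (a i v * a k w + a k w * a i v) =
      (((r i ^ 2) * (2 * ⟪v, w⟫_ℝ) : ℝ) : ℂ) • (1 : Matrix κ κ ℂ) := fun i => by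
    rw [Finset.sum_eq_single i (fun k _ hk => by rw [h1 i k v w hk.symm, smul_zero])
      (fun h => absurd (Finset.mem_univ i) h), h2, ← Complex.coe_smul, smul_smul]
    push_cast
    ring_nf
  rw [h3, Finset.sum_congr rfl fun i _ => h4 i, ← Finset.sum_smul, Finset.sum_mul]
  push_cast
  rfl

end

section

variable {E : Type} [NormedAddCommGroup E] [InnerProductSpace ℝ E] {ι : Type} [Fintype ι]
    [DecidableEq ι] (C : Cl E ι)

namespace Cl

/-- Three anticommuting Clifford multiplications on the threefold tensor product, permuted by
the cyclic permutation. -/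
noncomputable def leg : Fin 3 →
    E →ₗ[ℝ] Matrix ((ι ⊕ ι) × (ι ⊕ ι) × (ι ⊕ ι)) ((ι ⊕ ι) × (ι ⊕ ι) × (ι ⊕ ι)) ℂ :=
  ![{ toFun := fun v => t3 (C.gam v) (eps ι) 1
      map_add' := fun v w => by rw [map_add, add_t3]
      map_smul' := fun r v => by rw [map_smul, smul_t3, RingHom.id_apply] },
    { toFun := fun v => t3 1 (C.gam v) (eps ι)
      map_add' := fun v w => by rw [map_add, t3_add_mid]
      map_smul' := fun r v => by rw [map_smul, t3_smul_mid, RingHom.id_apply] },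
    { toFun := fun v => t3 (eps ι) 1 (C.gam v)
      map_add' := fun v w => by rw [map_add, t3_add_right]
      map_smul' := fun r v => by rw [map_smul, t3_smul_right, RingHom.id_apply] }]

theorem leg_zero (v : E) : C.leg 0 v = t3 (C.gam v) (eps ι) 1 := rfl

theorem leg_one (v : E) : C.leg 1 v = t3 1 (C.gam v) (eps ι) := rfl

theorem leg_two (v : E) : C.leg 2 v = t3 (eps ι) 1 (C.gam v) := rfl

theorem leg_anticomm_aux (v w : E) : C.leg 0 v * C.leg 1 w + C.leg 1 w * C.leg 0 v = 0 ∧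
    C.leg 1 v * C.leg 2 w + C.leg 2 w * C.leg 1 v = 0 ∧
    C.leg 2 v * C.leg 0 w + C.leg 0 w * C.leg 2 v = 0 := by
  simp only [leg_zero, leg_one, leg_two, t3_mul, mul_one, one_mul, eps_gam, neg_t3, t3_neg_mid,
    t3_neg_right, neg_add_cancel, and_self]

theorem leg_anticomm (i k : Fin 3) (v w : E) (h : i ≠ k) :
    C.leg i v * C.leg k w + C.leg k w * C.leg i v = 0 := by
  obtain ⟨h1, h2, h3⟩ := C.leg_anticomm_aux v w
  obtain ⟨h4, h5, h6⟩ := C.leg_anticomm_aux w v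
  rw [add_comm] at h4 h5 h6
  fin_cases i <;> fin_cases k <;> first | exact absurd rfl h | assumption

theorem leg_clifford (i : Fin 3) (v w : E) :
    C.leg i v * C.leg i w + C.leg i w * C.leg i v = ((2 * ⟪v, w⟫_ℝ : ℝ) : ℂ) • 1 := by
  have h := C.gam_add v w
  have h2 := eps_mul_eps ι
  fin_cases i
  · change C.leg 0 v * C.leg 0 w + C.leg 0 w * C.leg 0 v = _
    simp only [leg_zero, t3_mul, mul_one, h2, ← add_t3, h, smul_t3, t3_one]
  · change C.leg 1 v * C.leg 1 w + C.leg 1 w * C.leg 1 v = _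
    simp only [leg_one, t3_mul, mul_one, h2, ← t3_add_mid, h, t3_smul_mid, t3_one]
  · change C.leg 2 v * C.leg 2 w + C.leg 2 w * C.leg 2 v = _
    simp only [leg_two, t3_mul, mul_one, h2, ← t3_add_right, h, t3_smul_right, t3_one]

theorem cyc_mul_leg (v : E) : cyc (ι ⊕ ι) * C.leg 0 v = C.leg 2 v * cyc (ι ⊕ ι) ∧
    cyc (ι ⊕ ι) * C.leg 1 v = C.leg 0 v * cyc (ι ⊕ ι) ∧
    cyc (ι ⊕ ι) * C.leg 2 v = C.leg 1 v * cyc (ι ⊕ ι) :=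
  ⟨cyc_mul_t3 _ _ _, cyc_mul_t3 _ _ _, cyc_mul_t3 _ _ _⟩

theorem cube_mul_leg {A : Matrix (ι ⊕ ι) (ι ⊕ ι) ℂ} {v w : E}
    (h : A * C.gam v = C.gam w * A) (he : eps ι * A = A * eps ι) (i : Fin 3) :
    cube A * C.leg i v = C.leg i w * cube A := by
  fin_cases i
  · change cube A * C.leg 0 v = C.leg 0 w * cube A
    simp only [cube, leg_zero, t3_mul, h, he, one_mul, mul_one]
  · change cube A * C.leg 1 v = C.leg 1 w * cube A
    simp only [cube, leg_one, t3_mul, h, he, one_mul, mul_one]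
  · change cube A * C.leg 2 v = C.leg 2 w * cube A
    simp only [cube, leg_two, t3_mul, h, he, one_mul, mul_one]

/-- The combination of the three multiplications with given coefficients. -/
noncomputable def tri (r : Fin 3 → ℝ) :
    E →ₗ[ℝ] Matrix ((ι ⊕ ι) × (ι ⊕ ι) × (ι ⊕ ι)) ((ι ⊕ ι) × (ι ⊕ ι) × (ι ⊕ ι)) ℂ :=
  ∑ i, r i • C.leg i

theorem tri_apply (r : Fin 3 → ℝ) (v : E) :
    C.tri r v = r 0 • C.leg 0 v + r 1 • C.leg 1 v + r 2 • C.leg 2 v := by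
  simp [tri, Fin.sum_univ_three]

theorem tri_clifford (r : Fin 3 → ℝ) (v w : E) : C.tri r v * C.tri r w + C.tri r w * C.tri r v =
    (((∑ i, r i ^ 2) * (2 * ⟪v, w⟫_ℝ) : ℝ) : ℂ) • 1 :=
  anticommutator_sum C.leg_anticomm C.leg_clifford r v w

theorem cube_mul_tri {A : Matrix (ι ⊕ ι) (ι ⊕ ι) ℂ} {v w : E}
    (h : A * C.gam v = C.gam w * A) (he : eps ι * A = A * eps ι) (r : Fin 3 → ℝ) :
    cube A * C.tri r v = C.tri r w * cube A := by
  simp only [tri_apply, mul_add, add_mul, Matrix.mul_smul, Matrix.smul_mul, C.cube_mul_leg h he]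

theorem cyc_mul_tri (s : ℝ) (v : E) :
    cyc (ι ⊕ ι) * C.tri (fun _ => s) v = C.tri (fun _ => s) v * cyc (ι ⊕ ι) := by
  obtain ⟨h0, h1, h2⟩ := C.cyc_mul_leg v
  simp only [tri_apply, mul_add, add_mul, Matrix.mul_smul, Matrix.smul_mul, h0, h1, h2]
  abel

theorem es_mul_tri (ζ : ℂ) (s : ℝ) (v : E) :
    es (ι ⊕ ι) ζ * C.tri (fun _ => s) v = C.tri (fun _ => s) v * es (ι ⊕ ι) ζ :=
  commute_spr (C.cyc_mul_tri s v)

/-- Moving the symmetric combination to the first leg. -/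
theorem exists_rotate {d : ℕ} [NeZero d] (hd : d = Module.finrank ℝ E) {v : Fin d → E}
    (hv : Orthonormal ℝ v) : ∃ s : ℝ,
      ∃ M : Matrix ((ι ⊕ ι) × (ι ⊕ ι) × (ι ⊕ ι)) ((ι ⊕ ι) × (ι ⊕ ι) × (ι ⊕ ι)) ℂ,
        IsUnit M ∧ ∀ w, M * C.leg 0 w = C.tri (fun _ => s) w * M := by
  obtain ⟨r, hr, hr1, hr0, h11⟩ : ∃ r : I → Fin 3 → ℝ, (∀ i, Continuous fun t => r t i) ∧
      (∀ t, ∑ i, r t i ^ 2 = 1) ∧ (r 0 = ![1, 0, 0]) ∧ ∃ s, r 1 = fun _ => s := by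
    have hp : ∀ t : I, 0 < 1 + 2 * (t : ℝ) ^ 2 := fun t => by positivity
    refine ⟨fun t => (Real.sqrt (1 + 2 * (t : ℝ) ^ 2))⁻¹ • ![1, (t : ℝ), (t : ℝ)], fun i => ?_,
      fun t => ?_, ?_, (Real.sqrt (1 + 2 * ((1 : I) : ℝ) ^ 2))⁻¹, ?_⟩
    · have h1 : Continuous fun t : I => (Real.sqrt (1 + 2 * (t : ℝ) ^ 2))⁻¹ :=
        Continuous.inv₀ (by fun_prop) fun t => (Real.sqrt_pos.2 (hp t)).ne'
      have h2 : Continuous fun t : I => (![1, (t : ℝ), (t : ℝ)] : Fin 3 → ℝ) i := by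
        fin_cases i
        · exact continuous_const
        · exact continuous_subtype_val
        · exact continuous_subtype_val
      exact h1.mul h2
    · have h1 := Real.sq_sqrt (hp t).le
      have h2 := (Real.sqrt_pos.2 (hp t)).ne'
      simp only [Fin.sum_univ_three, Pi.smul_apply, smul_eq_mul, mul_pow, inv_pow, h1]
      simp
      field_simp
      ring
    · simp
    · funext i
      fin_cases i <;> simp
  obtain ⟨s, hs⟩ := h11
  obtain ⟨A, -, -, hdet, hA, -⟩ := transport (X := Unit) (fun j p => C.tri (r p.1) (v j))
    (fun j => by
      simp only [tri_apply]
      have h := fun i => (hr i).comp (continuous_fst (X := I) (Y := Unit))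
      exact (((h 0).smul continuous_const).add ((h 1).smul continuous_const)).add
        ((h 2).smul continuous_const))
    (fun j p => by
      have h := C.tri_clifford (r p.1) (v j) (v j)
      rw [hr1, real_inner_self_eq_norm_sq, hv.1 j, ← two_smul ℂ] at h
      have h2 : (2 : ℂ) • (C.tri (r p.1) (v j) * C.tri (r p.1) (v j)) = (2 : ℂ) • 1 := by
        rw [h]; norm_num
      exact smul_right_injective _ (two_ne_zero' ℂ) h2)
    (fun i j => if i = j then 1 else -1)
    (fun i j => by split_ifs <;> norm_num) (fun i j p => by
      split_ifs with h
      · rw [h, one_smul]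
      · have h2 := C.tri_clifford (r p.1) (v i) (v j)
        rw [hv.2 h] at h2
        rw [neg_one_smul]
        exact eq_neg_of_add_eq_zero_left (by simpa using h2))
  refine ⟨s, A (1, ()), (Matrix.isUnit_iff_isUnit_det _).2 (by rw [hdet]; exact isUnit_one), ?_⟩
  intro w
  refine LinearMap.congr_fun (ext_of_orthonormal hd hv
    (L₁ := LinearMap.mulLeft ℝ (A (1, ())) ∘ₗ C.leg 0)
    (L₂ := LinearMap.mulRight ℝ (A (1, ())) ∘ₗ C.tri (fun _ => s)) fun j => ?_) w
  have h := hA j 1 ()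
  simp only [hr0, hs] at h
  rw [C.tri_apply ![1, 0, 0]] at h
  simpa using h

/-- The symmetric combination is equivalent to the action on the first tensor factor. -/
theorem exists_untwist {d : ℕ} [NeZero d] (hd : d = Module.finrank ℝ E) {v : Fin d → E}
    (hv : Orthonormal ℝ v) : ∃ s : ℝ,
      ∃ W : Matrix ((ι ⊕ ι) × (ι ⊕ ι) × (ι ⊕ ι)) ((ι ⊕ ι) × (ι ⊕ ι) × (ι ⊕ ι)) ℂ,
        IsUnit W ∧ ∀ w, W * t3 (C.gam w) 1 1 = C.tri (fun _ => s) w * W := by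
  obtain ⟨s, M, hM, h⟩ := C.exists_rotate hd hv
  obtain ⟨p, q, hpp, hqq, hpq, hqp, hep, heq, hs⟩ : ∃ p q : Matrix (ι ⊕ ι) (ι ⊕ ι) ℂ,
      p * p = p ∧ q * q = q ∧ p * q = 0 ∧ q * p = 0 ∧ eps ι * p = p ∧ eps ι * q = -q ∧
        p + q = 1 :=
    ⟨fromBlocks 1 0 0 0, fromBlocks 0 0 0 1, by simp [fromBlocks_multiply],
      by simp [fromBlocks_multiply], by simp [fromBlocks_multiply], by simp [fromBlocks_multiply],
      by simp [eps, fromBlocks_multiply], by simp [eps, fromBlocks_multiply, fromBlocks_neg],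
      by simp [fromBlocks_add]⟩
  have hK : (t3 1 p 1 + t3 (eps ι) q 1) * (t3 1 p 1 + t3 (eps ι) q 1) = 1 := by
    simp only [mul_add, add_mul, t3_mul, one_mul, mul_one, hpp, hqq, hpq, hqp, eps_mul_eps,
      t3_zero_mid, add_zero, zero_add]
    rw [← t3_add_mid, hs, t3_one]
  refine ⟨s, M * (t3 1 p 1 + t3 (eps ι) q 1), hM.mul (isUnit_of_mul_eq_one hK), fun w => ?_⟩
  rw [← mul_assoc, ← h, mul_assoc, mul_assoc]
  congr 1
  simp only [leg_zero, mul_add, add_mul, t3_mul, one_mul, mul_one, hep, heq, eps_gam, neg_t3,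
    t3_neg_mid]

end Cl

end
end SphereParallel

namespace SphereParallel

open Matrix unitInterval Filter Topology
open scoped InnerProductSpace Kronecker

section

variable {κ L : Type} [Fintype κ] [DecidableEq κ] [Fintype L] [DecidableEq L]

/-- The block of a matrix on a tensor product with prescribed first indices. -/
def slice (k : κ) (D : Matrix (κ × L) (κ × L) ℂ) : Matrix L L ℂ :=
  D.submatrix (fun l => (k, l)) (fun l => (k, l))

theorem slice_one_kronecker (k : κ) (B : Matrix L L ℂ) :
    slice k ((1 : Matrix κ κ ℂ) ⊗ₖ B) = B := by
  ext i j; simp [slice]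

theorem one_kronecker_injective (k : κ) {B B' : Matrix L L ℂ}
    (h : (1 : Matrix κ κ ℂ) ⊗ₖ B = (1 : Matrix κ κ ℂ) ⊗ₖ B') : B = B' := by
  rw [← slice_one_kronecker k B, h, slice_one_kronecker]

theorem continuous_slice {Y : Type} [TopologicalSpace Y] (k : κ)
    {D : Y → Matrix (κ × L) (κ × L) ℂ} (hD : Continuous D) : Continuous fun y => slice k (D y) :=
  hD.matrix_submatrix _ _

end

section

variable {Y : Type} [TopologicalSpace Y] {ι κ L : Type} [Fintype ι] [DecidableEq ι] [Fintype κ]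
  [DecidableEq κ] [Fintype L] [DecidableEq L]

theorem Cl.eq_one_kronecker {E : Type} [NormedAddCommGroup E] [InnerProductSpace ℝ E]
    (C : Cl E ι) (k : ι ⊕ ι) {D : Matrix ((ι ⊕ ι) × L) ((ι ⊕ ι) × L) ℂ}
    (h : ∀ v, D * (C.gam v ⊗ₖ (1 : Matrix L L ℂ)) = (C.gam v ⊗ₖ (1 : Matrix L L ℂ)) * D) :
    D = (1 : Matrix (ι ⊕ ι) (ι ⊕ ι) ℂ) ⊗ₖ slice k D := by
  have h1 : ∀ l l' v, (D.submatrix (fun i => (i, l)) (fun i => (i, l'))) * C.gam v =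
      C.gam v * (D.submatrix (fun i => (i, l)) (fun i => (i, l'))) := fun l l' v => by
    ext i j
    have h2 := congrFun (congrFun (h v) (i, l)) (j, l')
    simpa [Matrix.mul_apply, Fintype.sum_prod_type, Matrix.one_apply, eq_comm] using h2
  choose c hc using fun l l' => C.gam_schur (h1 l l')
  ext ⟨i, l⟩ ⟨j, l'⟩
  have h2 : ∀ i j, D (i, l) (j, l') = (c l l' • (1 : Matrix (ι ⊕ ι) (ι ⊕ ι) ℂ)) i j := fun i j => by
    rw [← hc]; rfl
  rw [h2, kroneckerMap_apply, slice, submatrix_apply, h2]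
  simp [Matrix.one_apply]

/-- Invariance under rectangular conjugation. -/
theorem GLFun.compress (μ : GLFun Y) {G : Y → Matrix κ κ ℂ} (hG : IsGL G) {u : Matrix ι κ ℂ}
    {v : Matrix κ ι ℂ} (h : v * u = 1) :
    μ.val (fun y => 1 - u * v + u * G y * v) = μ.val G := by
  have := μ.corner (E := fun _ => (1 : Matrix κ κ ℂ)) isIdem_one hG (fun y => by simp)
    (u := fun _ => u) (v := fun _ => v) continuous_const continuous_const (fun _ => h)
    (fun _ => by simp) (fun _ => by simp)
  rw [this]
  exact μ.congr fun y => by simp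

theorem GLFun.kronecker_one (μ : GLFun Y) {G : Y → Matrix ι ι ℂ} (hG : IsGL G) :
    μ.val (fun y => G y ⊗ₖ (1 : Matrix L L ℂ)) = Fintype.card L * μ.val G := by
  have h := μ.blockDiagonal (K := L) (g := fun _ => G) fun _ => hG
  rw [Finset.sum_const, Finset.card_univ, nsmul_eq_mul] at h
  rw [← h]
  exact μ.congr fun y => Matrix.kronecker_one _

theorem IsGL.kronecker_one {G : Y → Matrix ι ι ℂ} (hG : IsGL G) :
    IsGL fun y => G y ⊗ₖ (1 : Matrix L L ℂ) := by
  refine IsGL.of_mul (h := fun y => (G y)⁻¹ ⊗ₖ (1 : Matrix L L ℂ)) ?_ fun y => ?_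
  · refine continuous_matrix fun i j => ?_
    simp only [Matrix.kroneckerMap_apply]
    exact (hG.1.matrix_elem _ _).mul continuous_const
  · rw [← Matrix.mul_kronecker_mul, hG.mul_inv, mul_one, Matrix.one_kronecker_one]

theorem GLFun.one_kronecker (μ : GLFun Y) {G : Y → Matrix ι ι ℂ} (hG : IsGL G) :
    μ.val (fun y => (1 : Matrix L L ℂ) ⊗ₖ G y) = Fintype.card L * μ.val G := by
  rw [← μ.kronecker_one hG]
  have h := μ.compress (hG.kronecker_one (L := L))
    (u := (1 : Matrix (ι × L) (ι × L) ℂ).submatrix Prod.swap id)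
    (v := (1 : Matrix (ι × L) (ι × L) ℂ).submatrix id Prod.swap) (by
      have h0 := Matrix.submatrix_mul_equiv (1 : Matrix (ι × L) (ι × L) ℂ)
        (1 : Matrix (ι × L) (ι × L) ℂ) id (Equiv.prodComm L ι) id
      rw [mul_one, Matrix.submatrix_id_id] at h0
      exact h0)
  rw [← h]
  have h1 : (1 : Matrix (ι × L) (ι × L) ℂ).submatrix Prod.swap id *
      (1 : Matrix (ι × L) (ι × L) ℂ).submatrix id Prod.swap = 1 := by
    ext i j
    simp [Matrix.mul_apply, Matrix.one_apply]
  refine μ.congr fun y => ?_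
  rw [h1, sub_self, zero_add]
  ext ⟨l, i⟩ ⟨m, j⟩
  have h2 := Matrix.one_submatrix_mul (Prod.swap : L × ι → ι × L) (Equiv.refl (ι × L))
    (G y ⊗ₖ (1 : Matrix L L ℂ))
  have h3 := Matrix.mul_submatrix_one (Equiv.refl (ι × L)) (Prod.swap : L × ι → ι × L)
    ((G y ⊗ₖ (1 : Matrix L L ℂ)).submatrix ((Equiv.refl (ι × L)).symm ∘ Prod.swap) id)
  rw [Equiv.coe_refl] at h2 h3
  rw [h2, h3]
  simp [mul_comm]

theorem exists_rank_factorization {p : Matrix L L ℂ} (hp : p * p = p) :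
    ∃ (u : Matrix L (Fin p.rank) ℂ) (v : Matrix (Fin p.rank) L ℂ), u * v = p ∧ v * u = 1 := by
  obtain ⟨b⟩ : Nonempty (Module.Basis (Fin p.rank) ℂ (LinearMap.range p.mulVecLin)) :=
    ⟨Module.finBasis ℂ _⟩
  refine ⟨LinearMap.toMatrix' ((LinearMap.range p.mulVecLin).subtype ∘ₗ
    b.equivFun.symm.toLinearMap), LinearMap.toMatrix' (b.equivFun.toLinearMap ∘ₗ
    p.mulVecLin.rangeRestrict), ?_, ?_⟩
  · rw [← LinearMap.toMatrix'_comp]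
    conv_rhs => rw [← LinearMap.toMatrix'_toLin' p]
    congr 1
    ext x
    simp
  · rw [← LinearMap.toMatrix'_comp, ← LinearMap.toMatrix'_id]
    congr 1
    refine LinearMap.ext fun x => ?_
    have h1 : p.mulVecLin.rangeRestrict ((b.equivFun.symm x : LinearMap.range p.mulVecLin) : L → ℂ)
        = b.equivFun.symm x := by
      obtain ⟨y, hy⟩ := (b.equivFun.symm x).2
      ext1
      rw [← hy]
      simp [hp]
    exact (congrArg b.equivFun h1).trans (b.equivFun.apply_symm_apply x)

theorem GLFun.kronecker_idem (μ : GLFun Y) {G : Y → Matrix ι ι ℂ} (hG : IsGL G)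
    {p : Matrix L L ℂ} (hp : p * p = p) :
    μ.val (fun y => 1 - (1 : Matrix ι ι ℂ) ⊗ₖ p + G y ⊗ₖ p) = p.rank * μ.val G := by
  obtain ⟨u, v, huv, hvu⟩ := exists_rank_factorization hp
  have h1 := μ.kronecker_one (L := Fin p.rank) hG
  rw [Fintype.card_fin] at h1
  rw [← h1, ← μ.compress (hG.kronecker_one (L := Fin p.rank)) (u := (1 : Matrix ι ι ℂ) ⊗ₖ u)
    (v := (1 : Matrix ι ι ℂ) ⊗ₖ v) (by
      rw [← Matrix.mul_kronecker_mul, hvu, mul_one, Matrix.one_kronecker_one])]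
  refine μ.congr fun y => ?_
  simp only [← Matrix.mul_kronecker_mul, mul_one, one_mul, Matrix.mul_one, huv]

end

end SphereParallel

namespace SphereParallel

open Matrix unitInterval Filter Topology
open scoped InnerProductSpace Kronecker

section

variable {Y : Type} [TopologicalSpace Y] {κ L : Type} [Fintype κ] [DecidableEq κ] [Fintype L]
  [DecidableEq L]

theorem isUnit_of_one_kronecker (k : κ) {B : Matrix L L ℂ}
    (h : IsUnit ((1 : Matrix κ κ ℂ) ⊗ₖ B)) : IsUnit B := by
  rw [Matrix.isUnit_iff_isUnit_det, Matrix.det_kronecker, Matrix.det_one, one_pow, one_mul] at h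
  have : Nonempty κ := ⟨k⟩
  exact (Matrix.isUnit_iff_isUnit_det _).2 ((isUnit_pow_iff Fintype.card_ne_zero).1 h)

theorem isIdem_one_kronecker {p : Matrix L L ℂ} (hp : p * p = p) :
    IsIdem fun _ : Y => (1 : Matrix κ κ ℂ) ⊗ₖ p :=
  ⟨continuous_const, fun _ => by rw [← Matrix.mul_kronecker_mul, hp, mul_one]⟩

theorem IsGL.kronecker {A : Y → Matrix κ κ ℂ} {B : Y → Matrix L L ℂ} (hA : IsGL A)
    (hB : IsGL B) : IsGL fun y => A y ⊗ₖ B y := by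
  refine IsGL.of_mul (h := fun y => (A y)⁻¹ ⊗ₖ (B y)⁻¹) ?_ fun y => ?_
  · refine continuous_matrix fun i j => ?_
    simp only [Matrix.kroneckerMap_apply]
    exact (hA.1.matrix_elem _ _).mul (hB.1.matrix_elem _ _)
  · rw [← Matrix.mul_kronecker_mul, hA.mul_inv, hB.mul_inv, Matrix.one_kronecker_one]

/-- The class of a projection twisted tensor product. -/
theorem GLFun.val_corner_kronecker (μ : GLFun Y) {A : Y → Matrix κ κ ℂ} {B : Y → Matrix L L ℂ}
    (hA : IsGL A) (hB : IsGL B) {p : Matrix L L ℂ} (hp : p * p = p) (hc : ∀ y, p * B y = B y * p) :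
    μ.val (fun y => 1 - (1 : Matrix κ κ ℂ) ⊗ₖ p + (1 : Matrix κ κ ℂ) ⊗ₖ p * (A y ⊗ₖ B y)) =
      p.rank * μ.val A + Fintype.card κ * μ.val (fun y => 1 - p + p * B y) := by
  have hpc : IsIdem fun _ : Y => p := ⟨continuous_const, fun _ => hp⟩
  have hB' : IsGL fun y => 1 - p + p * B y := IsGL.corner hpc hB hc
  have hP := isIdem_one_kronecker (Y := Y) (κ := κ) hp
  have hA1 := hA.kronecker_one (L := L)
  have hcA : ∀ y, (1 : Matrix κ κ ℂ) ⊗ₖ p * (A y ⊗ₖ (1 : Matrix L L ℂ)) =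
      A y ⊗ₖ (1 : Matrix L L ℂ) * ((1 : Matrix κ κ ℂ) ⊗ₖ p) := fun y => by
    simp only [← Matrix.mul_kronecker_mul, mul_one, one_mul]
  have h1 := μ.kronecker_idem hA hp
  have h2 := μ.one_kronecker (L := κ) hB'
  have hG1 : IsGL fun y => 1 - (1 : Matrix κ κ ℂ) ⊗ₖ p +
      (1 : Matrix κ κ ℂ) ⊗ₖ p * (A y ⊗ₖ (1 : Matrix L L ℂ)) := IsGL.corner hP hA1 hcA
  have h3 : μ.val (fun y => 1 - (1 : Matrix κ κ ℂ) ⊗ₖ p +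
      (1 : Matrix κ κ ℂ) ⊗ₖ p * (A y ⊗ₖ (1 : Matrix L L ℂ))) = p.rank * μ.val A := by
    rw [← h1]
    exact μ.congr fun y => by rw [← Matrix.mul_kronecker_mul, one_mul, mul_one]
  rw [← h3, ← h2, ← μ.mul' hG1 (isGL_one.kronecker hB')]
  refine μ.congr fun y => ?_
  have e : (1 : Matrix κ κ ℂ) ⊗ₖ (1 - p + p * B y) =
      1 - (1 : Matrix κ κ ℂ) ⊗ₖ p + (1 : Matrix κ κ ℂ) ⊗ₖ p * ((1 : Matrix κ κ ℂ) ⊗ₖ B y) := by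
    rw [← Matrix.mul_kronecker_mul, mul_one, Matrix.kronecker_add, ← Matrix.one_kronecker_one]
    congr 1
    rw [eq_sub_iff_add_eq, ← Matrix.kronecker_add, sub_add_cancel]
  have e' := corner_mul (H := (1 : Matrix κ κ ℂ) ⊗ₖ B y) (hP.2 y) (hcA y)
  rw [e, e', ← Matrix.mul_kronecker_mul (A y), mul_one, one_mul]

/-- The isotypic classes of a clutching function whose tensor cube is untwisted. -/
theorem GLFun.val_psi_of_untwist (μ : GLFun Y) (k : κ) {A : Y → Matrix κ κ ℂ}
    {B : Y → Matrix (κ × κ) (κ × κ) ℂ} (hA : IsGL A) (hB : IsGL B)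
    {W : Matrix (κ × κ × κ) (κ × κ × κ) ℂ} (hW : IsUnit W)
    (h : ∀ y, W * (A y ⊗ₖ B y) = cube (A y) * W) {ζ : ℂ} (hζ : ζ ^ 3 = 1)
    {p : Matrix (κ × κ) (κ × κ) ℂ} (hp : W * ((1 : Matrix κ κ ℂ) ⊗ₖ p) = es κ ζ * W) :
    p * p = p ∧ (p.trace * Fintype.card κ = (es κ ζ).trace) ∧
      μ.val (psi ζ A) = p.rank * μ.val A + Fintype.card κ * μ.val (fun y => 1 - p + p * B y) := by
  have hpp : p * p = p := one_kronecker_injective k <| hW.mul_left_cancel <| by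
    have e : (1 : Matrix κ κ ℂ) ⊗ₖ (p * p) =
        ((1 : Matrix κ κ ℂ) ⊗ₖ p) * ((1 : Matrix κ κ ℂ) ⊗ₖ p) := by
      rw [← Matrix.mul_kronecker_mul, mul_one]
    rw [e, ← mul_assoc, hp, mul_assoc, hp, ← mul_assoc, es_idem hζ]
  have hc : ∀ y, p * B y = B y * p := fun y => one_kronecker_injective k <| by
    have h1 : A y ⊗ₖ (p * B y) = A y ⊗ₖ (B y * p) := hW.mul_left_cancel <| by
      have e1 : A y ⊗ₖ (p * B y) = ((1 : Matrix κ κ ℂ) ⊗ₖ p) * (A y ⊗ₖ B y) := by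
        rw [← Matrix.mul_kronecker_mul, one_mul]
      have e2 : A y ⊗ₖ (B y * p) = (A y ⊗ₖ B y) * ((1 : Matrix κ κ ℂ) ⊗ₖ p) := by
        rw [← Matrix.mul_kronecker_mul, mul_one]
      rw [e1, e2, ← mul_assoc, hp, mul_assoc, h, ← mul_assoc, ← mul_assoc, h, mul_assoc _ W, hp,
        ← mul_assoc, es_mul_cube]
    have h2 := congrArg (fun M => ((A y)⁻¹ ⊗ₖ (1 : Matrix (κ × κ) (κ × κ) ℂ)) * M) h1
    simpa only [← Matrix.mul_kronecker_mul, hA.inv_mul, one_mul] using h2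
  refine ⟨hpp, ?_, ?_⟩
  · have h1 : (1 : Matrix κ κ ℂ) ⊗ₖ p = W⁻¹ * (es κ ζ * W) := by
      rw [← hp, ← mul_assoc, Matrix.nonsing_inv_mul _ ((Matrix.isUnit_iff_isUnit_det _).1 hW),
        one_mul]
    have h2 := congrArg Matrix.trace h1
    rw [Matrix.trace_kronecker, Matrix.trace_one, Matrix.trace_mul_comm, mul_assoc,
      Matrix.mul_nonsing_inv _ ((Matrix.isUnit_iff_isUnit_det _).1 hW), mul_one] at h2
    rw [← h2, mul_comm]
  · rw [← μ.val_corner_kronecker hA hB hpp hc]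
    have hAB := hA.kronecker hB
    refine (μ.conj (IsGL.corner (isIdem_one_kronecker hpp) hAB fun y => ?_) (isGL_psi hζ hA)
      (W := fun _ => W) ⟨continuous_const, fun _ => hW⟩ fun y => ?_).symm
    · rw [← Matrix.mul_kronecker_mul, ← Matrix.mul_kronecker_mul, hc, one_mul, mul_one]
    · simp only [psi, mul_add, add_mul, mul_sub, sub_mul, mul_one, one_mul]
      rw [← mul_assoc, hp, mul_assoc, h, ← mul_assoc]

/-- The third Adams operation on a clutching function whose tensor cube is untwisted. -/
theorem GLFun.psi3_of_untwist (μ : GLFun Y) (k : κ) {A : Y → Matrix κ κ ℂ}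
    {B : Y → Matrix (κ × κ) (κ × κ) ℂ} (hA : IsGL A) (hB : IsGL B)
    {W : Matrix (κ × κ × κ) (κ × κ × κ) ℂ} (hW : IsUnit W)
    (h : ∀ y, W * (A y ⊗ₖ B y) = cube (A y) * W)
    {p : ℂ → Matrix (κ × κ) (κ × κ) ℂ} (hp : ∀ ζ, W * ((1 : Matrix κ κ ℂ) ⊗ₖ p ζ) = es κ ζ * W) :
    ∃ z : ℤ, μ.psi3.val A = μ.val A + Fintype.card κ * z := by
  have : Nonempty κ := ⟨k⟩
  obtain ⟨i1, t1, v1⟩ := μ.val_psi_of_untwist k hA hB hW h (one_pow 3) (hp 1)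
  obtain ⟨i2, t2, v2⟩ := μ.val_psi_of_untwist k hA hB hW h om_cube (hp om)
  have ht := trace_es_sub (one_mul (1 : Matrix κ κ ℂ))
  rw [cube_one, mul_one, mul_one, Matrix.trace_one, ← t1, ← t2, ← sub_mul, ← rank_eq_trace i1,
    ← rank_eq_trace i2] at ht
  have h0 : (Fintype.card κ : ℂ) ≠ 0 := Nat.cast_ne_zero.2 Fintype.card_ne_zero
  have h1 := (mul_eq_right₀ h0).1 ht
  have h2 : ((p 1).rank : ℤ) - (p om).rank = 1 := by exact_mod_cast h1
  refine ⟨μ.val (fun y => 1 - p 1 + p 1 * B y) - μ.val (fun y => 1 - p om + p om * B y), ?_⟩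
  change μ.val (psi 1 A) - μ.val (psi om A) = _
  rw [v1, v2]
  linear_combination μ.val A * h2

end

section

variable {E : Type} [NormedAddCommGroup E] [InnerProductSpace ℝ E] {ι : Type} [Fintype ι]
  [DecidableEq ι] (C : Cl E ι)

/-- Clifford multiplication on the first factor of the threefold tensor product. -/
noncomputable def Cl.firstLeg :
    E →ₗ[ℝ] Matrix ((ι ⊕ ι) × (ι ⊕ ι) × (ι ⊕ ι)) ((ι ⊕ ι) × (ι ⊕ ι) × (ι ⊕ ι)) ℂ where
  toFun v := t3 (C.gam v) 1 1
  map_add' v w := by rw [map_add, add_t3]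
  map_smul' r v := by rw [map_smul, smul_t3, RingHom.id_apply]

theorem Cl.psi3_clutching (μ : GLFun (Metric.sphere (0 : E) 1)) {d : ℕ} [NeZero d]
    (hd : d = Module.finrank ℝ E)
    {f : Fin d → Metric.sphere (0 : E) 1 → E} (ho : ∀ x, Orthonormal ℝ fun j => f j x)
    (e₀ : Metric.sphere (0 : E) 1) {A : Metric.sphere (0 : E) 1 → Matrix (ι ⊕ ι) (ι ⊕ ι) ℂ}
    (hA : IsGL A) (hAf : ∀ x j, A x * C.gam (f j e₀) = C.gam (f j x) * A x)
    (hAe : ∀ x, eps ι * A x = A x * eps ι) :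
    ∃ z : ℤ, μ.psi3.val A = μ.val A + Fintype.card (ι ⊕ ι) * z := by
  obtain ⟨k⟩ : Nonempty (ι ⊕ ι) := by
    have := C.nonempty
    infer_instance
  obtain ⟨s, W, hW, hWt⟩ := C.exists_untwist hd (ho e₀)
  have hW' := (Matrix.isUnit_iff_isUnit_det _).1 hW
  have ht3 : ∀ a : Matrix (ι ⊕ ι) (ι ⊕ ι) ℂ, t3 a 1 1 =
      a ⊗ₖ (1 : Matrix ((ι ⊕ ι) × (ι ⊕ ι)) ((ι ⊕ ι) × (ι ⊕ ι)) ℂ) := fun a => by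
    rw [t3, Matrix.one_kronecker_one]
  have hWg : ∀ w, W * (C.gam w ⊗ₖ (1 : Matrix ((ι ⊕ ι) × (ι ⊕ ι)) ((ι ⊕ ι) × (ι ⊕ ι)) ℂ)) =
      C.tri (fun _ => s) w * W := fun w => by rw [← ht3, hWt]
  have hWi : ∀ w, W⁻¹ * C.tri (fun _ => s) w =
      (C.gam w ⊗ₖ (1 : Matrix ((ι ⊕ ι) × (ι ⊕ ι)) ((ι ⊕ ι) × (ι ⊕ ι)) ℂ)) * W⁻¹ := fun w => by
    have h := congrArg (fun M => W⁻¹ * M * W⁻¹) (hWg w)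
    simp only [← mul_assoc, Matrix.nonsing_inv_mul _ hW', one_mul] at h
    rw [h, mul_assoc _ W, Matrix.mul_nonsing_inv _ hW', mul_one]
  have hp : ∀ ζ, W * ((1 : Matrix (ι ⊕ ι) (ι ⊕ ι) ℂ) ⊗ₖ slice k (W⁻¹ * es (ι ⊕ ι) ζ * W)) =
      es (ι ⊕ ι) ζ * W := fun ζ => by
    rw [← C.eq_one_kronecker k fun v => ?_, mul_assoc W⁻¹, ← mul_assoc W,
      Matrix.mul_nonsing_inv _ hW', one_mul]
    rw [mul_assoc, hWg, mul_assoc, ← mul_assoc (es _ _), C.es_mul_tri, ← mul_assoc, ← mul_assoc,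
      hWi, mul_assoc, mul_assoc, mul_assoc]
  obtain ⟨D, hDdef⟩ : ∃ D : Metric.sphere (0 : E) 1 → Matrix ((ι ⊕ ι) × (ι ⊕ ι) × (ι ⊕ ι))
    ((ι ⊕ ι) × (ι ⊕ ι) × (ι ⊕ ι)) ℂ, D = fun x => W⁻¹ * cube (A x) * W *
      ((A x)⁻¹ ⊗ₖ (1 : Matrix ((ι ⊕ ι) × (ι ⊕ ι)) ((ι ⊕ ι) × (ι ⊕ ι)) ℂ)) := ⟨_, rfl⟩
  have hD : IsGL D := by
    rw [hDdef]
    have hWc : IsGL fun _ : Metric.sphere (0 : E) 1 => W := ⟨continuous_const, fun _ => hW⟩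
    exact ((hWc.inv.mul hA.cube).mul hWc).mul hA.inv.kronecker_one
  have hDk : ∀ x, D x = (1 : Matrix (ι ⊕ ι) (ι ⊕ ι) ℂ) ⊗ₖ slice k (D x) := fun x => by
    refine C.eq_one_kronecker k fun v => ?_
    have hj : ∀ j, D x * t3 (C.gam (f j x)) 1 1 = t3 (C.gam (f j x)) 1 1 * D x := fun j => by
      have h1 : (A x)⁻¹ * C.gam (f j x) = C.gam (f j e₀) * (A x)⁻¹ := by
        have h := congrArg (fun M => (A x)⁻¹ * M * (A x)⁻¹) (hAf x j)
        simp only [← mul_assoc, hA.inv_mul, one_mul] at h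
        rw [h, mul_assoc _ (A x), hA.mul_inv, mul_one]
      rw [ht3, hDdef]
      simp only []
      rw [mul_assoc, ← Matrix.mul_kronecker_mul, h1, Matrix.mul_kronecker_mul, mul_assoc,
        ← mul_assoc W, hWg, mul_assoc, ← mul_assoc (cube _), ← mul_assoc (cube _),
        C.cube_mul_tri (hAf x j) (hAe x)]
      simp only [← mul_assoc, hWi]
    rw [← ht3]
    exact LinearMap.congr_fun (ext_of_orthonormal hd (ho x)
      (L₁ := LinearMap.mulLeft ℝ (D x) ∘ₗ C.firstLeg)
      (L₂ := LinearMap.mulRight ℝ (D x) ∘ₗ C.firstLeg) hj) v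
  have hB : IsGL fun x => slice k (D x) :=
    ⟨continuous_slice k hD.1, fun x => isUnit_of_one_kronecker k (by rw [← hDk]; exact hD.2 x)⟩
  refine μ.psi3_of_untwist k hA hB hW (fun x => ?_) hp
  have h1 : A x ⊗ₖ slice k (D x) = ((1 : Matrix (ι ⊕ ι) (ι ⊕ ι) ℂ) ⊗ₖ slice k (D x)) *
      (A x ⊗ₖ (1 : Matrix ((ι ⊕ ι) × (ι ⊕ ι)) ((ι ⊕ ι) × (ι ⊕ ι)) ℂ)) := by
    rw [← Matrix.mul_kronecker_mul, mul_one, one_mul]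
  rw [h1, ← hDk, hDdef]
  simp only []
  rw [mul_assoc _ _ (A x ⊗ₖ _), ← Matrix.mul_kronecker_mul, hA.inv_mul, mul_one,
    Matrix.one_kronecker_one, mul_one, ← mul_assoc, ← mul_assoc, Matrix.mul_nonsing_inv _ hW',
    one_mul]

end

end SphereParallel

namespace SphereParallel

open Matrix unitInterval Filter Topology
open scoped InnerProductSpace Kronecker

theorem two_pow_dvd_three_pow_sub_one {N : ℕ} (h0 : N ≠ 0) (h : 2 ^ N ∣ 3 ^ N - 1) :
    N = 1 ∨ N = 2 ∨ N = 4 := by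
  rcases Nat.even_or_odd N with he | ⟨k, rfl⟩
  · have h1 := Nat.two_pow_sub_pow (x := 3) (y := 1) (by norm_num) (by norm_num) he
    rw [one_pow, show (3 + 1 : ℕ) = 2 ^ 2 from rfl, show (3 - 1 : ℕ) = 2 ^ 1 from rfl,
      Nat.prime_two.emultiplicity_pow_self, Nat.prime_two.emultiplicity_pow_self] at h1
    rw [pow_dvd_iff_le_emultiplicity] at h
    have hN : N < 5 := by
      by_contra! hN
      obtain ⟨j, rfl⟩ : ∃ j, N = j + 5 := ⟨N - 5, by omega⟩
      have h2 : 2 ^ (j + 3) ∣ j + 5 := by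
        rw [pow_dvd_iff_le_emultiplicity]
        have h4 : ((j + 3 : ℕ) : ℕ∞) + 3 ≤ emultiplicity 2 (j + 5) + 3 := by
          calc ((j + 3 : ℕ) : ℕ∞) + 3 = ((j + 5 : ℕ) : ℕ∞) + 1 := by norm_cast
            _ ≤ emultiplicity 2 (3 ^ (j + 5) - 1) + 1 := by gcongr
            _ = _ := by rw [h1, add_comm]; norm_num
        exact (ENat.add_le_add_iff_right (by simp)).1 h4
      have h3 := Nat.le_of_dvd (by omega) h2
      have h4 := Nat.lt_two_pow_self (n := j)
      rw [pow_add] at h3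
      omega
    interval_cases N <;> simp_all
    exact absurd he (by decide)
  · left
    by_contra hk
    have h1 : 2 ^ 2 ∣ 3 ^ (2 * k + 1) - 1 := (pow_dvd_pow 2 (by omega)).trans h
    have h2 : 9 ^ k % 4 = 1 := by rw [Nat.pow_mod]; simp
    rw [pow_succ 3, pow_mul] at h1
    norm_num at h1
    omega

theorem BottData.not_frame {m : ℕ} (B : BottData m) {d : ℕ} [NeZero d]
    (hd : d = Module.finrank ℝ B.E) (h3 : 3 ≤ d) {f : Fin d → Metric.sphere (0 : B.E) 1 → B.E}
    (hf : ∀ j, Continuous (f j)) (hf0 : ∀ x, f 0 x = x)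
    (ho : ∀ x, Orthonormal ℝ fun j => f j x) : 2 ^ (m + 1) ∣ 3 ^ (m + 1) - 1 := by
  obtain ⟨e₀, he₀⟩ : ∃ e₀ : Metric.sphere (0 : B.E) 1, (e₀ : B.E) = B.C.e :=
    ⟨⟨B.C.e, by simp [B.C.norm_e]⟩, rfl⟩
  obtain ⟨A, hAc, hAd, hAf, hAe⟩ := B.C.exists_clutching hd h3 hf ho e₀ he₀
  have hA : IsGL A :=
    ⟨hAc, fun x => (Matrix.isUnit_iff_isUnit_det _).2 (by rw [hAd]; exact isUnit_one)⟩
  obtain ⟨z, hz⟩ := B.C.psi3_clutching B.sphereFun hd ho e₀ hA hAf hAe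
  rw [B.sphereFun_psi3 hA, Fintype.card_sum, B.card] at hz
  have hblock : ∀ x : Metric.sphere (0 : B.E) 1,
      (A x).toBlocks₂₂ = B.C.β x * (A x).toBlocks₁₁ := fun x => by
    have h := hAf x 0
    rw [hf0, hf0, he₀, eq_of_eps_comm (hAe x), B.C.gam_apply, B.C.gam_apply, B.C.map_e,
      fromBlocks_multiply, fromBlocks_multiply] at h
    simpa using congrArg toBlocks₂₁ h
  have ha : IsGL fun x => (A x).toBlocks₁₁ := by
    refine ⟨hAc.matrix_submatrix _ _, fun x => (Matrix.isUnit_iff_isUnit_det _).2 ?_⟩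
    have h := hAd x
    rw [eq_of_eps_comm (hAe x), Matrix.det_fromBlocks_zero₁₂] at h
    exact IsUnit.of_mul_eq_one _ h
  have hβ : IsGL fun x : Metric.sphere (0 : B.E) 1 => B.C.β x :=
    ⟨B.C.continuous.comp continuous_subtype_val, fun x => B.C.isUnit (by simp)⟩
  have hval : B.sphereFun.val A = 2 * B.sphereFun.val (fun x => (A x).toBlocks₁₁) + 1 := by
    rw [B.sphereFun.congr fun x => show A x = fromBlocks (A x).toBlocks₁₁ 0 0
      (B.C.β x * (A x).toBlocks₁₁) by rw [← hblock]; exact eq_of_eps_comm (hAe x),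
      B.sphereFun.block ha (hβ.mul ha), B.sphereFun.mul' hβ ha, B.sphereFun_val]
    ring
  rw [hval] at hz
  have h1 : (2 : ℤ) ^ (m + 1) ∣ (3 ^ (m + 1) - 1) *
      (2 * B.sphereFun.val (fun x => (A x).toBlocks₁₁) + 1) := by
    refine ⟨z, ?_⟩
    push_cast at hz
    linear_combination hz
  have h2 : (2 : ℤ) ^ (m + 1) ∣ 3 ^ (m + 1) - 1 := by
    refine IsCoprime.dvd_of_dvd_mul_right (IsCoprime.pow_left ?_) h1
    exact ⟨-B.sphereFun.val (fun x => (A x).toBlocks₁₁), 1, by ring⟩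
  have h4 : 1 ≤ 3 ^ (m + 1) := Nat.one_le_pow _ _ (by norm_num)
  exact_mod_cast (by push_cast [h4]; exact h2 :
    ((2 ^ (m + 1) : ℕ) : ℤ) ∣ ((3 ^ (m + 1) - 1 : ℕ) : ℤ))

/-- A parallelizable sphere of odd dimension `2 * m + 1`. -/
theorem two_pow_dvd_of_frame {m n : ℕ} (hm : 1 ≤ m) (hn : n = 2 * m + 1)
    (b : Metric.sphere (0 : EuclideanSpace ℝ (Fin (n + 1))) 1 → Fin n →
      EuclideanSpace ℝ (Fin (n + 1))) (hb : ∀ i, Continuous fun x => b x i)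
    (ho : ∀ (x : Metric.sphere (0 : EuclideanSpace ℝ (Fin (n + 1))) 1) i,
      ⟪(x : EuclideanSpace ℝ (Fin (n + 1))), b x i⟫_ℝ = 0)
    (hli : ∀ x, LinearIndependent ℝ (b x)) : 2 ^ (m + 1) ∣ 3 ^ (m + 1) - 1 := by
  obtain ⟨f, hf, hf0, hfo⟩ := exists_frame b hb ho hli
  obtain ⟨B⟩ := nonempty_bottData m
  have hd : n + 1 = Module.finrank ℝ B.E := by rw [B.finrank, hn]; ring
  obtain ⟨J⟩ : Nonempty (B.E ≃ₗᵢ[ℝ] EuclideanSpace ℝ (Fin (n + 1))) :=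
    ⟨((stdOrthonormalBasis ℝ B.E).reindex (finCongr hd.symm)).repr⟩
  obtain ⟨j, hj, hjc⟩ : ∃ j : Metric.sphere (0 : B.E) 1 →
      Metric.sphere (0 : EuclideanSpace ℝ (Fin (n + 1))) 1,
      (∀ x : Metric.sphere (0 : B.E) 1, (j x : EuclideanSpace ℝ (Fin (n + 1))) = J x) ∧
        Continuous j :=
    ⟨fun x => ⟨J x, by simp⟩, fun _ => rfl,
      (J.continuous.comp continuous_subtype_val).subtype_mk fun x => by simp⟩
  refine B.not_frame hd (by omega) (f := fun i x => J.symm (f i (j x)))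
    (fun i => J.symm.continuous.comp ((hf i).comp hjc)) (fun x => ?_) fun x => ?_
  · rw [hf0, hj, J.symm_apply_apply]
  · exact (hfo (j x)).comp_linearIsometryEquiv J.symm

end SphereParallel

open scoped RealInnerProductSpace

theorem stmt_10 (n : ℕ) (hn : 2 ≤ n) (h3 : n ≠ 3) (h7 : n ≠ 7) :
    ¬ ∃ b : Metric.sphere (0 : EuclideanSpace ℝ (Fin (n + 1))) 1 →
        Fin n → EuclideanSpace ℝ (Fin (n + 1)),
      (∀ i, Continuous fun x => b x i) ∧
      (∀ (x : Metric.sphere (0 : EuclideanSpace ℝ (Fin (n + 1))) 1) (i : Fin n),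
        ⟪(x : EuclideanSpace ℝ (Fin (n + 1))), b x i⟫ = 0) ∧
      (∀ x, LinearIndependent ℝ (b x)) := by
  rintro ⟨b, hb, ho, hli⟩
  rcases Nat.even_or_odd' n with ⟨k, hk | hk⟩
  · have i : Fin n := ⟨0, by omega⟩
    exact SphereParallel.no_unit_field hk (fun x => b x i) (hb i) (fun x => ho x i)
      fun x => (hli x).ne_zero i
  · have h := SphereParallel.two_pow_dvd_three_pow_sub_one (by omega)
      (SphereParallel.two_pow_dvd_of_frame (by omega) hk b hb ho hli)
    omega
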